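/- arXiv:2503.20137 — 11 statements merged into one kernel-verified Lean document; each statement's English description precedes it below -/
import Mathlib

section
/- Let q be a prime power with q ≡ 1 (mod 4), n = 4q+4, ξ ∈ F_{q^2} a primitive n-th root of unity, and let C ⊆ F_q^n be the cyclic code C = {c ∈ F_q^n : c(1) = c(-1) = c(ξ) = c(ξ^q) = c(ξ^{q+1}) = 0, evaluation in F_{q^2}}. Then C is an (n = 4q+4, d_P = 7)_q MDS symbol-pair code; that is, d_P(C) = 7 and |C| = q^{n-5}. -/
/-- A nonempty set whose pair support under the permutation `σ` has at most six elements has at most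
three elements, or lies in a run of length five, or has four elements among which two are followed by
elements of the set. -/
theorem cases_of_card_pairSupport_le {ι : Type*} [Fintype ι] [DecidableEq ι] (σ : Equiv.Perm ι)
    (hσ : ∀ i, Set.InjOn (fun k : ℕ => (σ⁻¹ ^ k) i) (Set.Iio 7)) (S : Finset ι)
    (hS : S.Nonempty) (hcard : (Finset.univ.filter fun i => i ∈ S ∨ σ i ∈ S).card ≤ 6) :
    S.card ≤ 3 ∨ (∃ a, ∀ s ∈ S, ∃ k < 5, s = (σ ^ k) a) ∨
      (S.card = 4 ∧ ∃ i j, i ≠ j ∧ i ∈ S ∧ σ i ∈ S ∧ j ∈ S ∧ σ j ∈ S) := by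
  have walk : ∀ s : ι, ∀ m ≤ 7, (∀ k < m, (σ⁻¹ ^ k) s ∈ S) → m ≤ S.card := by
    intro s m hm h
    simpa using Finset.card_le_card_of_injOn (s := Finset.range m) (fun k => (σ⁻¹ ^ k) s)
      (fun k hk => h k (by simpa using hk))
      ((hσ s).mono fun k hk => by simp at hk ⊢; omega)
  set T := Finset.univ.filter fun i => i ∈ S ∨ σ i ∈ S with hT
  have hST : S ⊆ T := fun i hi => by simp [hT, hi]
  have step : ∀ s : ι, ∀ k, (σ⁻¹ ^ (k + 1)) s = σ⁻¹ ((σ⁻¹ ^ k) s) := fun s k => by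
    rw [pow_succ']; rfl
  by_cases h3 : S.card ≤ 3
  · exact Or.inl h3
  by_cases h4 : S.card = 4
  · refine Or.inr (Or.inr ⟨h4, ?_⟩)
    have hU : S ∪ S.map σ.symm.toEmbedding = T := by
      ext i; simp [hT, Finset.mem_map_equiv]
    have hc := Finset.card_union_add_card_inter S (S.map σ.symm.toEmbedding)
    rw [hU, Finset.card_map] at hc
    obtain ⟨i, hi, j, hj, hij⟩ := Finset.one_lt_card.1
      (show 1 < (S ∩ S.map σ.symm.toEmbedding).card by omega)
    simp only [Finset.mem_inter, Finset.mem_map_equiv, Equiv.symm_symm] at hi hj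
    exact ⟨i, j, hij, hi.1, hi.2, hj.1, hj.2⟩
  have hsd := Finset.card_sdiff_add_card_eq_card hST
  have hP : ∀ i, i ∉ S → σ i ∈ S → i ∈ T \ S := fun i h h' => by simp [hT, h, h']
  obtain ⟨s₀, hs₀⟩ := hS
  rcases Nat.eq_zero_or_pos (T \ S).card with h0 | h0
  · rw [Finset.card_eq_zero] at h0
    have hall : ∀ k, (σ⁻¹ ^ k) s₀ ∈ S := by
      intro k
      induction k with
      | zero => simpa using hs₀
      | succ k ih =>
        by_contra h
        rw [step] at h
        simpa [h0] using hP _ h (by simpa using ih)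
    have := walk s₀ 7 le_rfl fun k _ => hall k
    omega
  · obtain ⟨p, hp⟩ := Finset.card_eq_one.1 (show (T \ S).card = 1 by omega)
    refine Or.inr (Or.inl ⟨σ p, fun s hs => ?_⟩)
    by_contra! hne
    have hall : ∀ k < 6, (σ⁻¹ ^ k) s ∈ S := by
      intro k
      induction k with
      | zero => intro _; simpa using hs
      | succ k ih =>
        intro hk
        by_contra h
        rw [step] at h
        have h1 := hP _ h (by simpa using ih (by omega))
        rw [hp, Finset.mem_singleton] at h1
        refine hne k (by omega) ?_
        rw [← h1]
        simp
    have := walk s 6 (by omega) hall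
    omega

section Algebra

variable {K : Type*} [Field K]

theorem eq_zero_of_three_moments {a b c x y z : K} (hxy : x ≠ y) (hxz : x ≠ z)
    (h0 : a + b + c = 0) (h1 : a * x + b * y + c * z = 0)
    (h2 : a * x ^ 2 + b * y ^ 2 + c * z ^ 2 = 0) : a = 0 := by
  have h : a * ((x - y) * (x - z)) = 0 := by linear_combination h2 - (y + z) * h1 + y * z * h0
  simpa [sub_eq_zero, hxy, hxz] using h

theorem eq_or_of_pow_four_eq_one {u v w : K} (hw : w ^ 2 = -1) (hu : u ^ 4 = 1) (hv : v ^ 4 = 1) :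
    v = u ∨ v = w * u ∨ v = -u ∨ v = -(w * u) := by
  have h : (v - u) * ((v - w * u) * ((v + u) * (v + w * u))) = 0 := by
    linear_combination hv - hu - (v ^ 2 * u ^ 2 - u ^ 4) * hw
  simp only [mul_eq_zero, sub_eq_zero, add_eq_zero_iff_eq_neg] at h
  exact h

/-- No word of weight three satisfies the five check equations. -/
theorem false_of_weight_three {a b c x y z u v w : K} (ha : a ≠ 0) (hb : b ≠ 0) (hc : c ≠ 0)
    (hx : x ≠ 0) (hy : y ≠ 0) (hz : z ≠ 0) (hxy : x ≠ y) (hxz : x ≠ z)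
    (h0 : a + b + c = 0) (h1 : a * u + b * v + c * w = 0)
    (h2 : a * u ^ 2 + b * v ^ 2 + c * w ^ 2 = 0) (h3 : a * x + b * y + c * z = 0)
    (h4 : a * (u / x) + b * (v / y) + c * (w / z) = 0) (hu : u ≠ 0) : False := by
  by_cases huv : u = v
  · subst huv
    have : c * (u - w) = 0 := by linear_combination u * h0 - h1
    have hw : u = w := by simpa [hc, sub_eq_zero] using this
    subst hw
    refine div_ne_zero ha hx (eq_zero_of_three_moments (a := a / x) (b := b / y) (c := c / z)
      hxy hxz ?_ ?_ ?_)
    · refine mul_left_cancel₀ hu ?_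
      linear_combination h4
    · field_simp
      exact h0
    · field_simp
      linear_combination h3
  · by_cases huw : u = w
    · subst huw
      have : b * (u - v) = 0 := by linear_combination u * h0 - h1
      exact huv (by simpa [hb, sub_eq_zero] using this)
    · exact ha (eq_zero_of_three_moments huv huw h0 h1 h2)

/-- No word supported on two pairs of consecutive positions satisfies the check equations. -/
theorem false_of_two_pairs {a b c d x y u v ξ ω : K} (h2ne : (2 : K) ≠ 0) (hω : ω ^ 2 = -1)
    (hξ0 : ξ ≠ 0) (hξω : ξ ≠ ω) (hξω2 : ξ ^ 2 ≠ ω)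
    (ha : a ≠ 0) (hb : b ≠ 0) (hx : x ≠ 0) (hy : y ≠ 0)
    (hxy : x ≠ y) (hu : u ^ 4 = 1) (hv : v ^ 4 = 1)
    (h0 : a + b + c + d = 0)
    (h1 : a * u + b * (ω * u) + c * v + d * (ω * v) = 0)
    (h2 : a * u ^ 2 + b * (ω * u) ^ 2 + c * v ^ 2 + d * (ω * v) ^ 2 = 0)
    (h3 : a * x + b * (ξ * x) + c * y + d * (ξ * y) = 0)
    (h4 : a * (u / x) + b * (ω * u / (ξ * x)) + c * (v / y) + d * (ω * v / (ξ * y)) = 0) :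
    False := by
  have hu0 : u ≠ 0 := by rintro rfl; simp at hu
  have hω1 : ω ≠ 1 := by
    rintro rfl; exact h2ne (by linear_combination hω)
  have hω0 : ω ≠ 0 := by rintro rfl; simp at hω
  rcases eq_or_of_pow_four_eq_one hω hu hv with rfl | rfl | rfl | rfl
  · have hbd : d = -b := by
      have : (b + d) * (ω - 1) * v = 0 := by linear_combination h1 - v * h0
      have : b + d = 0 := by simpa [hu0, sub_eq_zero, hω1] using this
      linear_combination this
    have hac : c = -a := by linear_combination h0 - hbd
    subst hbd hac
    have e1 : (a + b * ξ) * (x - y) = 0 := by linear_combination h3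
    have e1 : a + b * ξ = 0 := by simpa [sub_eq_zero, hxy] using e1
    have e2 : (a * ξ + b * ω) * (y - x) = 0 := by
      field_simp at h4
      exact mul_left_cancel₀ hu0 (by linear_combination h4)
    have e2 : a * ξ + b * ω = 0 := by simpa [sub_eq_zero, hxy.symm] using e2
    have : b * (ξ ^ 2 - ω) = 0 := by linear_combination ξ * e1 - e2
    exact hξω2 (by simpa [hb, sub_eq_zero] using this)
  · refine ha (eq_zero_of_three_moments (a := a) (b := b + c) (c := d) (x := 1) (y := ω) (z := -1)
      hω1.symm (fun h => h2ne (by linear_combination h)) (by linear_combination h0) ?_ ?_)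
    · refine mul_left_cancel₀ hu0 ?_
      linear_combination h1 - d * u * hω
    · refine mul_left_cancel₀ (pow_ne_zero 2 hu0) ?_
      linear_combination h2 - d * u ^ 2 * (ω ^ 2 - 1) * hω
  · have hac : c = -a := by
      have : 2 * u ^ 2 * (a + c) = 0 := by
        linear_combination h2 + u ^ 2 * h0 - (b + d) * u ^ 2 * hω
      have : a + c = 0 := by simpa [h2ne, hu0] using this
      linear_combination this
    have hbd : d = -b := by linear_combination h0 - hac
    subst hbd hac
    have e : 2 * u * (a + ω * b) = 0 := by linear_combination h1
    have e : a + ω * b = 0 := by simpa [h2ne, hu0] using e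
    have e1 : (a + b * ξ) * (x - y) = 0 := by linear_combination h3
    have e1 : a + b * ξ = 0 := by simpa [sub_eq_zero, hxy] using e1
    have : b * (ξ - ω) = 0 := by linear_combination e1 - e
    exact hξω (by simpa [hb, sub_eq_zero] using this)
  · refine hb (eq_zero_of_three_moments (a := b) (b := a + d) (c := c) (x := ω) (y := 1) (z := -ω)
      hω1 (fun h => mul_ne_zero h2ne hω0 (by linear_combination h)) (by linear_combination h0) ?_ ?_)
    · refine mul_left_cancel₀ hu0 ?_
      linear_combination h1 + d * u * hω
    · refine mul_left_cancel₀ (pow_ne_zero 2 hu0) ?_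
      linear_combination h2 - d * u ^ 2 * (ω ^ 2 - 1) * hω

/-- No word supported on three consecutive positions and a fourth one satisfies the check
equations. -/
theorem false_of_triple_and_single {a b c d x y u v ξ ω : K} (h2ne : (2 : K) ≠ 0)
    (hω : ω ^ 2 = -1) (hξ0 : ξ ≠ 0) (hξ1 : ξ ≠ 1) (hξω : ξ ≠ ω) (hξω2 : ξ ^ 2 ≠ -ω)
    (ha : a ≠ 0) (hb : b ≠ 0) (hx : x ≠ 0) (hy : y ≠ 0)
    (hu : u ^ 4 = 1) (hv : v ^ 4 = 1)
    (h0 : a + b + c + d = 0)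
    (h1 : a * u + b * (ω * u) + c * (ω * (ω * u)) + d * v = 0)
    (h2 : a * u ^ 2 + b * (ω * u) ^ 2 + c * (ω * (ω * u)) ^ 2 + d * v ^ 2 = 0)
    (h3 : a * x + b * (ξ * x) + c * (ξ * (ξ * x)) + d * y = 0)
    (h4 : a * (u / x) + b * (ω * u / (ξ * x)) + c * (ω * (ω * u) / (ξ * (ξ * x)))
      + d * (v / y) = 0) :
    False := by
  have hu0 : u ≠ 0 := by rintro rfl; simp at hu
  have hω1 : ω ≠ 1 := by
    rintro rfl; exact h2ne (by linear_combination hω)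
  have hω1' : ω ≠ -1 := by
    rintro rfl; exact h2ne (by linear_combination hω)
  have h11 : (1 : K) ≠ -1 := fun h => h2ne (by linear_combination h)
  have hw2 : ω * (ω * u) = -u := by linear_combination u * hω
  rw [hw2] at h1 h2 h4
  have hsq : (ω * u) ^ 2 = -u ^ 2 := by linear_combination u ^ 2 * hω
  rcases eq_or_of_pow_four_eq_one hω hu hv with rfl | rfl | rfl | rfl
  · refine hb (eq_zero_of_three_moments (a := b) (b := a + d) (c := c) (x := ω) (y := 1) (z := -1)
      hω1 hω1' (by linear_combination h0) ?_ ?_)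
    · exact mul_left_cancel₀ hu0 (by linear_combination h1)
    · exact mul_left_cancel₀ (pow_ne_zero 2 hu0) (by linear_combination h2)
  · refine ha (eq_zero_of_three_moments (a := a) (b := b + d) (c := c) (x := 1) (y := ω) (z := -1)
      hω1.symm h11 (by linear_combination h0) ?_ ?_)
    · exact mul_left_cancel₀ hu0 (by linear_combination h1)
    · exact mul_left_cancel₀ (pow_ne_zero 2 hu0) (by linear_combination h2)
  · refine ha (eq_zero_of_three_moments (a := a) (b := b) (c := c + d) (x := 1) (y := ω) (z := -1)
      hω1.symm h11 (by linear_combination h0) ?_ ?_)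
    · exact mul_left_cancel₀ hu0 (by linear_combination h1)
    · exact mul_left_cancel₀ (pow_ne_zero 2 hu0) (by linear_combination h2)
  · have hac : c = -a := by
      have : 2 * u ^ 2 * (a + c) = 0 := by
        linear_combination h2 + u ^ 2 * h0 - (b + d) * hsq
      have : a + c = 0 := by simpa [h2ne, hu0] using this
      linear_combination this
    have hbd : d = -b := by linear_combination h0 - hac
    subst hbd hac
    have e : 2 * u * (a + ω * b) = 0 := by linear_combination h1
    have e : a + ω * b = 0 := by simpa [h2ne, hu0] using e
    obtain rfl : b = ω * a := by linear_combination b * hω - ω * e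
    have e1 : x * (1 + ω * ξ - ξ ^ 2) = ω * y :=
      mul_left_cancel₀ ha (by linear_combination h3)
    have e2 : y * (ξ ^ 2 - ξ + 1) = ξ ^ 2 * x := by
      refine mul_left_cancel₀ (mul_ne_zero ha hu0) ?_
      field_simp at h4
      linear_combination h4 - a * u * (y * ξ + x * ξ ^ 2) * hω
    have : x * ((ξ - 1) * ((ξ - ω) * (ξ ^ 2 + ω))) = 0 := by
      linear_combination (-(ξ ^ 2 - ξ + 1)) * e1 - ω * e2 + x * (1 - ξ) * hω
    simp only [mul_eq_zero, hx, sub_eq_zero, hξ1, hξω, false_or] at this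
    exact hξω2 (by linear_combination this)

end Algebra

section Weight

variable {K : Type*} [Field K]

/-- A word of length five vanishing at the five zeros of the code is zero. -/
theorem eq_zero_of_five_zeros {ξ ω : K} (h2ne : (2 : K) ≠ 0) (hω : ω ^ 2 = -1)
    (hξ : ∀ k, 0 < k → k ≤ 8 → ξ ^ k ≠ 1) (hξ0 : ξ ≠ 0) (d : Fin 5 → K)
    (h : ∀ α ∈ ({1, -1, ω, ξ, ω / ξ} : Set K), ∑ k, d k * α ^ (k : ℕ) = 0) : d = 0 := by
  have hω4 : ω ^ 4 = 1 := by linear_combination (ω ^ 2 - 1) * hω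
  have h11 : (1 : K) ≠ -1 := fun h => h2ne (by linear_combination h)
  have hω1 : ω ≠ 1 := by
    rintro rfl; exact h2ne (by linear_combination hω)
  have hω1' : ω ≠ -1 := by
    rintro rfl; exact h2ne (by linear_combination hω)
  have hξ4 : ∀ e : K, e ^ 4 = 1 → ξ ≠ e := by
    rintro e he rfl; exact hξ 4 (by norm_num) (by norm_num) he
  have hξω2 : ξ ≠ ω / ξ := by
    intro h
    rw [eq_div_iff hξ0] at h
    refine hξ 8 (by norm_num) (by norm_num) ?_
    calc ξ ^ 8 = (ξ * ξ) ^ 4 := by ring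
      _ = 1 := by rw [h, hω4]
  have hdiv : ∀ e : K, e ^ 4 = 1 → e ≠ ω / ξ := by
    intro e he h
    rw [eq_div_iff hξ0] at h
    refine hξ 4 (by norm_num) (by norm_num) ?_
    calc ξ ^ 4 = (e * ξ) ^ 4 := by rw [mul_pow, he, one_mul]
      _ = 1 := by rw [h, hω4]
  have a1 := hξ4 1 (by norm_num)
  have a2 := hξ4 (-1) (by norm_num)
  have a3 := hξ4 ω hω4
  have b1 := hdiv 1 (by norm_num)
  have b2 := hdiv (-1) (by norm_num)
  have b3 := hdiv ω hω4
  have hinj : Function.Injective ![1, -1, ω, ξ, ω / ξ] := by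
    intro i j hij
    fin_cases i <;> fin_cases j <;> first
      | rfl
      | (exfalso; simp at hij; first
          | exact h11 hij | exact h11 hij.symm | exact hω1 hij | exact hω1 hij.symm
          | exact hω1' hij | exact hω1' hij.symm | exact a1 hij | exact a1 hij.symm
          | exact a2 hij | exact a2 hij.symm | exact a3 hij | exact a3 hij.symm
          | exact b1 hij | exact b1 hij.symm | exact b2 hij | exact b2 hij.symm
          | exact b3 hij | exact b3 hij.symm | exact hξω2 hij | exact hξω2 hij.symm)
  exact Matrix.eq_zero_of_forall_index_sum_mul_pow_eq_zero hinj fun j =>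
    h (![1, -1, ω, ξ, ω / ξ] j) (by fin_cases j <;> simp)

/-- A nonzero word satisfying the check equations has pair weight at least seven. Position `i` is
recorded by the point `x i` and its norm `u i`, and `σ` is the cyclic successor. -/
theorem seven_le_card_pairSupport {ι : Type*} [Fintype ι] [DecidableEq ι] [DecidableEq K]
    (σ : Equiv.Perm ι) {ξ ω : K} (h2ne : (2 : K) ≠ 0) (hω : ω ^ 2 = -1)
    (hξ : ∀ k, 0 < k → k ≤ 8 → ξ ^ k ≠ 1) (hξ0 : ξ ≠ 0)
    (x u c : ι → K) (hxinj : Function.Injective x) (hx0 : ∀ i, x i ≠ 0) (hu : ∀ i, u i ^ 4 = 1)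
    (hxσ : ∀ i, x (σ i) = ξ * x i) (huσ : ∀ i, u (σ i) = ω * u i) (hc : c ≠ 0)
    (h0 : ∑ i, c i = 0) (h1 : ∑ i, c i * u i = 0) (h2 : ∑ i, c i * u i ^ 2 = 0)
    (h3 : ∑ i, c i * x i = 0) (h4 : ∑ i, c i * (u i / x i) = 0) :
    7 ≤ (Finset.univ.filter fun i => c i ≠ 0 ∨ c (σ i) ≠ 0).card := by
  have hω4 : ω ^ 4 = 1 := by linear_combination (ω ^ 2 - 1) * hω
  have hu0 : ∀ i, u i ≠ 0 := fun i h => by simpa [h] using hu i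
  have hxpow : ∀ k i, x ((σ ^ k) i) = ξ ^ k * x i := by
    intro k
    induction k with
    | zero => simp
    | succ k ih => intro i; rw [pow_succ', Equiv.Perm.mul_apply, hxσ, ih]; ring
  have hupow : ∀ k i, u ((σ ^ k) i) = ω ^ k * u i := by
    intro k
    induction k with
    | zero => simp
    | succ k ih => intro i; rw [pow_succ', Equiv.Perm.mul_apply, huσ, ih]; ring
  have hfix : ∀ k i, 0 < k → k ≤ 8 → (σ ^ k) i ≠ i := by
    intro k i hk hk' h
    have := hxpow k i
    rw [h] at this
    exact hξ k hk hk' (mul_right_cancel₀ (hx0 i) (by rw [← this, one_mul]))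
  have hlt : ∀ j k i, j < k → k ≤ 8 → (σ ^ j) i ≠ (σ ^ k) i := by
    intro j k i hjk hk h
    refine hfix (k - j) ((σ ^ j) i) (by omega) (by omega) ?_
    rw [← Equiv.Perm.mul_apply, ← pow_add, Nat.sub_add_cancel hjk.le, h]
  have hinj : ∀ i, Set.InjOn (fun k : ℕ => (σ ^ k) i) (Set.Iio 7) := by
    intro i j hj k hk h
    simp only [Set.mem_Iio] at hj hk
    rcases lt_trichotomy j k with hjk | hjk | hjk
    · exact (hlt j k i hjk (by omega) h).elim
    · exact hjk
    · exact (hlt k j i hjk (by omega) h.symm).elim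
  have hinj' : ∀ i, Set.InjOn (fun k : ℕ => (σ⁻¹ ^ k) i) (Set.Iio 7) := by
    intro i j hj k hk h
    simp only [Set.mem_Iio] at hj hk
    have e : ∀ m < 7, (σ⁻¹ ^ m) i = (σ ^ (6 - m)) ((σ⁻¹ ^ 6) i) := by
      intro m hm
      have : σ⁻¹ ^ 6 = (σ ^ (6 - m))⁻¹ * σ⁻¹ ^ m := by
        rw [← inv_pow, ← pow_add]; congr 1; omega
      rw [← Equiv.Perm.mul_apply, this, mul_inv_cancel_left]
    simp only [e j hj, e k hk] at h
    have := hinj _ (show 6 - j < 7 by omega) (show 6 - k < 7 by omega) h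
    omega
  set S := Finset.univ.filter fun i => c i ≠ 0 with hS
  have hmem : ∀ i, i ∈ S ↔ c i ≠ 0 := fun i => by simp [hS]
  have hsum : ∀ (T : Finset ι) (f : ι → K), S ⊆ T → ∑ i, c i * f i = ∑ i ∈ T, c i * f i := by
    intro T f hT
    refine (Finset.sum_subset (Finset.subset_univ T) fun i _ hi => ?_).symm
    have : c i = 0 := by
      by_contra h
      exact hi (hT ((hmem i).2 h))
    rw [this, zero_mul]
  have h0' : ∑ i, c i * 1 = 0 := by simpa using h0
  by_contra! hlt7
  have hSne : S.Nonempty := by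
    obtain ⟨i, hi⟩ := Function.ne_iff.1 hc
    exact ⟨i, (hmem i).2 hi⟩
  rw [hsum S _ subset_rfl] at h1 h2 h3 h4 h0'
  rcases cases_of_card_pairSupport_le σ hinj' S hSne
    (by simp only [hmem]; omega) with hc3 | ⟨a, ha⟩ | ⟨hc4, i, j, hij, hi, hi', hj, hj'⟩
  · have := hSne.card_pos
    obtain h | h | h : S.card = 1 ∨ S.card = 2 ∨ S.card = 3 := by omega
    · obtain ⟨i, hi⟩ := Finset.card_eq_one.1 h
      have hci : c i ≠ 0 := (hmem i).1 (by simp [hi])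
      rw [hi] at h0'
      simp [hci] at h0'
    · obtain ⟨i, j, hij, hi⟩ := Finset.card_eq_two.1 h
      have hci : c i ≠ 0 := (hmem i).1 (by simp [hi])
      rw [hi, Finset.sum_pair hij] at h0' h3
      have : c i * (x i - x j) = 0 := by linear_combination h3 - x j * h0'
      simp [hci, sub_eq_zero, hxinj.eq_iff, hij] at this
    · obtain ⟨i, j, k, hij, hik, hjk, hi⟩ := Finset.card_eq_three.1 h
      have hci : c i ≠ 0 := (hmem i).1 (by simp [hi])
      have hcj : c j ≠ 0 := (hmem j).1 (by simp [hi])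
      have hck : c k ≠ 0 := (hmem k).1 (by simp [hi])
      have e : ∀ f : ι → K, ∑ l ∈ S, c l * f l = c i * f i + c j * f j + c k * f k := by
        intro f
        rw [hi, Finset.sum_insert (by simp [hij, hik]), Finset.sum_pair hjk, add_assoc]
      simp only [e] at h0' h1 h2 h3 h4
      exact false_of_weight_three hci hcj hck (hx0 i) (hx0 j) (hx0 k) (hxinj.ne hij)
        (hxinj.ne hik) (by linear_combination h0') h1 h2 h3 h4 (hu0 i)
  · have hsub : S ⊆ (Finset.univ : Finset (Fin 5)).image fun k : Fin 5 => (σ ^ (k : ℕ)) a := by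
      intro s hs
      obtain ⟨k, hk, rfl⟩ := ha s hs
      exact Finset.mem_image.2 ⟨⟨k, hk⟩, Finset.mem_univ _, rfl⟩
    have e : ∀ f : ι → K,
        ∑ l ∈ S, c l * f l = ∑ k : Fin 5, c ((σ ^ (k : ℕ)) a) * f ((σ ^ (k : ℕ)) a) := by
      intro f
      rw [← hsum S f subset_rfl, hsum _ f hsub, Finset.sum_image]
      intro j _ k _ h
      exact Fin.ext (hinj a (show (j : ℕ) < 7 by omega) (show (k : ℕ) < 7 by omega) h)
    have e' : ∀ (f : ι → K) (α : K), f a ≠ 0 → (∀ k, f ((σ ^ k) a) = α ^ k * f a) →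
        ∑ l ∈ S, c l * f l = 0 → ∑ k : Fin 5, c ((σ ^ (k : ℕ)) a) * α ^ (k : ℕ) = 0 := by
      intro f α hfa hf h
      rw [e] at h
      refine mul_right_cancel₀ hfa ?_
      rw [Finset.sum_mul, zero_mul, ← h]
      exact Finset.sum_congr rfl fun k _ => by rw [hf]; ring
    have hd := eq_zero_of_five_zeros h2ne hω hξ hξ0 (fun k => c ((σ ^ (k : ℕ)) a)) (by
      rintro α (rfl | rfl | rfl | rfl | rfl)
      · exact e' (fun _ => 1) 1 one_ne_zero (by simp) h0'
      · refine e' (fun i => u i ^ 2) (-1) (pow_ne_zero 2 (hu0 a)) (fun k => ?_) h2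
        rw [hupow, mul_pow, ← pow_mul, mul_comm k 2, pow_mul, hω]
      · exact e' u _ (hu0 a) (fun k => hupow k a) h1
      · exact e' x _ (hx0 a) (fun k => hxpow k a) h3
      · refine e' (fun i => u i / x i) _ (div_ne_zero (hu0 a) (hx0 a)) (fun k => ?_) h4
        rw [hupow, hxpow, div_pow, mul_div_mul_comm])
    obtain ⟨s, hs⟩ := hSne
    obtain ⟨k, hk, rfl⟩ := ha s hs
    exact (hmem _).1 hs (congrFun hd ⟨k, hk⟩)
  · have hξ1 : ξ ≠ 1 := fun h => hξ 1 (by norm_num) (by norm_num) (by rw [h, pow_one])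
    have hξω : ξ ≠ ω := fun h => hξ 4 (by norm_num) (by norm_num) (by rw [h, hω4])
    have hξω2 : ∀ e, e ^ 4 = 1 → ξ ^ 2 ≠ e := by
      intro e he h
      refine hξ 8 (by norm_num) (by norm_num) ?_
      rw [show 8 = 2 * 4 from rfl, pow_mul, h, he]
    have hn1 : ∀ i, σ i ≠ i := fun i => by simpa using hfix 1 i (by norm_num) (by norm_num)
    have hn2 : ∀ i, σ (σ i) ≠ i := fun i => hfix 2 i (by norm_num) (by norm_num)
    have triple : ∀ i, i ∈ S → σ i ∈ S → σ (σ i) ∈ S → False := by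
      intro i hi hi' hi''
      have hsub : ({i, σ i, σ (σ i)} : Finset ι) ⊆ S := by
        simp [Finset.insert_subset_iff, hi, hi', hi'']
      have hc3 : ({i, σ i, σ (σ i)} : Finset ι).card = 3 :=
        Finset.card_eq_three.2 ⟨_, _, _, (hn1 i).symm, (hn2 i).symm, (hn1 _).symm, rfl⟩
      obtain ⟨k, hk⟩ := Finset.card_eq_one.1
        (show (S \ {i, σ i, σ (σ i)}).card = 1 by rw [Finset.card_sdiff_of_subset hsub]; omega)
      have e : ∀ f : ι → K, ∑ l ∈ S, c l * f l =
          c i * f i + c (σ i) * f (σ i) + c (σ (σ i)) * f (σ (σ i)) + c k * f k := by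
        intro f
        rw [← Finset.sum_sdiff hsub, hk, Finset.sum_singleton,
          Finset.sum_insert (by simp [(hn1 i).symm, (hn2 i).symm]),
          Finset.sum_pair (hn1 _).symm]
        ring
      simp only [e, hxσ, huσ] at h0' h1 h2 h3 h4
      exact false_of_triple_and_single h2ne hω hξ0 hξ1 hξω
        (hξω2 (-ω) (by rw [Even.neg_pow (by decide), hω4])) ((hmem _).1 hi) ((hmem _).1 hi')
        (hx0 i) (hx0 k) (hu i) (hu k) (by linear_combination h0') h1 h2 h3 h4
    by_cases hji : j = σ i
    · subst hji; exact triple i hi hi' hj'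
    by_cases hij' : i = σ j
    · subst hij'; exact triple j hj hj' hi'
    have hσij : σ i ≠ σ j := σ.injective.ne hij
    have hSeq : {i, σ i, j, σ j} = S := by
      refine Finset.eq_of_subset_of_card_le
        (by simp [Finset.insert_subset_iff, hi, hi', hj, hj']) ?_
      rw [hc4, Finset.card_insert_of_notMem (by simp [hij, (hn1 i).symm, hij']),
        Finset.card_insert_of_notMem (by simp [Ne.symm hji, hij]),
        Finset.card_pair (hn1 j).symm]
    have e : ∀ f : ι → K, ∑ l ∈ S, c l * f l =
        c i * f i + c (σ i) * f (σ i) + c j * f j + c (σ j) * f (σ j) := by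
      intro f
      rw [← hSeq, Finset.sum_insert (by simp [hij, (hn1 i).symm, hij']),
        Finset.sum_insert (by simp [Ne.symm hji, hij]), Finset.sum_pair (hn1 j).symm]
      ring
    simp only [e, hxσ, huσ] at h0' h1 h2 h3 h4
    exact false_of_two_pairs h2ne hω hξ0 hξω (hξω2 ω hω4) ((hmem _).1 hi) ((hmem _).1 hi')
      (hx0 i) (hx0 j) (hxinj.ne hij) (hu i) (hu j) (by linear_combination h0') h1 h2 h3 h4

end Weight

section Dimension

variable {F K : Type*} [Field F] [Field K] [Algebra F K]

/-- The evaluations at `1`, `-1`, `w` and `ξ` of the word of length `m` read as a polynomial. -/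
noncomputable def checkMap (w : F) (ξ : K) (m : ℕ) : (Fin m → F) →ₗ[F] F × F × F × K :=
  (Fintype.linearCombination F fun i : Fin m => (1 : F) ^ (i : ℕ)).prod
    ((Fintype.linearCombination F fun i : Fin m => (-1 : F) ^ (i : ℕ)).prod
      ((Fintype.linearCombination F fun i : Fin m => w ^ (i : ℕ)).prod
        (Fintype.linearCombination F fun i : Fin m => ξ ^ (i : ℕ))))

theorem checkMap_eq_zero_iff [Fintype F] {q : ℕ} (hF : Fintype.card F = q) {w : F} {ξ : K}
    (hw : algebraMap F K w = ξ ^ (q + 1)) (m : ℕ) (c : Fin m → F) :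
    checkMap w ξ m c = 0 ↔ ∀ α ∈ ({1, -1, ξ, ξ ^ q, ξ ^ (q + 1)} : Set K),
      ∑ i, algebraMap F K (c i) * α ^ (i : ℕ) = 0 := by
  have hbase : ∀ β : F, ∑ i, c i * β ^ (i : ℕ) = 0 ↔
      ∑ i, algebraMap F K (c i) * algebraMap F K β ^ (i : ℕ) = 0 := fun β => by
    rw [← map_eq_zero_iff _ (algebraMap F K).injective]
    simp only [map_sum, map_mul, map_pow]
  have hfrob : ∑ i, algebraMap F K (c i) * ξ ^ (i : ℕ) = 0 →
      ∑ i, algebraMap F K (c i) * (ξ ^ q) ^ (i : ℕ) = 0 := fun h => by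
    have := congrArg (FiniteField.frobeniusAlgHom F K) h
    rw [map_sum, map_zero] at this
    rw [← this]
    refine Finset.sum_congr rfl fun i _ => ?_
    rw [map_mul, AlgHom.commutes, FiniteField.frobeniusAlgHom_apply, hF, ← pow_mul,
      ← pow_mul, mul_comm q]
  have h1 := hbase 1
  have h2 := hbase (-1)
  have h3 := hbase w
  rw [map_one] at h1
  rw [map_neg, map_one] at h2
  rw [hw] at h3
  simp only [checkMap, LinearMap.prod_apply, Function.prod_apply, Fintype.linearCombination_apply,
    Prod.mk_eq_zero, Set.mem_insert_iff, Set.mem_singleton_iff, forall_eq_or_imp, forall_eq,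
    smul_eq_mul, Algebra.smul_def, h1, h2, h3]
  tauto

theorem linearCombination_pow_extend (α : K) {m n : ℕ} (h : m ≤ n) (c : Fin m → F) :
    Fintype.linearCombination F (fun i : Fin n => α ^ (i : ℕ))
      (Function.extend (Fin.castLE h) c 0) =
    Fintype.linearCombination F (fun i : Fin m => α ^ (i : ℕ)) c := by
  simp only [Fintype.linearCombination_apply]
  refine (Fintype.sum_of_injective (Fin.castLE h) (Fin.castLE_injective h) _ _ ?_ ?_).symm
  · intro i hi
    rw [Function.extend_apply' _ _ _ hi]
    simp
  · intro i
    rw [(Fin.castLE_injective h).extend_apply]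
    simp

theorem checkMap_extend (w : F) (ξ : K) {m n : ℕ} (h : m ≤ n) (c : Fin m → F) :
    checkMap w ξ n (Function.extend (Fin.castLE h) c 0) = checkMap w ξ m c := by
  simp only [checkMap, LinearMap.prod_apply, Function.prod_apply, linearCombination_pow_extend]

end Dimension


/-- For a prime power `q ≡ 1 (mod 4)` and `n = 4q+4`, the cyclic code
`C = {c ∈ F_q^n : c(1) = c(-1) = c(ξ) = c(ξ^q) = c(ξ^{q+1}) = 0}` (with `ξ` a primitive
`n`-th root of unity in `F_{q^2}`) is an `(n, d_P = 7)_q` MDS symbol-pair code: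
its minimum pair distance is `7` and `|C| = q^{n-5}`. -/
theorem stmt_0 (q : ℕ) (hq : IsPrimePow q) (hq4 : q % 4 = 1)
    (F F2 : Type) [Field F] [Fintype F] [DecidableEq F]
    [Field F2] [Fintype F2] [Algebra F F2]
    (hF : Fintype.card F = q) (hF2 : Fintype.card F2 = q ^ 2)
    (ξ : F2) (hξ : IsPrimitiveRoot ξ (4 * q + 4))
    (C : Set (Fin (4 * q + 4) → F))
    (hC : C = {c | ∀ α ∈ ({1, -1, ξ, ξ ^ q, ξ ^ (q + 1)} : Set F2),
      ∑ i : Fin (4 * q + 4), algebraMap F F2 (c i) * α ^ (i : ℕ) = 0}) :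
    IsLeast {w : ℕ | ∃ c ∈ C, c ≠ 0 ∧
        (Finset.univ.filter fun i : Fin (4 * q + 4) =>
          c i ≠ 0 ∨ c ⟨((i : ℕ) + 1) % (4 * q + 4), Nat.mod_lt _ (by omega)⟩ ≠ 0).card = w} 7
      ∧ Nat.card ↥C = q ^ (4 * q + 4 - 5) := by
  have hn0 : 0 < 4 * q + 4 := by omega
  have hq5 : 5 ≤ q := by
    have := hq.one_lt
    omega
  obtain ⟨ω, hωdef⟩ : ∃ ω, ω = ξ ^ (q + 1) := ⟨_, rfl⟩
  have hω4 : IsPrimitiveRoot ω 4 := hωdef ▸ hξ.pow hn0 (by ring)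
  have hω : ω ^ 2 = -1 :=
    (hω4.pow (by norm_num) (show 4 = 2 * 2 by norm_num)).eq_neg_one_of_two_right
  have h2ne : (2 : F2) ≠ 0 := by
    intro h
    exact hω4.pow_ne_one_of_pos_of_lt (l := 2) (by norm_num) (by norm_num)
      (by linear_combination hω - h)
  have hξ0 : ξ ≠ 0 := hξ.ne_zero (by omega)
  have hξk : ∀ k, 0 < k → k ≤ 8 → ξ ^ k ≠ 1 := fun k hk hk' =>
    hξ.pow_ne_one_of_pos_of_lt hk.ne' (by omega)
  have hξq : ξ ^ q = ω / ξ := by rw [eq_div_iff hξ0, hωdef, pow_succ]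
  obtain ⟨w, hw⟩ : ∃ w : F, algebraMap F F2 w = ω := by
    obtain ⟨v, hv⟩ := FiniteField.isSquare_neg_one_iff.2 (show Fintype.card F % 4 ≠ 3 by omega)
    have hv' : ω ^ 2 = algebraMap F F2 v ^ 2 := by
      rw [hω, pow_two, ← map_mul, ← hv, map_neg, map_one]
    rcases sq_eq_sq_iff_eq_or_eq_neg.1 hv' with h | h
    · exact ⟨v, h.symm⟩
    · exact ⟨-v, by rw [map_neg, h]⟩
  have hfin2 : Module.finrank F F2 = 2 := by
    have := Module.card_eq_pow_finrank (K := F) (V := F2)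
    rw [hF2, hF] at this
    exact (Nat.pow_right_injective (by omega) this).symm
  have hfin : Module.finrank F (F × F × F × F2) = 5 := by
    simp [Module.finrank_prod, hfin2]
  have hmem : ∀ c, c ∈ C ↔ checkMap w ξ (4 * q + 4) c = 0 := fun c => by
    rw [checkMap_eq_zero_iff hF (hw.trans hωdef), hC]; rfl
  have hlower : ∀ c ∈ C, c ≠ 0 → 7 ≤ (Finset.univ.filter fun i : Fin (4 * q + 4) =>
      c i ≠ 0 ∨ c ⟨((i : ℕ) + 1) % (4 * q + 4), Nat.mod_lt _ (by omega)⟩ ≠ 0).card := by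
    intro c hcC hc
    have hxinj : Function.Injective fun i : Fin (4 * q + 4) => ξ ^ (i : ℕ) :=
      fun i j hij => Fin.ext (hξ.pow_inj i.2 j.2 hij)
    have hmod : ∀ k, ξ ^ (k % (4 * q + 4)) = ξ ^ k := fun k => by
      conv_rhs => rw [← Nat.mod_add_div k (4 * q + 4), pow_add, pow_mul, hξ.pow_eq_one, one_pow,
        mul_one]
    let τ : Fin (4 * q + 4) → Fin (4 * q + 4) :=
      fun i => ⟨((i : ℕ) + 1) % (4 * q + 4), Nat.mod_lt _ (by omega)⟩
    have hxτ : ∀ i, ξ ^ (τ i : ℕ) = ξ * ξ ^ (i : ℕ) := fun i => by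
      simp only [τ, hmod, pow_succ']
    have hτ : Function.Injective τ := fun i j hij => hxinj <| by
      refine mul_left_cancel₀ hξ0 ?_
      simp only [← hxτ, hij]
    rw [hC] at hcC
    have hu : ∀ i : ℕ, ω ^ i = (ξ ^ i) ^ (q + 1) := fun i => by
      rw [hωdef, ← pow_mul, ← pow_mul, mul_comm]
    classical
    have := seven_le_card_pairSupport (Equiv.ofBijective τ (Finite.injective_iff_bijective.1 hτ))
      h2ne hω hξk hξ0 (fun i => ξ ^ (i : ℕ)) (fun i => ω ^ (i : ℕ))
      (fun i => algebraMap F F2 (c i)) hxinj (fun i => pow_ne_zero _ hξ0)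
      (fun i => by rw [← pow_mul, mul_comm, pow_mul, hω4.pow_eq_one, one_pow]) hxτ
      (fun i => by
        simp only [Equiv.ofBijective_apply, hu, hxτ, mul_pow]
        rw [hωdef])
      (fun h => hc (funext fun i => by simpa using congrFun h i))
      (by simpa using hcC 1 (by simp)) (hcC ω (by simp [hωdef]))
      (by simpa only [← pow_mul, mul_comm _ 2, pow_mul ω 2, hω] using hcC (-1) (by simp))
      (hcC ξ (by simp))
      (by simpa only [hξq, div_pow] using hcC (ξ ^ q) (by simp))
    simpa [τ] using this
  refine ⟨⟨?_, ?_⟩, ?_⟩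
  · obtain ⟨d, hd, hd0⟩ := (Submodule.ne_bot_iff _).1
      ((checkMap w ξ 6).ker_ne_bot_of_finrank_lt (by rw [hfin]; simp))
    have h6 : 6 ≤ 4 * q + 4 := by omega
    set c := Function.extend (Fin.castLE h6) d 0 with hcdef
    have hcC : c ∈ C := by
      rw [hmem, checkMap_extend]
      exact hd
    have hc0 : c ≠ 0 := by
      intro h
      refine hd0 (funext fun i => ?_)
      rw [← (Fin.castLE_injective h6).extend_apply d 0 i, ← hcdef, h]
      rfl
    have hcz : ∀ i : Fin (4 * q + 4), 6 ≤ (i : ℕ) → c i = 0 := by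
      intro i hi
      refine Function.extend_apply' _ _ _ ?_
      rintro ⟨j, rfl⟩
      simp at hi
      omega
    refine ⟨c, hcC, hc0, le_antisymm ?_ (hlower c hcC hc0)⟩
    refine (Finset.card_le_card_of_injOn (t := insert (4 * q + 3) (Finset.range 6))
      (fun i : Fin (4 * q + 4) => (i : ℕ)) ?_ Fin.val_injective.injOn).trans
      ((Finset.card_insert_le _ _).trans (by simp))
    intro i hi
    simp only [Finset.coe_filter, Finset.mem_univ, true_and, Set.mem_ofPred_eq] at hi
    by_contra hne
    simp only [Finset.coe_insert, Set.mem_insert_iff, Finset.mem_coe, Finset.mem_range,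
      not_or, not_lt] at hne
    refine hi.elim (fun h => h (hcz i hne.2)) fun h => h (hcz _ ?_)
    have := i.2
    simp only
    rw [Nat.mod_eq_of_lt (by omega)]
    omega
  · rintro k ⟨c, hcC, hc0, rfl⟩
    exact hlower c hcC hc0
  · have hinj : Function.Injective (checkMap w ξ 5) := by
      refine (injective_iff_map_eq_zero _).2 fun d hd => ?_
      rw [checkMap_eq_zero_iff hF (hw.trans hωdef)] at hd
      have h := eq_zero_of_five_zeros h2ne hω hξk hξ0 (fun i => algebraMap F F2 (d i)) (by
        intro α hα
        refine hd α ?_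
        rw [← hωdef, hξq]
        simp only [Set.mem_insert_iff, Set.mem_singleton_iff] at hα ⊢
        tauto)
      exact funext fun i => by simpa using congrFun h i
    have hsurj5 := (LinearMap.injective_iff_surjective_of_finrank_eq_finrank
      (by rw [hfin]; simp)).1 hinj
    have hsurj : Function.Surjective (checkMap w ξ (4 * q + 4)) := fun y => by
      obtain ⟨d, rfl⟩ := hsurj5 y
      exact ⟨_, checkMap_extend w ξ (by omega) d⟩
    have hrank := (checkMap w ξ (4 * q + 4)).finrank_range_add_finrank_ker
    rw [LinearMap.range_eq_top.2 hsurj, finrank_top, hfin, Module.finrank_fin_fun] at hrank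
    have hCker : C = (LinearMap.ker (checkMap w ξ (4 * q + 4)) : Set (Fin (4 * q + 4) → F)) :=
      Set.ext fun c => by rw [hmem]; rfl
    rw [hCker, show 4 * q + 4 - 5 = Module.finrank F (LinearMap.ker (checkMap w ξ (4 * q + 4)))
      by omega, ← hF, ← Nat.card_eq_fintype_card]
    exact Module.natCard_eq_pow_finrank
end

section
/- Let q be a prime power with q ≡ 1 (mod 4), n = 4q+4, ξ ∈ F_{q^2} a primitive n-th root of unity, and let C ⊆ F_q^n be the cyclic code C = {c ∈ F_q^n : c(1) = c(-1) = c(ξ) = c(ξ^q) = c(ξ^{q+1}) = 0, evaluation in F_{q^2}}. Then the minimum Hamming distance of C equals 4, i.e. d_H(C) = 4. -/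
/-- A linear dependence between three points, in terms of coordinates `x`, `x'` for which the
norm-like products `x * x'` also satisfy power-sum relations, has trivial first coefficient. -/
theorem eq_zero_of_three_term_relations {K : Type*} [Field K] {A B C x y z x' y' z' : K}
    (hx : x' ≠ 0) (hxy : x ≠ y) (hxz : x ≠ z)
    (h0 : A + B + C = 0) (h1 : A * x + B * y + C * z = 0)
    (h1' : A * x' + B * y' + C * z' = 0)
    (hN : A * (x * x') + B * (y * y') + C * (z * z') = 0)
    (hN2 : A * (x * x') ^ 2 + B * (y * y') ^ 2 + C * (z * z') ^ 2 = 0) : A = 0 := by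
  by_contra hA
  have aux : ∀ {B C y z y' z' : K}, x ≠ y → x ≠ z →
      A + B + C = 0 → A * x + B * y + C * z = 0 → A * x' + B * y' + C * z' = 0 →
      A * (x * x') + B * (y * y') + C * (z * z') = 0 →
      A * (x * x') ^ 2 + B * (y * y') ^ 2 + C * (z * z') ^ 2 = 0 →
      x * x' ≠ y * y' := by
    intro B C y z y' z' hxy hxz h0 h1 h1' hN hN2 huv
    have hC : C * (z * z' - x * x') ^ 2 = 0 := by
      rw [← huv] at hN hN2
      linear_combination hN2 - 2 * (x * x') * hN + (x * x') ^ 2 * h0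
    rcases mul_eq_zero.1 hC with hC | hC
    · have : A * (x - y) = 0 := by linear_combination h1 - y * h0 - (z - y) * hC
      exact mul_ne_zero hA (sub_ne_zero.2 hxy) this
    · have hut : z * z' - x * x' = 0 := pow_eq_zero_iff two_ne_zero |>.1 hC
      have : x' * A * ((x - y) * (x - z)) = 0 := by
        linear_combination x' * x * h1 - x' * x * (y + z) * h0 + y * z * h1' +
          B * z * huv - C * y * hut
      exact mul_ne_zero (mul_ne_zero hx hA)
        (mul_ne_zero (sub_ne_zero.2 hxy) (sub_ne_zero.2 hxz)) this
  have hV : A * ((x * x' - y * y') * (x * x' - z * z')) = 0 := by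
    linear_combination hN2 - (y * y' + z * z') * hN + (y * y') * (z * z') * h0
  rcases mul_eq_zero.1 ((mul_eq_zero.1 hV).resolve_left hA) with h | h
  · exact aux hxy hxz h0 h1 h1' hN hN2 (sub_eq_zero.1 h)
  · exact aux (B := C) (C := B) (y' := z') (z' := y') hxz hxy (by linear_combination h0) (by linear_combination h1)
      (by linear_combination h1') (by linear_combination hN) (by linear_combination hN2)
      (sub_eq_zero.1 h)

/-- In dimension less than `3`, four vectors admit a nontrivial relation with coefficient sum
zero. -/
theorem exists_affine_relation {K V : Type*} [Field K] [AddCommGroup V] [Module K V]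
    [FiniteDimensional K V] (hV : Module.finrank K V < 3) (p : Fin 4 → V) :
    ∃ v : Fin 4 → K, v ≠ 0 ∧ ∑ k, v k = 0 ∧ ∑ k, v k • p k = 0 := by
  let L : (Fin 4 → K) →ₗ[K] K × V :=
    (Fintype.linearCombination K fun _ : Fin 4 => (1 : K)).prod (Fintype.linearCombination K p)
  have hL : LinearMap.ker L ≠ ⊥ := L.ker_ne_bot_of_finrank_lt (by simp; lia)
  obtain ⟨v, hv, hv0⟩ := Submodule.exists_mem_ne_zero_of_ne_bot hL
  have hv' := Prod.ext_iff.1 (LinearMap.mem_ker.1 hv)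
  exact ⟨v, hv0, by simpa [L, Fintype.linearCombination_apply] using hv'.1,
    by simpa [L, Fintype.linearCombination_apply] using hv'.2⟩


/-- For a prime power `q ≡ 1 (mod 4)` and `n = 4q+4`, the cyclic code
`C = {c ∈ F_q^n : c(1) = c(-1) = c(ξ) = c(ξ^q) = c(ξ^{q+1}) = 0}` (with `ξ` a primitive
`n`-th root of unity in `F_{q^2}`) has minimum Hamming distance `d_H(C) = 4`. -/
theorem stmt_1 (q : ℕ) (hq : IsPrimePow q) (hq4 : q % 4 = 1)
    (F F2 : Type) [Field F] [Fintype F] [DecidableEq F]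
    [Field F2] [Fintype F2] [Algebra F F2]
    (hF : Fintype.card F = q) (hF2 : Fintype.card F2 = q ^ 2)
    (ξ : F2) (hξ : IsPrimitiveRoot ξ (4 * q + 4))
    (C : Set (Fin (4 * q + 4) → F))
    (hC : C = {c | ∀ α ∈ ({1, -1, ξ, ξ ^ q, ξ ^ (q + 1)} : Set F2),
      ∑ i : Fin (4 * q + 4), algebraMap F F2 (c i) * α ^ (i : ℕ) = 0}) :
    IsLeast {w : ℕ | ∃ c ∈ C, c ≠ 0 ∧
        (Finset.univ.filter fun i : Fin (4 * q + 4) => c i ≠ 0).card = w} 4 := by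
  have hq0 : 0 < q := hq.pos
  have hq5 : 5 ≤ q := by
    have := hq.one_lt
    lia
  have hξ0 : ξ ≠ 0 := hξ.ne_zero (by lia)
  have hneg : (ξ ^ (q + 1)) ^ 2 = -1 := by
    rw [← pow_mul]
    exact (hξ.pow (by lia) (show 4 * q + 4 = (q + 1) * 2 * 2 by ring)).eq_neg_one_of_two_right
  have hξ4 : (ξ ^ 4) ^ (q + 1) = 1 := by
    rw [← pow_mul, show 4 * (q + 1) = 4 * q + 4 by ring, hξ.pow_eq_one]
  have lower : ∀ c ∈ C, c ≠ 0 →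
      4 ≤ (Finset.univ.filter fun i : Fin (4 * q + 4) => c i ≠ 0).card := by
    intro c hc hc0
    by_contra! hlt
    obtain ⟨t, hst, ht⟩ := Finset.exists_superset_card_eq (Nat.le_of_lt_succ hlt)
      (by rw [Fintype.card_fin]; lia)
    rw [hC] at hc
    have hsum : ∀ α ∈ ({1, -1, ξ, ξ ^ q, ξ ^ (q + 1)} : Set F2),
        ∑ i ∈ t, algebraMap F F2 (c i) * α ^ (i : ℕ) = 0 := by
      intro α hα
      rw [← hc α hα]
      refine Finset.sum_subset (Finset.subset_univ t) fun i _ hi => ?_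
      have : c i = 0 := by
        by_contra h
        exact hi (hst (by simpa using h))
      simp [this]
    have key : ∀ i ∈ t, c i = 0 := by
      intro i hi
      obtain ⟨j, k, hjk, hjk'⟩ := Finset.card_eq_two.1
        (show (t.erase i).card = 2 by rw [Finset.card_erase_of_mem hi, ht])
      have hij : i ≠ j := by
        rintro rfl
        have : i ∈ t.erase i := by simp [hjk']
        simp at this
      have hik : i ≠ k := by
        rintro rfl
        have : i ∈ t.erase i := by simp [hjk']
        simp at this
      have hsum3 : ∀ α ∈ ({1, -1, ξ, ξ ^ q, ξ ^ (q + 1)} : Set F2),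
          algebraMap F F2 (c i) * α ^ (i : ℕ) + algebraMap F F2 (c j) * α ^ (j : ℕ) +
            algebraMap F F2 (c k) * α ^ (k : ℕ) = 0 := by
        intro α hα
        rw [← hsum α hα, ← Finset.add_sum_erase _ _ hi, hjk', Finset.sum_pair hjk, add_assoc]
      have hinj : ∀ {a b : Fin (4 * q + 4)}, a ≠ b → ξ ^ (a : ℕ) ≠ ξ ^ (b : ℕ) :=
        fun hab h => hab (Fin.ext (hξ.pow_inj (Fin.is_lt _) (Fin.is_lt _) h))
      have hprod : ∀ m : ℕ, ξ ^ m * (ξ ^ q) ^ m = (ξ ^ (q + 1)) ^ m := fun m => by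
        rw [← mul_pow, pow_succ']
      have hprod2 : ∀ m : ℕ, (ξ ^ m * (ξ ^ q) ^ m) ^ 2 = (-1) ^ m := fun m => by
        rw [hprod, pow_right_comm, hneg]
      refine (map_eq_zero (algebraMap F F2)).1 (eq_zero_of_three_term_relations
        (pow_ne_zero i (pow_ne_zero q hξ0)) (hinj hij) (hinj hik)
        (by simpa using hsum3 1 (by simp)) (hsum3 ξ (by simp)) (hsum3 (ξ ^ q) (by simp)) ?_ ?_)
      · simpa only [hprod] using hsum3 (ξ ^ (q + 1)) (by simp)
      · simpa only [hprod2] using hsum3 (-1) (by simp)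
    refine hc0 (funext fun i => ?_)
    by_contra h
    exact h (key i (hst (by simpa using h)))
  refine ⟨?_, ?_⟩
  · have hfin : Module.finrank F F2 = 2 := by
      have := Module.card_eq_pow_finrank (K := F) (V := F2)
      rw [hF, hF2] at this
      exact (Nat.pow_right_injective (by lia) this).symm
    obtain ⟨v, hv0, hv1, hv2⟩ := exists_affine_relation (K := F) (by rw [hfin]; lia)
      fun k : Fin 4 => (ξ ^ 4) ^ (k : ℕ)
    let e : Fin 4 → Fin (4 * q + 4) := fun k => ⟨4 * k, by lia⟩
    have he : Function.Injective e := fun a b h => by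
      have := congrArg Fin.val h
      simp only [e] at this
      lia
    let c : Fin (4 * q + 4) → F := Function.extend e v 0
    have hce : ∀ k, c (e k) = v k := fun k => he.extend_apply v 0 k
    have hcn : ∀ i ∉ Set.range e, c i = 0 := fun i hi => Function.extend_apply' v (0 : Fin (4 * q + 4) → F) i hi
    have hsum : ∀ α : F2, ∑ i, algebraMap F F2 (c i) * α ^ (i : ℕ) =
        ∑ k, algebraMap F F2 (v k) * (α ^ 4) ^ (k : ℕ) := fun α =>
      (Fintype.sum_of_injective e he _ _ (fun i hi => by simp [hcn i hi])
        fun k => by simp [hce, e, pow_mul]).symm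
    have hone : ∀ α : F2, α ^ 4 = 1 → ∑ i, algebraMap F F2 (c i) * α ^ (i : ℕ) = 0 := by
      intro α hα
      simp [hsum, hα, ← map_sum, hv1]
    have hξsum : ∑ i, algebraMap F F2 (c i) * ξ ^ (i : ℕ) = 0 := by
      rw [hsum, ← hv2]
      simp only [Algebra.smul_def]
    have hcC : c ∈ C := by
      rw [hC]
      rintro α (rfl | rfl | rfl | rfl | rfl)
      · exact hone 1 (by norm_num)
      · exact hone (-1) (by norm_num)
      · exact hξsum
      · have h := congrArg (FiniteField.frobeniusAlgHom F F2) hξsum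
        have hξq : FiniteField.frobeniusAlgHom F F2 ξ = ξ ^ q := by
          rw [FiniteField.frobeniusAlgHom_apply, hF]
        simpa only [map_sum, map_mul, map_pow, AlgHom.commutes, map_zero, hξq] using h
      · exact hone _ (by rw [pow_right_comm, hξ4])
    have hc0 : c ≠ 0 := by
      intro h
      exact hv0 (funext fun k => (hce k).symm.trans (congrFun h (e k)))
    refine ⟨c, hcC, hc0, le_antisymm ?_ (lower c hcC hc0)⟩
    calc _ ≤ (Finset.univ.image e).card := Finset.card_le_card fun i hi => by
            by_contra h
            exact (Finset.mem_filter.1 hi).2 (hcn i (by simpa using h))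
      _ ≤ 4 := Finset.card_image_le.trans (by simp)
  · rintro w ⟨c, hc, hc0, rfl⟩
    exact lower c hc hc0
end

section
/- Let q be a prime power with q ≡ 1 (mod 4), n = 4q+4, ξ ∈ F_{q^2} a primitive n-th root of unity, and let C ⊆ F_q^n be the cyclic code C = {c ∈ F_q^n : c(1) = c(-1) = c(ξ) = c(ξ^q) = c(ξ^{q+1}) = 0, evaluation in F_{q^2}}. Then for every integer ℓ with 4 ≤ ℓ ≤ n-2, there is no codeword c ∈ C whose support is exactly {0, 1, 2, ℓ}; equivalently, C contains no codeword of the form (⋆,⋆,⋆,0_r,⋆,0_{n-r-4}) with each ⋆ a nonzero element of F_q and 1 ≤ r ≤ n-5. -/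
/-- A nowhere-zero polynomial `A + B x + C x² + D x^ℓ` cannot vanish at `1`, `-1`, `I`, `ξ` and
`I / ξ` when `I² = -1 ≠ 1` and `ξ⁸ ≠ 1`. -/
theorem no_vanishing_quadrinomial {K : Type*} [Field K] {A B C D I x y : K} {l : ℕ}
    (hA : A ≠ 0) (hB : B ≠ 0) (hI : I ^ 2 = -1) (h2 : (2 : K) ≠ 0)
    (hxy : y * x = I) (hx8 : x ^ 8 ≠ 1)
    (e1 : A + B + C + D = 0) (e2 : A - B + C + D * (-1) ^ l = 0)
    (e3 : A + B * I + C * I ^ 2 + D * I ^ l = 0)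
    (e4 : A + B * x + C * x ^ 2 + D * x ^ l = 0)
    (e5 : A + B * y + C * y ^ 2 + D * y ^ l = 0) : False := by
  rcases Nat.even_or_odd l with hl | hl
  · rw [hl.neg_one_pow] at e2
    exact mul_ne_zero h2 hB (by linear_combination e1 - e2)
  rw [hl.neg_one_pow] at e2
  have hC : C = -A := by
    have : 2 * (A + C) = 0 := by linear_combination e1 + e2
    linear_combination (mul_eq_zero.1 this).resolve_left h2
  have hD : D = -B := by linear_combination e1 - hC
  subst hC hD
  obtain ⟨m, rfl⟩ := hl
  have hIl : I ^ (2 * m + 1) = (-1) ^ m * I := by rw [pow_succ, pow_mul, hI]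
  rcases Nat.even_or_odd m with hm | hm
  · rw [hIl, hm.neg_one_pow] at e3
    exact mul_ne_zero h2 hA (by linear_combination e3 + A * hI)
  rw [hm.neg_one_pow] at hIl
  rw [hIl] at e3
  have hAB : A = -B * I := by
    have : 2 * (A + B * I) = 0 := by linear_combination e3 + A * hI
    linear_combination (mul_eq_zero.1 this).resolve_left h2
  subst hAB
  have hX : x ^ (2 * m + 1) = -I + x + I * x ^ 2 :=
    mul_left_cancel₀ hB (by linear_combination -e4)
  have hY : y ^ (2 * m + 1) = -I + y + I * y ^ 2 :=
    mul_left_cancel₀ hB (by linear_combination -e5)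
  have hprod : (-I + y + I * y ^ 2) * (-I + x + I * x ^ 2) = -I := by
    rw [← hX, ← hY, ← mul_pow, hxy, hIl]; ring
  have hyx2 : y ^ 2 * x ^ 2 = -1 := by rw [← mul_pow, hxy, hI]
  have hclear : (-I * x ^ 2 + I * x - I) * (-I + x + I * x ^ 2) = -I * x ^ 2 := by
    linear_combination x ^ 2 * hprod - (-I + x + I * x ^ 2) * (x * hxy + I * hyx2)
  have hfac : (x - 1) * ((x - I) * (x ^ 2 + I)) = 0 := by
    linear_combination hclear + (x ^ 4 - x ^ 3) * hI
  apply hx8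
  rcases mul_eq_zero.1 hfac with h | h
  · rw [sub_eq_zero.1 h, one_pow]
  rcases mul_eq_zero.1 h with h | h
  · rw [sub_eq_zero.1 h]
    linear_combination (I ^ 2 - 1) * (I ^ 4 + 1) * hI
  · rw [show x ^ 8 = (x ^ 2) ^ 4 by ring, eq_neg_of_add_eq_zero_left h]
    linear_combination (I ^ 2 - 1) * hI


/-- For a prime power `q ≡ 1 (mod 4)` and `n = 4q+4`, the cyclic code
`C = {c ∈ F_q^n : c(1) = c(-1) = c(ξ) = c(ξ^q) = c(ξ^{q+1}) = 0}` contains, for every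
`4 ≤ ℓ ≤ n-2`, no codeword whose support is exactly `{0, 1, 2, ℓ}`. -/
theorem stmt_2 (q : ℕ) (hq : IsPrimePow q) (hq4 : q % 4 = 1)
    (F F2 : Type) [Field F] [Fintype F]
    [Field F2] [Fintype F2] [Algebra F F2]
    (hF : Fintype.card F = q) (hF2 : Fintype.card F2 = q ^ 2)
    (ξ : F2) (hξ : IsPrimitiveRoot ξ (4 * q + 4))
    (C : Set (Fin (4 * q + 4) → F))
    (hC : C = {c | ∀ α ∈ ({1, -1, ξ, ξ ^ q, ξ ^ (q + 1)} : Set F2),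
      ∑ i : Fin (4 * q + 4), algebraMap F F2 (c i) * α ^ (i : ℕ) = 0}) :
    ∀ ℓ : ℕ, 4 ≤ ℓ → ℓ ≤ 4 * q + 4 - 2 →
      ¬ ∃ c ∈ C, ∀ i : Fin (4 * q + 4),
        c i ≠ 0 ↔ ((i : ℕ) = 0 ∨ (i : ℕ) = 1 ∨ (i : ℕ) = 2 ∨ (i : ℕ) = ℓ) := by
  rintro l hl4 hln ⟨c, hc, hsupp⟩
  rw [hC] at hc
  have hq1 := hq.one_lt
  let j : ∀ k, k < 4 * q + 4 → Fin (4 * q + 4) := fun k hk => ⟨k, hk⟩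
  let i0 := j 0 (by omega)
  let i1 := j 1 (by omega)
  let i2 := j 2 (by omega)
  let il := j l (by omega)
  have hsum : ∀ α : F2, ∑ i : Fin (4 * q + 4), algebraMap F F2 (c i) * α ^ (i : ℕ) =
      algebraMap F F2 (c i0) + algebraMap F F2 (c i1) * α + algebraMap F F2 (c i2) * α ^ 2 +
        algebraMap F F2 (c il) * α ^ l := by
    intro α
    rw [← Finset.sum_subset (Finset.subset_univ {i0, i1, i2, il})]
    · have h01 : i0 ≠ i1 := by simp [i0, i1, j]
      have h02 : i0 ≠ i2 := by simp [i0, i2, j]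
      have h0l : i0 ≠ il := by simp [i0, il, j]; omega
      have h12 : i1 ≠ i2 := by simp [i1, i2, j]
      have h1l : i1 ≠ il := by simp [i1, il, j]; omega
      have h2l : i2 ≠ il := by simp [i2, il, j]; omega
      rw [Finset.sum_insert (by simp [h01, h02, h0l]), Finset.sum_insert (by simp [h12, h1l]),
        Finset.sum_insert (by simp [h2l]), Finset.sum_singleton]
      simp only [i0, i1, i2, il, j]
      ring
    · intro i _ hi
      have : c i = 0 := by
        by_contra h
        apply hi
        have := (hsupp i).1 h
        simpa only [i0, i1, i2, il, j, Finset.mem_insert, Finset.mem_singleton, Fin.ext_iff] using this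
      rw [this, map_zero, zero_mul]
  have hev : ∀ α ∈ ({1, -1, ξ, ξ ^ q, ξ ^ (q + 1)} : Set F2), algebraMap F F2 (c i0) +
      algebraMap F F2 (c i1) * α + algebraMap F F2 (c i2) * α ^ 2 +
        algebraMap F F2 (c il) * α ^ l = 0 := fun α hα => hsum α ▸ hc α hα
  have hA : algebraMap F F2 (c i0) ≠ 0 := by simpa using (hsupp i0).2 (by simp [i0, j])
  have hB : algebraMap F F2 (c i1) ≠ 0 := by simpa using (hsupp i1).2 (by simp [i1, j])
  have hI1 : (ξ ^ (q + 1)) ^ 2 ≠ 1 := by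
    rw [← pow_mul]
    exact hξ.pow_ne_one_of_pos_of_lt (by omega) (by omega)
  have hI : (ξ ^ (q + 1)) ^ 2 = -1 := by
    refine (mul_self_eq_one_iff.1 ?_).resolve_left hI1
    rw [← sq]
    rw [← pow_mul, ← pow_mul, show (q + 1) * (2 * 2) = 4 * q + 4 by ring, hξ.pow_eq_one]
  have h2 : (2 : F2) ≠ 0 := fun h => hI1 (by linear_combination hI - h)
  refine no_vanishing_quadrinomial (x := ξ) (y := ξ ^ q) (l := l) hA hB hI h2
    (pow_succ ξ q).symm (hξ.pow_ne_one_of_pos_of_lt (by omega) (by omega))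
    ?_ ?_ (hev _ (by simp)) (hev _ (by simp)) (hev _ (by simp))
  · simpa using hev 1 (by simp)
  · simpa [sub_eq_add_neg] using hev (-1) (by simp)
end

section
/- Let q be a prime power with q ≡ 1 (mod 4), n = 4q+4, ξ ∈ F_{q^2} a primitive n-th root of unity, and let C ⊆ F_q^n be the cyclic code C = {c ∈ F_q^n : c(1) = c(-1) = c(ξ) = c(ξ^q) = c(ξ^{q+1}) = 0, evaluation in F_{q^2}}. Then for every integer ℓ with 3 ≤ ℓ ≤ n-3, there is no codeword c ∈ C whose support is exactly {0, 1, ℓ, ℓ+1}; equivalently, C contains no codeword of the form (⋆,⋆,0_r,⋆,⋆,0_{n-r-4}) with each ⋆ a nonzero element of F_q and 1 ≤ r ≤ n-5. -/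
/-- A sum over `Fin n` whose terms vanish off four distinct indices is the sum of four terms. -/
theorem Fin.sum_eq_four_terms {M : Type*} [AddCommMonoid M] {n : ℕ} (f : Fin n → M)
    (i j k l : Fin n) (hij : i ≠ j) (hik : i ≠ k) (hil : i ≠ l) (hjk : j ≠ k) (hjl : j ≠ l)
    (hkl : k ≠ l) (hf : ∀ m, m ≠ i → m ≠ j → m ≠ k → m ≠ l → f m = 0) :
    ∑ m, f m = f i + f j + f k + f l := by
  classical
  have h : ∑ m ∈ ({i, j, k, l} : Finset (Fin n)), f m = ∑ m, f m := by
    refine Finset.sum_subset (Finset.subset_univ _) fun m _ hm => ?_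
    simp only [Finset.mem_insert, Finset.mem_singleton, not_or] at hm
    exact hf m hm.1 hm.2.1 hm.2.2.1 hm.2.2.2
  rw [← h, Finset.sum_insert (by simp [hij, hik, hil]), Finset.sum_insert (by simp [hjk, hjl]),
    Finset.sum_pair hkl]
  simp only [add_assoc]

/-- The image of a finite field `F` contains no primitive `n`-th root of unity if
`n ≥ Fintype.card F`. -/
theorem IsPrimitiveRoot.algebraMap_ne_of_card_le {F K : Type*} [Field F] [Fintype F] [Field K]
    [Algebra F K] {n : ℕ} (hn : Fintype.card F ≤ n) {ξ : K} (hξ : IsPrimitiveRoot ξ n) (u : F) :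
    algebraMap F K u ≠ ξ := by
  rintro rfl
  have hcard : 1 < Fintype.card F := Fintype.one_lt_card
  have hu : u ≠ 0 := by
    rintro rfl
    exact hξ.ne_zero (by omega) (map_zero _)
  have h := hξ.pow_eq_one_iff_dvd (Fintype.card F - 1) |>.1 (by
    rw [← map_pow, FiniteField.pow_card_sub_one_eq_one u hu, map_one])
  exact absurd (Nat.le_of_dvd (by omega) h) (by omega)

/-- For a prime power `q ≡ 1 (mod 4)` and `n = 4q+4`, the cyclic code
`C = {c ∈ F_q^n : c(1) = c(-1) = c(ξ) = c(ξ^q) = c(ξ^{q+1}) = 0}` contains, for every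
`3 ≤ ℓ ≤ n-3`, no codeword whose support is exactly `{0, 1, ℓ, ℓ+1}`. -/
theorem stmt_3 (q : ℕ) (hq : IsPrimePow q) (hq4 : q % 4 = 1)
    (F F2 : Type) [Field F] [Fintype F]
    [Field F2] [Fintype F2] [Algebra F F2]
    (hF : Fintype.card F = q) (hF2 : Fintype.card F2 = q ^ 2)
    (ξ : F2) (hξ : IsPrimitiveRoot ξ (4 * q + 4))
    (C : Set (Fin (4 * q + 4) → F))
    (hC : C = {c | ∀ α ∈ ({1, -1, ξ, ξ ^ q, ξ ^ (q + 1)} : Set F2),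
      ∑ i : Fin (4 * q + 4), algebraMap F F2 (c i) * α ^ (i : ℕ) = 0}) :
    ∀ ℓ : ℕ, 3 ≤ ℓ → ℓ ≤ 4 * q + 4 - 3 →
      ¬ ∃ c ∈ C, ∀ i : Fin (4 * q + 4),
        c i ≠ 0 ↔ ((i : ℕ) = 0 ∨ (i : ℕ) = 1 ∨ (i : ℕ) = ℓ ∨ (i : ℕ) = ℓ + 1) := by
  rintro ℓ hℓ hℓn ⟨c, hc, hsupp⟩
  rw [hC] at hc
  have heval : ∀ α ∈ ({1, -1, ξ, ξ ^ q, ξ ^ (q + 1)} : Set F2),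
      algebraMap F F2 (c ⟨0, by omega⟩) + algebraMap F F2 (c ⟨1, by omega⟩) * α
        + algebraMap F F2 (c ⟨ℓ, by omega⟩) * α ^ ℓ
        + algebraMap F F2 (c ⟨ℓ + 1, by omega⟩) * α ^ (ℓ + 1) = 0 := by
    intro α hα
    have h := hc α hα
    rw [Fin.sum_eq_four_terms _ ⟨0, by omega⟩ ⟨1, by omega⟩ ⟨ℓ, by omega⟩ ⟨ℓ + 1, by omega⟩
      (by simp) (by simp; omega) (by simp) (by simp; omega) (by simp; omega) (by simp)] at h
    · simpa using h
    · intro m h0 h1 h2 h3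
      simp only [ne_eq, Fin.ext_iff] at h0 h1 h2 h3
      have hm : c m = 0 := by
        by_contra hne
        have := (hsupp m).1 hne
        omega
      rw [hm, map_zero, zero_mul]
  have ha := (hsupp ⟨0, by omega⟩).2 (by simp)
  have hb := (hsupp ⟨1, by omega⟩).2 (by simp)
  have hinj := (algebraMap F F2).injective
  have ha' := (map_ne_zero_iff _ hinj).2 ha
  have hb' := (map_ne_zero_iff _ hinj).2 hb
  have h1 := heval 1 (by simp)
  have hm1 := heval (-1) (by simp)
  have hx := heval ξ (by simp)
  have hw := heval (ξ ^ (q + 1)) (by simp)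
  have hω : IsPrimitiveRoot (ξ ^ (q + 1)) 4 := hξ.pow (by omega) (by ring)
  have hω2 : (ξ ^ (q + 1)) ^ 2 = -1 := by
    have h4 := hω.pow_eq_one
    have h2 := hω.pow_ne_one_of_pos_of_lt (l := 2) (by norm_num) (by norm_num)
    refine (mul_eq_zero.1 (?_ : ((ξ ^ (q + 1)) ^ 2 - 1) * ((ξ ^ (q + 1)) ^ 2 + 1) = 0)).elim
      (fun h => absurd (sub_eq_zero.1 h) h2) eq_neg_of_add_eq_zero_left
    linear_combination h4
  have h2 : (2 : F2) ≠ 0 := by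
    intro h
    refine hω.pow_ne_one_of_pos_of_lt (l := 2) (by norm_num) (by norm_num) ?_
    linear_combination hω2 - h
  have hω0 : ξ ^ (q + 1) ≠ 0 := hω.ne_zero (by norm_num)
  generalize ξ ^ (q + 1) = ω at hω2 hw hω0
  generalize hA : algebraMap F F2 (c ⟨0, _⟩) = a at *
  generalize hB : algebraMap F F2 (c ⟨1, _⟩) = b at *
  generalize algebraMap F F2 (c ⟨ℓ, _⟩) = d at *
  generalize algebraMap F F2 (c ⟨ℓ + 1, _⟩) = e at *
  simp only [one_pow, mul_one] at h1
  rcases Nat.even_or_odd ℓ with hpar | hpar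
  · rw [pow_succ, hpar.neg_one_pow] at hm1
    have had : a + d = 0 := by
      refine (mul_eq_zero.1 (?_ : 2 * (a + d) = 0)).resolve_left h2
      linear_combination h1 + hm1
    have hprod : (a + b * ξ) * (1 - ξ ^ ℓ) = 0 := by
      linear_combination hx - ξ ^ ℓ * had - ξ ^ (ℓ + 1) * (h1 - had)
    have hξℓ : 1 - ξ ^ ℓ ≠ 0 :=
      sub_ne_zero.2 (hξ.pow_ne_one_of_pos_of_lt (by omega) (by omega)).symm
    have hlin := (mul_eq_zero.1 hprod).resolve_right hξℓ
    refine hξ.algebraMap_ne_of_card_le (F := F) (by omega)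
      (-c ⟨0, by omega⟩ / c ⟨1, by omega⟩) ?_
    rw [map_div₀, map_neg, hA, hB, div_eq_iff hb']
    linear_combination -hlin
  · rw [pow_succ, hpar.neg_one_pow] at hm1
    have hae : a + e = 0 := by
      refine (mul_eq_zero.1 (?_ : 2 * (a + e) = 0)).resolve_left h2
      linear_combination h1 + hm1
    obtain ⟨k, rfl⟩ := hpar
    rw [pow_succ ω (2 * k + 1), pow_succ ω (2 * k), pow_mul, hω2] at hw
    rcases Nat.even_or_odd k with hk | hk
    · rw [hk.neg_one_pow] at hw
      refine mul_ne_zero h2 ha' ?_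
      linear_combination hw - ω * (h1 - hae) - e * hω2 + hae
    · rw [hk.neg_one_pow] at hw
      refine mul_ne_zero (mul_ne_zero h2 hb') hω0 ?_
      linear_combination hw + ω * (h1 - hae) + e * hω2 - hae
end

section
/- Let q be a prime power with q ≡ 3 (mod 4), n = 4q-4, ξ ∈ F_{q^2} a primitive n-th root of unity, and let C ⊆ F_q^n be the cyclic code C = {c ∈ F_q^n : c(1) = c(-1) = c(ξ) = c(ξ^q) = c(ξ^2) = c(ξ^{2q}) = 0, evaluation in F_{q^2}}. Then the minimum Hamming distance of C satisfies: d_H(C) = 6 if q = 3, and d_H(C) = 4 if q > 3. -/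
open Polynomial in
/-- The elements fixed by the `#F`-power Frobenius come from the base field `F`. -/
lemma exists_algebraMap_eq_of_pow_card_eq_self {F K : Type*} [Field F] [Fintype F] [Field K]
    [Algebra F K] {x : K} (hx : x ^ Fintype.card F = x) : ∃ b : F, algebraMap F K b = x := by
  classical
  have hne : (X ^ Fintype.card F - X : K[X]) ≠ 0 :=
    FiniteField.X_pow_card_sub_X_ne_zero K Fintype.one_lt_card
  have hroots : Finset.univ.image (algebraMap F K) =
      (X ^ Fintype.card F - X : K[X]).roots.toFinset := by
    refine Finset.eq_of_subset_of_card_le (fun y hy => ?_) ?_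
    · obtain ⟨b, -, rfl⟩ := Finset.mem_image.mp hy
      simp [hne, ← map_pow, FiniteField.pow_card]
    · rw [Finset.card_image_of_injective _ (algebraMap F K).injective, Finset.card_univ]
      calc _ ≤ _ := Multiset.toFinset_card_le _
        _ ≤ _ := card_roots' _
        _ = _ := FiniteField.X_pow_card_sub_X_natDegree_eq K Fintype.one_lt_card
  have hmem : x ∈ (X ^ Fintype.card F - X : K[X]).roots.toFinset := by simp [hne, hx]
  rw [← hroots] at hmem
  obtain ⟨b, -, hb⟩ := Finset.mem_image.mp hmem
  exact ⟨b, hb⟩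

open Polynomial in
/-- The BCH bound: a nonzero word vanishing at `1, ξ, …, ξ ^ (d - 1)` has weight more than `d`. -/
lemma lt_card_support_of_forall_sum_mul_pow_eq_zero {F K : Type*} [Field F] [DecidableEq F]
    [Field K] [Algebra F K] {n d : ℕ} {ξ : K} (hξ : IsPrimitiveRoot ξ n) {c : Fin n → F}
    (hc : c ≠ 0) (h : ∀ k < d, ∑ i : Fin n, algebraMap F K (c i) * (ξ ^ k) ^ (i : ℕ) = 0) :
    d < (Finset.univ.filter fun i : Fin n => c i ≠ 0).card := by
  by_contra! hd
  obtain ⟨j, hj⟩ := Function.ne_iff.mp hc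
  set S := Finset.univ.filter fun i : Fin n => c i ≠ 0 with hS
  have hjS : j ∈ S := by simpa [hS] using hj
  set P : K[X] := ∏ i ∈ S.erase j, (X - C (ξ ^ (i : ℕ))) with hP
  have hdeg : P.natDegree < d := by
    rw [hP, natDegree_finsetProd_X_sub_C_eq_card, Finset.card_erase_of_mem hjS]
    have := Finset.card_pos.mpr ⟨j, hjS⟩
    omega
  have hsum : ∑ i : Fin n, algebraMap F K (c i) * P.eval (ξ ^ (i : ℕ)) = 0 := by
    simp_rw [eval_eq_sum_range' hdeg, Finset.mul_sum]
    rw [Finset.sum_comm]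
    refine Finset.sum_eq_zero fun k hk => ?_
    have := h k (Finset.mem_range.mp hk)
    calc _ = P.coeff k * ∑ i : Fin n, algebraMap F K (c i) * (ξ ^ k) ^ (i : ℕ) := by
          rw [Finset.mul_sum]
          refine Finset.sum_congr rfl fun i _ => ?_
          rw [pow_right_comm]
          ring
      _ = 0 := by rw [this, mul_zero]
  rw [Finset.sum_eq_single j] at hsum
  · rcases mul_eq_zero.mp hsum with h0 | h0
    · exact hj (by simpa using h0)
    · rw [hP, eval_prod, Finset.prod_eq_zero_iff] at h0
      obtain ⟨i, hi, hi0⟩ := h0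
      rw [eval_sub, eval_X, eval_C, sub_eq_zero] at hi0
      exact (Finset.mem_erase.mp hi).1 (Fin.ext (hξ.pow_inj j.2 i.2 hi0).symm)
  · intro i _ hij
    by_cases hi : c i = 0
    · simp [hi]
    · have : P.eval (ξ ^ (i : ℕ)) = 0 := by
        rw [hP, eval_prod]
        exact Finset.prod_eq_zero (i := i) (by simp [hS, hi, hij]) (by simp)
      rw [this, mul_zero]
  · simp


/-- For a prime power `q ≡ 3 (mod 4)` and `n = 4q-4`, the cyclic code
`C = {c ∈ F_q^n : c(1) = c(-1) = c(ξ) = c(ξ^q) = c(ξ^2) = c(ξ^{2q}) = 0}` (with `ξ` a primitive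
`n`-th root of unity in `F_{q^2}`) has minimum Hamming distance `6` if `q = 3` and `4` if `q > 3`. -/
theorem stmt_4 (q : ℕ) (hq : IsPrimePow q) (hq4 : q % 4 = 3)
    (F F2 : Type) [Field F] [Fintype F] [DecidableEq F]
    [Field F2] [Fintype F2] [Algebra F F2]
    (hF : Fintype.card F = q) (hF2 : Fintype.card F2 = q ^ 2)
    (ξ : F2) (hξ : IsPrimitiveRoot ξ (4 * q - 4))
    (C : Set (Fin (4 * q - 4) → F))
    (hC : C = {c | ∀ α ∈ ({1, -1, ξ, ξ ^ q, ξ ^ 2, ξ ^ (2 * q)} : Set F2),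
      ∑ i : Fin (4 * q - 4), algebraMap F F2 (c i) * α ^ (i : ℕ) = 0}) :
    (q = 3 → IsLeast {w : ℕ | ∃ c ∈ C, c ≠ 0 ∧
        (Finset.univ.filter fun i : Fin (4 * q - 4) => c i ≠ 0).card = w} 6)
    ∧ (3 < q → IsLeast {w : ℕ | ∃ c ∈ C, c ≠ 0 ∧
        (Finset.univ.filter fun i : Fin (4 * q - 4) => c i ≠ 0).card = w} 4) := by
  have h1n : (-1 : F2) = ξ ^ (2 * q - 2) := by
    have h := (hξ.pow (a := 2 * q - 2) (b := 2) (by omega) (by omega)).eq_neg_one_of_two_right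
    exact h.symm
  subst hC
  refine ⟨?_, ?_⟩
  · rintro rfl
    have hF3 : (3 : F) = 0 := by
      have := FiniteField.cast_card_eq_zero F
      rw [hF] at this
      exact_mod_cast this
    have h30 : (3 : F2) = 0 := by
      have := congrArg (algebraMap F F2) hF3
      rwa [map_ofNat, map_zero] at this
    have h4 : ξ ^ 4 = -1 := h1n.symm
    obtain ⟨e, he⟩ : ∃ e : F, algebraMap F F2 e = ξ + ξ ^ 3 := by
      apply exists_algebraMap_eq_of_pow_card_eq_self
      rw [hF]
      linear_combination (ξ ^ 5 + ξ ^ 7) * h30 + ξ * (ξ ^ 4 - 1) * h4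
    have h2 : ξ ^ 2 ≠ -1 := by
      rw [h1n]
      intro h
      have := hξ.pow_inj (by norm_num) (by norm_num) h
      omega
    have he0 : e ≠ 0 := by
      rintro rfl
      have : ξ * (ξ ^ 2 + 1) = 0 := by
        rw [map_zero] at he
        linear_combination -he
      rcases mul_eq_zero.mp this with h | h
      · exact hξ.ne_zero (by norm_num) h
      · exact h2 (eq_neg_of_add_eq_zero_left h)
    have he2 : (ξ + ξ ^ 3) ^ 2 = 1 := by
      have h := FiniteField.pow_card_sub_one_eq_one e he0
      rw [hF] at h
      rw [← he, ← map_pow, h, map_one]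
    have h20 : (2 : F) ≠ 0 := by
      intro h
      exact one_ne_zero (α := F) (by linear_combination hF3 - h)
    refine ⟨⟨(![2, e, 0, e, -2, -e, 0, -e] : Fin 8 → F), ?_, ?_, ?_⟩, ?_⟩
    · intro α hα
      change ∑ i : Fin 8, _ = _
      have hfac : (1 - α ^ 4) * (2 + (ξ + ξ ^ 3) * α + (ξ + ξ ^ 3) * α ^ 3) = 0 := by
        simp only [Set.mem_insert_iff, Set.mem_singleton_iff] at hα
        rcases hα with rfl | rfl | hα | rfl | rfl | rfl
        · ring
        · ring
        · rw [hα]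
          linear_combination (1 - ξ ^ 4) * (he2 + h30)
        · linear_combination (1 - (ξ ^ 3) ^ 4) * (he2 + h30 + (ξ + ξ ^ 3) * ξ * (ξ ^ 4 - 1) * h4)
        · linear_combination (1 - ξ ^ 4) * (2 + (ξ + ξ ^ 3) * ξ ^ 2 + (ξ + ξ ^ 3) * ξ ^ 6) * h4
        · have : (ξ ^ (2 * 3)) ^ 4 = 1 := by
            rw [← pow_mul, show 2 * 3 * 4 = 4 * 6 by norm_num, pow_mul, h4]; norm_num
          rw [this]; ring
      simp only [Fin.sum_univ_eight]
      simp [he, map_ofNat (algebraMap F F2) 2]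
      linear_combination hfac
    · intro h
      exact he0 (congrFun h (1 : Fin 8))
    · have : (Finset.univ.filter fun i : Fin 8 =>
          (![2, e, 0, e, -2, -e, 0, -e] : Fin 8 → F) i ≠ 0) = {0, 1, 3, 4, 5, 7} := by
        ext i
        fin_cases i <;> simp [he0, h20]
      change (Finset.univ.filter fun i : Fin 8 =>
          (![2, e, 0, e, -2, -e, 0, -e] : Fin 8 → F) i ≠ 0).card = 6
      rw [this]
      rfl
    · rintro w ⟨c, hc, hc0, rfl⟩
      refine lt_card_support_of_forall_sum_mul_pow_eq_zero hξ hc0 fun k hk => hc _ ?_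
      interval_cases k <;> simp [h1n]
  · intro hq3
    refine ⟨?_, ?_⟩
    · obtain ⟨a, ha⟩ : ∃ a : F, algebraMap F F2 a = ξ ^ 4 := by
        apply exists_algebraMap_eq_of_pow_card_eq_self
        rw [hF, ← pow_mul, show 4 * q = 4 * q - 4 + 4 by omega, pow_add, hξ.pow_eq_one, one_mul]
      have hI : (ξ ^ (q - 1)) ^ 2 = -1 := by
        rw [h1n, ← pow_mul]
        congr 1
        omega
      have ha0 : a ≠ 0 := by
        rintro rfl
        rw [map_zero] at ha
        exact hξ.ne_zero (by omega) (pow_eq_zero_iff (by norm_num) |>.mp ha.symm)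
      have ha1 : a - 1 ≠ 0 := by
        intro h
        rw [sub_eq_zero.mp h, map_one] at ha
        exact hξ.pow_ne_one_of_pos_of_lt (by norm_num) (by omega) ha.symm
      have ha2 : a + 1 ≠ 0 := by
        intro h
        rw [eq_neg_of_add_eq_zero_left h, map_neg, map_one, h1n] at ha
        have := hξ.pow_inj (by omega) (by omega) ha
        omega
      let p : Fin (4 * q - 4) := ⟨0, by omega⟩
      let r : Fin (4 * q - 4) := ⟨4, by omega⟩
      let s : Fin (4 * q - 4) := ⟨q - 1, by omega⟩
      let t : Fin (4 * q - 4) := ⟨3 * (q - 1) + 4, by omega⟩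
      have hpr : p ≠ r := by simp [p, r]
      have hps : p ≠ s := by simp only [p, s, ne_eq, Fin.mk.injEq]; omega
      have hpt : p ≠ t := by simp only [p, t, ne_eq, Fin.mk.injEq]; omega
      have hrs : r ≠ s := by simp only [r, s, ne_eq, Fin.mk.injEq]; omega
      have hrt : r ≠ t := by simp only [r, t, ne_eq, Fin.mk.injEq]; omega
      have hst : s ≠ t := by simp only [s, t, ne_eq, Fin.mk.injEq]; omega
      let c : Fin (4 * q - 4) → F := fun i =>
        (if i = p then (a + 1) * a else 0) + (if i = r then -(a + 1) else 0) +
        (if i = s then -((a - 1) * a) else 0) + (if i = t then -(a - 1) else 0)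
      have hcp : c p = (a + 1) * a := by simp [c, hpr, hps, hpt]
      have hcr : c r = -(a + 1) := by simp only [c]; simp [hpr.symm, hrs, hrt]
      have hcs : c s = -((a - 1) * a) := by simp only [c]; simp [hps.symm, hrs.symm, hst]
      have hct : c t = -(a - 1) := by simp only [c]; simp [hpt.symm, hrt.symm, hst.symm]
      have hsum : ∀ α : F2, ∑ i, algebraMap F F2 (c i) * α ^ (i : ℕ) =
          (ξ ^ 4 + 1) * ξ ^ 4 - (ξ ^ 4 + 1) * α ^ 4 - (ξ ^ 4 - 1) * ξ ^ 4 * α ^ (q - 1)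
            - (ξ ^ 4 - 1) * ((α ^ (q - 1)) ^ 3 * α ^ 4) := by
        intro α
        have hx : ∀ (u : F) (v : Fin (4 * q - 4)),
            ∑ i, algebraMap F F2 (if i = v then u else 0) * α ^ (i : ℕ) =
              algebraMap F F2 u * α ^ (v : ℕ) := by
          intro u v
          rw [Finset.sum_eq_single v] <;> simp +contextual
        have hadd : ∀ (x y : F) (z : F2), algebraMap F F2 (x + y) * z =
            algebraMap F F2 x * z + algebraMap F F2 y * z := by
          intro x y z
          rw [map_add, add_mul]
        simp only [c, hadd, Finset.sum_add_distrib, hx]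
        simp only [map_add, map_mul, map_sub, map_neg, map_one, ha, p, r, s, t, pow_zero]
        rw [← pow_mul, mul_comm (q - 1) 3, ← pow_add]
        ring
      have hfrob : ∀ α : F2, (∑ i, algebraMap F F2 (c i) * (α ^ q) ^ (i : ℕ)) =
          (∑ i, algebraMap F F2 (c i) * α ^ (i : ℕ)) ^ q := by
        intro α
        have := map_sum (FiniteField.frobeniusAlgHom F F2)
          (fun i => algebraMap F F2 (c i) * α ^ (i : ℕ)) Finset.univ
        simp only [map_mul, AlgHom.commutes, FiniteField.coe_frobeniusAlgHom, hF] at this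
        rw [this]
        simp only [pow_right_comm]
      have hξ1 : ∑ i, algebraMap F F2 (c i) * ξ ^ (i : ℕ) = 0 := by
        rw [hsum]
        linear_combination (-(ξ ^ 4 - 1) * ξ ^ 4 * ξ ^ (q - 1)) * hI
      have hξ2 : ∑ i, algebraMap F F2 (c i) * (ξ ^ 2) ^ (i : ℕ) = 0 := by
        rw [hsum, pow_right_comm ξ 2 (q - 1), hI]
        ring
      refine ⟨c, ?_, ?_, ?_⟩
      · intro α hα
        simp only [Set.mem_insert_iff, Set.mem_singleton_iff] at hα
        rcases hα with rfl | rfl | rfl | rfl | rfl | rfl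
        · rw [hsum]
          simp only [one_pow]
          ring
        · have : Even (q - 1) := ⟨(q - 1) / 2, by omega⟩
          rw [hsum, this.neg_one_pow]
          ring
        · exact hξ1
        · rw [hfrob, hξ1, zero_pow (by omega)]
        · exact hξ2
        · rw [pow_mul, hfrob, hξ2, zero_pow (by omega)]
      · intro h
        have := congrFun h r
        rw [hcr, Pi.zero_apply, neg_eq_zero] at this
        exact ha2 this
      · have hsupp : (Finset.univ.filter fun i => c i ≠ 0) = {p, r, s, t} := by
          ext i
          simp only [Finset.mem_filter, Finset.mem_univ, true_and, Finset.mem_insert,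
            Finset.mem_singleton]
          constructor
          · intro hi
            by_contra! hne
            exact hi (by simp [c, hne])
          · rintro (rfl | rfl | rfl | rfl)
            · rw [hcp]; exact mul_ne_zero ha2 ha0
            · rw [hcr]; exact neg_ne_zero.mpr ha2
            · rw [hcs]; exact neg_ne_zero.mpr (mul_ne_zero ha1 ha0)
            · rw [hct]; exact neg_ne_zero.mpr ha1
        rw [hsupp]
        simp [hpr, hps, hpt, hrs, hrt, hst]
    · rintro w ⟨c, hc, hc0, rfl⟩
      refine lt_card_support_of_forall_sum_mul_pow_eq_zero hξ hc0 fun k hk => hc _ ?_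
      interval_cases k <;> simp
end

section
/- Let q be a prime power with q ≡ 3 (mod 4), n = 4q-4, ξ ∈ F_{q^2} a primitive n-th root of unity, and let C ⊆ F_q^n be the cyclic code C = {c ∈ F_q^n : c(1) = c(-1) = c(ξ) = c(ξ^q) = c(ξ^2) = c(ξ^{2q}) = 0, evaluation in F_{q^2}}. Then for every integer ℓ with 5 ≤ ℓ ≤ n-2, there is no codeword c ∈ C whose support is exactly {0, 1, 2, 3, ℓ}; equivalently, C contains no codeword of the form (⋆,⋆,⋆,⋆,0_r,⋆,0_{n-r-5}) with each ⋆ a nonzero element of F_q and 1 ≤ r ≤ n-6. -/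
/-- A sum over `Fin n` of a function supported on five given indices. -/
theorem Fin.sum_eq_five_terms {M : Type*} [AddCommMonoid M] {n ℓ : ℕ} (h3 : 3 < ℓ) (hn : ℓ < n)
    (f : Fin n → M)
    (hf : ∀ i : Fin n, ¬ ((i : ℕ) = 0 ∨ (i : ℕ) = 1 ∨ (i : ℕ) = 2 ∨ (i : ℕ) = 3 ∨ (i : ℕ) = ℓ) →
      f i = 0) :
    ∑ i, f i = f ⟨0, by omega⟩ + (f ⟨1, by omega⟩ + (f ⟨2, by omega⟩ + (f ⟨3, by omega⟩ +
      f ⟨ℓ, hn⟩))) := by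
  rw [← Finset.sum_subset (Finset.subset_univ
    {⟨0, by omega⟩, ⟨1, by omega⟩, ⟨2, by omega⟩, ⟨3, by omega⟩, ⟨ℓ, hn⟩})]
  · repeat rw [Finset.sum_insert (by simp [Fin.ext_iff]; try omega)]
    rw [Finset.sum_singleton]
  · intro i _ hi
    exact hf i (by simpa [Fin.ext_iff] using hi)

/-- For a prime power `q ≡ 3 (mod 4)` and `n = 4q-4`, the cyclic code
`C = {c ∈ F_q^n : c(1) = c(-1) = c(ξ) = c(ξ^q) = c(ξ^2) = c(ξ^{2q}) = 0}` contains, for every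
`5 ≤ ℓ ≤ n-2`, no codeword whose support is exactly `{0, 1, 2, 3, ℓ}`. -/
theorem stmt_5 (q : ℕ) (hq : IsPrimePow q) (hq4 : q % 4 = 3)
    (F F2 : Type) [Field F] [Fintype F]
    [Field F2] [Fintype F2] [Algebra F F2]
    (hF : Fintype.card F = q) (hF2 : Fintype.card F2 = q ^ 2)
    (ξ : F2) (hξ : IsPrimitiveRoot ξ (4 * q - 4))
    (C : Set (Fin (4 * q - 4) → F))
    (hC : C = {c | ∀ α ∈ ({1, -1, ξ, ξ ^ q, ξ ^ 2, ξ ^ (2 * q)} : Set F2),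
      ∑ i : Fin (4 * q - 4), algebraMap F F2 (c i) * α ^ (i : ℕ) = 0}) :
    ∀ ℓ : ℕ, 5 ≤ ℓ → ℓ ≤ 4 * q - 4 - 2 →
      ¬ ∃ c ∈ C, ∀ i : Fin (4 * q - 4),
        c i ≠ 0 ↔ ((i : ℕ) = 0 ∨ (i : ℕ) = 1 ∨ (i : ℕ) = 2 ∨ (i : ℕ) = 3 ∨ (i : ℕ) = ℓ) := by
  rintro ℓ h5 hl ⟨c, hc, hsupp⟩
  have hq3 : 3 ≤ q := by omega
  have hneg : ξ ^ (2 * q - 2) = -1 := by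
    refine IsPrimitiveRoot.eq_neg_one_of_two_right (hξ.pow (by omega) ?_)
    omega
  have hne : (-1 : F2) ≠ 1 := hneg ▸ hξ.pow_ne_one_of_pos_of_lt (by omega) (by omega)
  have h2 : (2 : F2) ≠ 0 := fun h => hne (by linear_combination -h)
  have hξ4 : ξ ^ 4 ≠ 1 := hξ.pow_ne_one_of_pos_of_lt (by omega) (by omega)
  have hξ2q : ξ ^ (2 * q) = -ξ ^ 2 := by
    rw [show 2 * q = (2 * q - 2) + 2 by omega, pow_add, hneg, neg_one_mul]
  have hℓ : ℓ < 4 * q - 4 := by omega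
  rw [hC] at hc
  have expand (α : F2) := Fin.sum_eq_five_terms (by omega) hℓ
    (fun i : Fin (4 * q - 4) => algebraMap F F2 (c i) * α ^ (i : ℕ)) fun i hi => by
      simp [not_not.mp (mt (hsupp i).mp hi)]
  have e1 := (expand 1).symm.trans (hc 1 (by simp))
  have e2 := (expand (-1)).symm.trans (hc (-1) (by simp))
  have e3 := (expand (ξ ^ 2)).symm.trans (hc (ξ ^ 2) (by simp))
  have e4 := (expand (-ξ ^ 2)).symm.trans (hc (-ξ ^ 2) (by simp [hξ2q]))
  have key (a b : F2) (hb : b ≠ 0) (h : 2 * (a + b) = 0) (h' : 2 * (a + b * ξ ^ 4) = 0) :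
      False := by
    have hz : 2 * b * (ξ ^ 4 - 1) = 0 := by linear_combination h' - h
    simp [h2, hb, sub_eq_zero, hξ4] at hz
  have cne (i : Fin (4 * q - 4)) (hi : (i : ℕ) ≤ 3) : algebraMap F F2 (c i) ≠ 0 := by
    rw [map_ne_zero, hsupp i]
    omega
  rcases Nat.even_or_odd ℓ with he | ho
  · simp only [he.neg_pow, one_pow] at e1 e2 e3 e4
    refine key (algebraMap F F2 (c ⟨1, by omega⟩)) _ (cne ⟨3, by omega⟩ le_rfl) ?_ ?_
    · linear_combination e1 - e2
    · refine mul_left_cancel₀ (pow_ne_zero 2 (hξ.ne_zero (by omega))) ?_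
      linear_combination e3 - e4
  · simp only [ho.neg_pow, one_pow] at e1 e2 e3 e4
    refine key (algebraMap F F2 (c ⟨0, by omega⟩)) _ (cne ⟨2, by omega⟩ (by simp)) ?_ ?_
    · linear_combination e1 + e2
    · linear_combination e3 + e4
end

section
/- Let q be a prime power with q ≡ 3 (mod 4), n = 4q-4, ξ ∈ F_{q^2} a primitive n-th root of unity, and let C ⊆ F_q^n be the cyclic code C = {c ∈ F_q^n : c(1) = c(-1) = c(ξ) = c(ξ^q) = c(ξ^2) = c(ξ^{2q}) = 0, evaluation in F_{q^2}}. Then for every integer ℓ with 4 ≤ ℓ ≤ n-3, there is no codeword c ∈ C whose support is exactly {0, 1, 2, ℓ, ℓ+1}; equivalently, C contains no codeword of the form (⋆,⋆,⋆,0_r,⋆,⋆,0_{n-r-5}) with each ⋆ a nonzero element of F_q and 1 ≤ r ≤ n-6. -/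
/-- A function on `Fin n` supported on the exponents `0, 1, 2, l, l + 1` has the expected
five-term sum against the powers of `α`. -/
theorem sum_mul_pow_eq_of_support {K : Type*} [Field K] {n l : ℕ} (hl : 4 ≤ l) (hn : l + 1 < n)
    (a : Fin n → K)
    (ha : ∀ i : Fin n, a i ≠ 0 →
      ((i : ℕ) = 0 ∨ (i : ℕ) = 1 ∨ (i : ℕ) = 2 ∨ (i : ℕ) = l ∨ (i : ℕ) = l + 1)) (α : K) :
    ∑ i : Fin n, a i * α ^ (i : ℕ) =
      a ⟨0, by omega⟩ + a ⟨1, by omega⟩ * α + a ⟨2, by omega⟩ * α ^ 2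
        + a ⟨l, by omega⟩ * α ^ l + a ⟨l + 1, hn⟩ * α ^ (l + 1) := by
  have h : ∑ i ∈ ({⟨0, by omega⟩, ⟨1, by omega⟩, ⟨2, by omega⟩, ⟨l, by omega⟩, ⟨l + 1, hn⟩} :
      Finset (Fin n)), a i * α ^ (i : ℕ) = ∑ i : Fin n, a i * α ^ (i : ℕ) := by
    refine Finset.sum_subset (Finset.subset_univ _) fun i _ hi => ?_
    by_cases h0 : a i = 0
    · simp [h0]
    · exact absurd (by simpa [Fin.ext_iff] using ha i h0) hi
  rw [← h, Finset.sum_insert, Finset.sum_insert, Finset.sum_insert, Finset.sum_insert,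
    Finset.sum_singleton]
  · simp only [pow_zero, pow_one, mul_one]
    ring
  all_goals
    simp only [Finset.mem_insert, Finset.mem_singleton, Fin.mk.injEq]
    omega

/-- The `2 * m`-th power of a primitive root of unity of order `4 * m` is `-1`. -/
theorem IsPrimitiveRoot.pow_two_mul_eq_neg_one {K : Type*} [Field K] {ξ : K} {m : ℕ} (hm : 0 < m)
    (hξ : IsPrimitiveRoot ξ (4 * m)) : ξ ^ (2 * m) = -1 := by
  have h : (ξ ^ (2 * m)) ^ 2 = 1 := by
    rw [← pow_mul, show 2 * m * 2 = 4 * m by ring, hξ.pow_eq_one]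
  exact (mul_self_eq_one_iff.1 ((pow_two _).symm.trans h)).resolve_left
    (hξ.pow_ne_one_of_pos_of_lt (by omega) (by omega))

/-- A polynomial with nonzero coefficients exactly at `0, 1, 2, l, l + 1` cannot vanish at
all of `1, -1, η, -η` when `η` is nonzero and `η ^ 2 ≠ 1`. -/
theorem not_vanish_at_pm_one_pm {K : Type*} [Field K] (h2 : (2 : K) ≠ 0)
    {η a₀ a₁ a₂ b₀ b₁ : K} (hη : η ≠ 0) (hη2 : η ^ 2 ≠ 1)
    (ha₀ : a₀ ≠ 0) (ha₁ : a₁ ≠ 0) (ha₂ : a₂ ≠ 0) (l : ℕ)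
    (h : ∀ α ∈ ({1, -1, η, -η} : Set K),
      a₀ + a₁ * α + a₂ * α ^ 2 + b₀ * α ^ l + b₁ * α ^ (l + 1) = 0) : False := by
  have e₁ := h 1 (by simp)
  have e₂ := h (-1) (by simp)
  have e₃ := h η (by simp)
  have e₄ := h (-η) (by simp)
  have hη2' : η ^ 2 - 1 ≠ 0 := sub_ne_zero.2 hη2
  rcases Nat.even_or_odd l with hl | hl
  · simp only [one_pow, hl.neg_pow, hl.add_one.neg_pow, even_two.neg_pow] at e₁ e₂ e₃ e₄
    have hb₁ : b₁ = -a₁ := mul_left_cancel₀ h2 (by linear_combination e₁ - e₂)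
    have hb₀ : b₀ = -a₀ - a₂ := mul_left_cancel₀ h2 (by linear_combination e₁ + e₂)
    have hp : η ^ l = 1 :=
      mul_left_cancel₀ (mul_ne_zero (mul_ne_zero h2 ha₁) hη) (by
        subst hb₁; linear_combination e₄ - e₃)
    refine mul_ne_zero (mul_ne_zero h2 ha₂) hη2' ?_
    subst hb₀
    linear_combination e₃ + e₄ + 2 * (a₀ + a₂) * hp
  · simp only [one_pow, hl.neg_pow, hl.add_one.neg_pow, even_two.neg_pow] at e₁ e₂ e₃ e₄
    have hb₀ : b₀ = -a₁ := mul_left_cancel₀ h2 (by linear_combination e₁ - e₂)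
    have hb₁ : b₁ = -a₀ - a₂ := mul_left_cancel₀ h2 (by linear_combination e₁ + e₂)
    have hp : η ^ l = η :=
      mul_left_cancel₀ (mul_ne_zero h2 ha₁) (by
        subst hb₀; linear_combination e₄ - e₃)
    refine mul_ne_zero (mul_ne_zero h2 ha₀) hη2' ?_
    subst hb₁
    linear_combination -e₃ - e₄ - 2 * (a₀ + a₂) * η * hp


/-- For a prime power `q ≡ 3 (mod 4)` and `n = 4q-4`, the cyclic code
`C = {c ∈ F_q^n : c(1) = c(-1) = c(ξ) = c(ξ^q) = c(ξ^2) = c(ξ^{2q}) = 0}` contains, for every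
`4 ≤ ℓ ≤ n-3`, no codeword whose support is exactly `{0, 1, 2, ℓ, ℓ+1}`. -/
theorem stmt_6 (q : ℕ) (hq : IsPrimePow q) (hq4 : q % 4 = 3)
    (F F2 : Type) [Field F] [Fintype F]
    [Field F2] [Fintype F2] [Algebra F F2]
    (hF : Fintype.card F = q) (hF2 : Fintype.card F2 = q ^ 2)
    (ξ : F2) (hξ : IsPrimitiveRoot ξ (4 * q - 4))
    (C : Set (Fin (4 * q - 4) → F))
    (hC : C = {c | ∀ α ∈ ({1, -1, ξ, ξ ^ q, ξ ^ 2, ξ ^ (2 * q)} : Set F2),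
      ∑ i : Fin (4 * q - 4), algebraMap F F2 (c i) * α ^ (i : ℕ) = 0}) :
    ∀ ℓ : ℕ, 4 ≤ ℓ → ℓ ≤ 4 * q - 4 - 3 →
      ¬ ∃ c ∈ C, ∀ i : Fin (4 * q - 4),
        c i ≠ 0 ↔ ((i : ℕ) = 0 ∨ (i : ℕ) = 1 ∨ (i : ℕ) = 2 ∨ (i : ℕ) = ℓ ∨ (i : ℕ) = ℓ + 1) := by
  rintro l hl hln ⟨c, hc, hsupp⟩
  subst hC
  have hξ' : IsPrimitiveRoot ξ (4 * (q - 1)) := by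
    rwa [show 4 * (q - 1) = 4 * q - 4 by omega]
  have hneg := hξ'.pow_two_mul_eq_neg_one (by omega)
  have h2q : ξ ^ (2 * q) = -ξ ^ 2 := by
    rw [show 2 * q = 2 * (q - 1) + 2 by omega, pow_add, hneg, neg_one_mul]
  have h2 : (2 : F2) ≠ 0 := by
    intro h
    refine hξ'.pow_ne_one_of_pos_of_lt (l := 2 * (q - 1)) (by omega) (by omega) ?_
    rw [hneg]
    linear_combination -h
  have hη2 : (ξ ^ 2) ^ 2 ≠ 1 := by
    rw [← pow_mul]
    exact hξ.pow_ne_one_of_pos_of_lt (by omega) (by omega)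
  have hne (i : Fin (4 * q - 4)) : algebraMap F F2 (c i) ≠ 0 ↔ c i ≠ 0 := by simp
  refine not_vanish_at_pm_one_pm (η := ξ ^ 2) h2 (pow_ne_zero 2 (hξ.ne_zero (by omega))) hη2
    ((hne ⟨0, by omega⟩).2 ((hsupp _).2 (by simp)))
    ((hne ⟨1, by omega⟩).2 ((hsupp _).2 (by simp)))
    ((hne ⟨2, by omega⟩).2 ((hsupp _).2 (by simp))) l
    (b₀ := algebraMap F F2 (c ⟨l, by omega⟩))
    (b₁ := algebraMap F F2 (c ⟨l + 1, by omega⟩)) fun α hα => ?_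
  rw [← sum_mul_pow_eq_of_support hl (by omega) (fun i => algebraMap F F2 (c i))
    (fun i hi => (hsupp i).1 ((hne i).1 hi)) α]
  refine hc α ?_
  rw [h2q]
  simp only [Set.mem_insert_iff, Set.mem_singleton_iff] at hα ⊢
  tauto
end

section
/- Let q be a prime power with q ≡ 3 (mod 4), n = 4q-4, ξ ∈ F_{q^2} a primitive n-th root of unity, and let C ⊆ F_q^n be the cyclic code C = {c ∈ F_q^n : c(1) = c(-1) = c(ξ) = c(ξ^q) = c(ξ^2) = c(ξ^{2q}) = 0, evaluation in F_{q^2}}. Then C is an (n = 4q-4, d_P = 8)_q MDS symbol-pair code; that is, d_P(C) = 8 and |C| = q^{n-6}. -/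
open Polynomial

section PairSupport

variable {K : Type*} [Field K]

lemma card_ne_one_of_sum_eq_zero {ι M : Type*} [AddCommMonoid M] {S : Finset ι} {b : ι → M}
    (hb : ∀ x ∈ S, b x ≠ 0) (h0 : ∑ x ∈ S, b x = 0) : S.card ≠ 1 := by
  intro h
  obtain ⟨m, rfl⟩ := Finset.card_eq_one.1 h
  exact hb m (by simp) (by simpa using h0)

variable [DecidableEq K]

/-- A two-term combination annihilating `1` and `x ^ 2` is supported on `{m, -m}`. -/
lemma exists_eq_pair_neg_of_card_eq_two {S : Finset K} {b : K → K}
    (hb : ∀ x ∈ S, b x ≠ 0) (h0 : ∑ x ∈ S, b x = 0) (h2 : ∑ x ∈ S, b x * x ^ 2 = 0)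
    (hS : S.card = 2) : ∃ m, m ≠ -m ∧ S = {m, -m} ∧ b (-m) = -b m := by
  obtain ⟨x, y, hxy, rfl⟩ := Finset.card_eq_two.1 hS
  rw [Finset.sum_pair hxy] at h0 h2
  have hy : y = -x := by
    have h : b x * ((x - y) * (x + y)) = 0 := by linear_combination h2 - y ^ 2 * h0
    have h' := (mul_eq_zero.1 ((mul_eq_zero.1 h).resolve_left (hb x (by simp)))).resolve_left
      (sub_ne_zero.2 hxy)
    linear_combination h'
  subst hy
  exact ⟨x, hxy, rfl, by linear_combination h0⟩

/-- The squares of the points supporting a three-term combination annihilating `1` and `x ^ 2` are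
distinct. -/
lemma injOn_sq_of_card_eq_three {S : Finset K} {b : K → K}
    (hb : ∀ x ∈ S, b x ≠ 0) (h0 : ∑ x ∈ S, b x = 0) (h2 : ∑ x ∈ S, b x * x ^ 2 = 0)
    (hS : S.card = 3) : Set.InjOn (fun x : K => x ^ 2) S := by
  intro x hx y hy hxy
  by_contra hne
  obtain ⟨z, hz⟩ : ∃ z, (S.erase x).erase y = {z} := by
    apply Finset.card_eq_one.1
    rw [Finset.card_erase_of_mem (by simpa [Ne.symm hne] using hy), Finset.card_erase_of_mem hx, hS]
  have hzS : z ∈ (S.erase x).erase y := by simp [hz]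
  simp only [Finset.mem_erase] at hzS
  obtain ⟨hzy, hzx, hzS⟩ := hzS
  have hSe : S = {x, y, z} := by
    rw [← hz, Finset.insert_erase (by simpa [Ne.symm hne] using hy), Finset.insert_erase hx]
  have hx' : x ∉ ({y, z} : Finset K) := by simp [hne, Ne.symm hzx]
  rw [hSe, Finset.sum_insert hx', Finset.sum_pair (Ne.symm hzy)] at h0 h2
  simp only at hxy
  have h : b z * ((z - x) * (z + x)) = 0 := by linear_combination h2 - x ^ 2 * h0 + b y * hxy
  have hzx' : z = -x := by
    have h' := (mul_eq_zero.1 ((mul_eq_zero.1 h).resolve_left (hb z hzS))).resolve_left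
      (sub_ne_zero.2 hzx)
    linear_combination h'
  have hyx : y = -x := by
    have h' : (x - y) * (x + y) = 0 := by linear_combination hxy
    have h'' := (mul_eq_zero.1 h').resolve_left (sub_ne_zero.2 hne)
    linear_combination h''
  exact hzy (hzx'.trans hyx.symm)

lemma neg_notMem_of_card_eq_three (h2K : (2 : K) ≠ 0) {S : Finset K} {b : K → K}
    (hb : ∀ x ∈ S, b x ≠ 0) (h0 : ∑ x ∈ S, b x = 0) (h2 : ∑ x ∈ S, b x * x ^ 2 = 0)
    (hS : S.card = 3) {x : K} (hx0 : x ≠ 0) (hx : x ∈ S) : -x ∉ S := by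
  intro hx'
  have h := injOn_sq_of_card_eq_three hb h0 h2 hS hx hx' (by simp)
  exact mul_ne_zero h2K hx0 (by linear_combination h)

lemma sum_mul_ne_zero_of_card_eq_three {S : Finset K} {b : K → K}
    (hb : ∀ x ∈ S, b x ≠ 0) (h0 : ∑ x ∈ S, b x = 0) (h2 : ∑ x ∈ S, b x * x ^ 2 = 0)
    (hS : S.card = 3) : ∑ x ∈ S, b x * x ≠ 0 := by
  intro h1
  obtain ⟨x, y, z, hxy, hxz, hyz, rfl⟩ := Finset.card_eq_three.1 hS
  have hx' : x ∉ ({y, z} : Finset K) := by simp [hxy, hxz]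
  rw [Finset.sum_insert hx', Finset.sum_pair hyz] at h0 h1 h2
  have h : b x * ((x - y) * (x - z)) = 0 := by
    linear_combination h2 - (y + z) * h1 + y * z * h0
  simp [hb x (by simp), sub_eq_zero, hxy, hxz] at h

variable {F : Type*} [Field F] [Algebra F K]

omit [DecidableEq K] in
lemma pow_eq_of_algebraMap_mul_eq {h : ℕ} (hF : ∀ r : F, r ≠ 0 → r ^ h = 1) {r s : F}
    (hr : r ≠ 0) (hs : s ≠ 0) {x y : K}
    (hxy : algebraMap F K r * x = algebraMap F K s * y) : x ^ h = y ^ h := by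
  have := congrArg (· ^ h) hxy
  simpa [mul_pow, ← map_pow, hF r hr, hF s hs] using this

/-- Two three-term combinations with coefficients in `F`, one supported on `A` and the other on
`ξ A`, cannot cancel at `x` when `ξ` is not in `F`. -/
lemma image_mul_ne_of_card_eq_three {h : ℕ} (hF : ∀ r : F, r ≠ 0 → r ^ h = 1)
    (h2K : (2 : K) ≠ 0) {ξ : K} (hξ : ξ ^ h = -1) (hξ0 : ξ ≠ 0) {a : K → F} {A B : Finset K}
    (ha : ∀ x ∈ A, a x ≠ 0) (hb : ∀ x ∈ B, a x ≠ 0)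
    (hA0 : ∑ x ∈ A, algebraMap F K (a x) = 0)
    (hA2 : ∑ x ∈ A, algebraMap F K (a x) * x ^ 2 = 0)
    (hB0 : ∑ x ∈ B, algebraMap F K (a x) = 0)
    (hB2 : ∑ x ∈ B, algebraMap F K (a x) * x ^ 2 = 0)
    (h1 : ∑ x ∈ A, algebraMap F K (a x) * x + ∑ x ∈ B, algebraMap F K (a x) * x = 0)
    (hA : A.card = 3) : A.image (ξ * ·) ≠ B := by
  rintro rfl
  have ha' : ∀ x ∈ A, algebraMap F K (a x) ≠ 0 := fun x hx => by simpa using ha x hx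
  have hinj := injOn_sq_of_card_eq_three ha' hA0 hA2 hA
  have hne := sum_mul_ne_zero_of_card_eq_three ha' hA0 hA2 hA
  have hmul : Function.Injective (ξ * ·) := mul_right_injective₀ hξ0
  obtain ⟨x, y, z, hxy, hxz, hyz, rfl⟩ := Finset.card_eq_three.1 hA
  have hx' : x ∉ ({y, z} : Finset K) := by simp [hxy, hxz]
  rw [Finset.sum_image hmul.injOn] at hB0 hB2 h1
  rw [Finset.sum_insert hx', Finset.sum_pair hyz] at hA0 hA2 hB0 hB2 hne
  rw [Finset.sum_insert hx', Finset.sum_pair hyz, Finset.sum_insert hx', Finset.sum_pair hyz] at h1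
  have hsq : ∀ s ∈ ({x, y, z} : Finset K), ∀ t ∈ ({x, y, z} : Finset K), s ≠ t →
      s ^ 2 - t ^ 2 ≠ 0 := fun s hs t ht hst h => hst (hinj hs ht (sub_eq_zero.1 h))
  have hvx : a (ξ * x) ≠ 0 := hb _ (by simp)
  have hux : a x ≠ 0 := ha _ (by simp)
  generalize hu1 : algebraMap F K (a x) = u1 at *
  generalize algebraMap F K (a y) = u2 at *
  generalize algebraMap F K (a z) = u3 at *
  generalize hv1 : algebraMap F K (a (ξ * x)) = v1 at *
  generalize algebraMap F K (a (ξ * y)) = v2 at *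
  generalize algebraMap F K (a (ξ * z)) = v3 at *
  have hB2' : v1 * x ^ 2 + (v2 * y ^ 2 + v3 * z ^ 2) = 0 := by
    have : ξ ^ 2 * (v1 * x ^ 2 + (v2 * y ^ 2 + v3 * z ^ 2)) = 0 := by linear_combination hB2
    exact (mul_eq_zero.1 this).resolve_left (pow_ne_zero 2 hξ0)
  have e2 : u1 * v2 = u2 * v1 := by
    apply mul_right_cancel₀ (hsq x (by simp) z (by simp) hxz)
    linear_combination v2 * (hA2 - z ^ 2 * hA0) - u2 * (hB2' - z ^ 2 * hB0)
  have e3 : u1 * v3 = u3 * v1 := by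
    apply mul_right_cancel₀ (hsq x (by simp) y (by simp) hxy)
    linear_combination v3 * (hA2 - y ^ 2 * hA0) - u3 * (hB2' - y ^ 2 * hB0)
  have hprod : (u1 + ξ * v1) * (u1 * x + (u2 * y + u3 * z)) = 0 := by
    linear_combination u1 * h1 - ξ * y * e2 - ξ * z * e3
  have hlin := (mul_eq_zero.1 hprod).resolve_right hne
  have hpow := pow_eq_of_algebraMap_mul_eq hF hvx (neg_ne_zero.2 hux) (x := ξ) (y := (1 : K))
    (by rw [map_neg, hu1, hv1]; linear_combination hlin)
  rw [hξ, one_pow] at hpow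
  exact h2K (by linear_combination -hpow)

/-- The pair `A`, `B` of even and odd supports of a word, as sets of roots of unity, cannot have
sizes two and three and small pair weight. -/
lemma eight_le_of_card_eq_two_of_card_eq_three (h2K : (2 : K) ≠ 0) {ξ : K} (hξ0 : ξ ≠ 0)
    {b : K → K} {A B : Finset K}
    (hB0 : 0 ∉ B) (hbA : ∀ x ∈ A, b x ≠ 0) (hbB : ∀ x ∈ B, b x ≠ 0)
    (hA0 : ∑ x ∈ A, b x = 0) (hA2 : ∑ x ∈ A, b x * x ^ 2 = 0)
    (hB1 : ∑ x ∈ B, b x = 0) (hB2 : ∑ x ∈ B, b x * x ^ 2 = 0)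
    (hA : A.card = 2) (hB : B.card = 3) :
    8 ≤ (A ∪ B.image (ξ⁻¹ * ·)).card + (B ∪ A.image (ξ⁻¹ * ·)).card := by
  by_contra! hlt
  have hmul : Function.Injective (ξ⁻¹ * · : K → K) := mul_right_injective₀ (inv_ne_zero hξ0)
  obtain ⟨m, hm, rfl, -⟩ := exists_eq_pair_neg_of_card_eq_two hbA hA0 hA2 hA
  have hcB : (B.image (ξ⁻¹ * ·)).card = 3 := by rw [Finset.card_image_of_injective _ hmul, hB]
  have key : ∀ x ∈ B, -x ∉ B := fun x hx =>
    neg_notMem_of_card_eq_three h2K hbB hB1 hB2 hB (fun h => hB0 (h ▸ hx)) hx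
  rcases le_or_gt ({m, -m} ∪ B.image (ξ⁻¹ * ·)).card 3 with hc | hc
  · have heq := Finset.eq_of_subset_of_card_le
      (Finset.subset_union_right (s₁ := {m, -m}) (s₂ := B.image (ξ⁻¹ * ·))) (by omega)
    have h1 : m ∈ B.image (ξ⁻¹ * ·) := by rw [heq]; simp
    have h2 : -m ∈ B.image (ξ⁻¹ * ·) := by rw [heq]; simp
    obtain ⟨y, hy, hy'⟩ := Finset.mem_image.1 h1
    obtain ⟨z, hz, hz'⟩ := Finset.mem_image.1 h2
    have : z = -y := hmul (by simp only at hy' hz' ⊢; rw [hz', mul_neg, hy'])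
    exact key y hy (this ▸ hz)
  · have heq := Finset.eq_of_subset_of_card_le
      (Finset.subset_union_left (s₁ := B) (s₂ := ({m, -m} : Finset K).image (ξ⁻¹ * ·))) (by omega)
    have h1 : ξ⁻¹ * m ∈ B := by rw [heq]; simp
    have h2 : -(ξ⁻¹ * m) ∈ B := by rw [heq]; simp
    exact key _ h1 h2

/-- The pair weight bound, with the positions of a word identified with roots of unity, the even
ones being those in `A`, the odd ones those in `B`. -/
lemma eight_le_card_union_add_card_union {h : ℕ} (hF : ∀ r : F, r ≠ 0 → r ^ h = 1)
    (h2K : (2 : K) ≠ 0) {ξ : K} (hξ : ξ ^ h = -1) (hξ0 : ξ ≠ 0) {a : K → F} {A B : Finset K}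
    (hA : ∀ x ∈ A, x ^ h = 1) (hB : ∀ x ∈ B, x ^ h = -1) (hz : 0 ∉ A ∪ B)
    (haA : ∀ x ∈ A, a x ≠ 0) (haB : ∀ x ∈ B, a x ≠ 0)
    (hA0 : ∑ x ∈ A, algebraMap F K (a x) = 0)
    (hA2 : ∑ x ∈ A, algebraMap F K (a x) * x ^ 2 = 0)
    (hB0 : ∑ x ∈ B, algebraMap F K (a x) = 0)
    (hB2 : ∑ x ∈ B, algebraMap F K (a x) * x ^ 2 = 0)
    (h1 : ∑ x ∈ A, algebraMap F K (a x) * x + ∑ x ∈ B, algebraMap F K (a x) * x = 0)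
    (hne : (A ∪ B).Nonempty) :
    8 ≤ (A ∪ B.image (ξ⁻¹ * ·)).card + (B ∪ A.image (ξ⁻¹ * ·)).card := by
  by_contra! hlt
  have hmul : Function.Injective (ξ⁻¹ * · : K → K) := mul_right_injective₀ (inv_ne_zero hξ0)
  have hzA : 0 ∉ A := fun h => hz (Finset.mem_union_left _ h)
  have hzB : 0 ∉ B := fun h => hz (Finset.mem_union_right _ h)
  have haA' : ∀ x ∈ A, algebraMap F K (a x) ≠ 0 := fun x hx => by simpa using haA x hx
  have haB' : ∀ x ∈ B, algebraMap F K (a x) ≠ 0 := fun x hx => by simpa using haB x hx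
  have hcA : (A.image (ξ⁻¹ * ·)).card = A.card := Finset.card_image_of_injective _ hmul
  have hcB : (B.image (ξ⁻¹ * ·)).card = B.card := Finset.card_image_of_injective _ hmul
  have l1 := Finset.card_le_card
    (Finset.subset_union_left (s₁ := A) (s₂ := B.image (ξ⁻¹ * ·)))
  have l2 := Finset.card_le_card
    (Finset.subset_union_right (s₁ := A) (s₂ := B.image (ξ⁻¹ * ·)))
  have l3 := Finset.card_le_card
    (Finset.subset_union_left (s₁ := B) (s₂ := A.image (ξ⁻¹ * ·)))
  have l4 := Finset.card_le_card
    (Finset.subset_union_right (s₁ := B) (s₂ := A.image (ξ⁻¹ * ·)))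
  have hA1 := card_ne_one_of_sum_eq_zero haA' hA0
  have hB1 := card_ne_one_of_sum_eq_zero haB' hB0
  have pair_sum : ∀ {S : Finset K}, (∀ x ∈ S, algebraMap F K (a x) ≠ 0) →
      ∑ x ∈ S, algebraMap F K (a x) = 0 → ∑ x ∈ S, algebraMap F K (a x) * x ^ 2 = 0 →
      S.card = 2 → ∃ m ∈ S, ∑ x ∈ S, algebraMap F K (a x) * x = 2 * (algebraMap F K (a m) * m) := by
    intro S hS h0 h2 hc
    obtain ⟨m, hm, rfl, hbm⟩ := exists_eq_pair_neg_of_card_eq_two hS h0 h2 hc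
    exact ⟨m, by simp, by rw [Finset.sum_pair hm, hbm]; ring⟩
  have single : ∀ {S : Finset K}, (∀ x ∈ S, algebraMap F K (a x) ≠ 0) → 0 ∉ S →
      ∑ x ∈ S, algebraMap F K (a x) = 0 → ∑ x ∈ S, algebraMap F K (a x) * x ^ 2 = 0 →
      ∑ x ∈ S, algebraMap F K (a x) * x = 0 → S.card ≠ 2 ∧ S.card ≠ 3 := by
    intro S hS hzS h0 h2 h1
    refine ⟨fun hc => ?_, fun hc => sum_mul_ne_zero_of_card_eq_three hS h0 h2 hc h1⟩
    obtain ⟨m, hm, hsum⟩ := pair_sum hS h0 h2 hc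
    exact mul_ne_zero h2K (mul_ne_zero (hS m hm) fun h => hzS (h ▸ hm)) (hsum.symm.trans h1)
  have hpos : A.card = 0 → B.card = 0 → False := by
    intro h h'
    rw [Finset.card_eq_zero] at h h'
    simp [h, h'] at hne
  have hA' : A.card = 0 → B.card ≠ 2 ∧ B.card ≠ 3 := by
    intro h
    rw [Finset.card_eq_zero] at h
    subst h
    exact single haB' hzB hB0 hB2 (by simpa using h1)
  have hB' : B.card = 0 → A.card ≠ 2 ∧ A.card ≠ 3 := by
    intro h
    rw [Finset.card_eq_zero] at h
    subst h
    exact single haA' hzA hA0 hA2 (by simpa using h1)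
  have h22 : A.card = 2 → B.card ≠ 2 := by
    intro h h'
    obtain ⟨m, hm, hms⟩ := pair_sum haA' hA0 hA2 h
    obtain ⟨k, hk, hks⟩ := pair_sum haB' hB0 hB2 h'
    rw [hms, hks] at h1
    have hlin : algebraMap F K (a m) * m = algebraMap F K (-a k) * k := by
      apply mul_left_cancel₀ h2K
      rw [map_neg]
      linear_combination h1
    have := pow_eq_of_algebraMap_mul_eq hF (haA m hm) (neg_ne_zero.2 (haB k hk)) hlin
    rw [hA m hm, hB k hk] at this
    exact h2K (by linear_combination this)
  have h23 : A.card = 2 → B.card ≠ 3 := fun h h' => absurd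
    (eight_le_of_card_eq_two_of_card_eq_three h2K hξ0 hzB haA' haB' hA0 hA2 hB0 hB2 h h') (by omega)
  have h32 : A.card = 3 → B.card ≠ 2 := fun h h' => absurd
    (eight_le_of_card_eq_two_of_card_eq_three h2K hξ0 hzA haB' haA' hB0 hB2 hA0 hA2 h' h) (by omega)
  have himg : ∀ {S T : Finset K}, S.card = 3 → T.card = 3 → (S ∪ T.image (ξ⁻¹ * ·)).card ≤ 3 →
      S.image (ξ * ·) = T := by
    intro S T hS hT hc
    have hcT : (T.image (ξ⁻¹ * ·)).card = T.card := Finset.card_image_of_injective _ hmul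
    have e1 := Finset.eq_of_subset_of_card_le
      (Finset.subset_union_left (s₁ := S) (s₂ := T.image (ξ⁻¹ * ·))) (by omega)
    have e2 := Finset.eq_of_subset_of_card_le
      (Finset.subset_union_right (s₁ := S) (s₂ := T.image (ξ⁻¹ * ·))) (by omega)
    rw [e1, ← e2, Finset.image_image]
    simp [Function.comp_def, hξ0]
  have h33 : A.card = 3 → B.card ≠ 3 := by
    intro h h'
    rcases le_or_gt (A ∪ B.image (ξ⁻¹ * ·)).card 3 with hc | hc
    · exact image_mul_ne_of_card_eq_three hF h2K hξ hξ0 haA haB hA0 hA2 hB0 hB2 h1 h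
        (himg h h' hc)
    · exact image_mul_ne_of_card_eq_three hF h2K hξ hξ0 haB haA hB0 hB2 hA0 hA2
        (by rw [add_comm]; exact h1) h' (himg h' h (by omega))
  have hA3 : A.card ≤ 3 := by omega
  have hB3 : B.card ≤ 3 := by omega
  clear * - hA3 hB3 hA1 hB1 hpos hA' hB' h22 h23 h32 h33
  generalize A.card = m at *
  generalize B.card = k at *
  interval_cases m <;> interval_cases k <;> simp_all

end PairSupport

section Dimension

variable {F K : Type*} [Field F] [Field K] [Algebra F K]

/-- Evaluation at `1`, `-1`, `ξ` and `ξ ^ 2` of the polynomial of degree less than `m` with given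
coefficients. -/
noncomputable def evalCoeffs (ξ : K) (m : ℕ) : (Fin m → F) →ₗ[F] F × F × K × K :=
  ((aeval (1 : F)).toLinearMap.prod ((aeval (-1 : F)).toLinearMap.prod
    ((aeval ξ).toLinearMap.prod (aeval (ξ ^ 2)).toLinearMap))) ∘ₗ
    (degreeLT F m).subtype ∘ₗ (degreeLTEquiv F m).symm.toLinearMap

lemma aeval_degreeLTEquiv_symm {m : ℕ} (c : Fin m → F) (α : K) :
    aeval α ((degreeLTEquiv F m).symm c : F[X]) = ∑ i, algebraMap F K (c i) * α ^ (i : ℕ) := by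
  change aeval α (∑ i : Fin m, monomial (i : ℕ) (c i)) = _
  simp [aeval_monomial]

lemma sum_mul_pow_card [Fintype F] {m : ℕ} (c : Fin m → F) (α : K) :
    ∑ i, algebraMap F K (c i) * (α ^ Fintype.card F) ^ (i : ℕ) =
      (∑ i, algebraMap F K (c i) * α ^ (i : ℕ)) ^ Fintype.card F := by
  rw [← aeval_degreeLTEquiv_symm, ← aeval_degreeLTEquiv_symm]
  exact aeval_algHom_apply (FiniteField.frobeniusAlgHom F K) α _

lemma mem_ker_evalCoeffs [Fintype F] {ξ : K} {m : ℕ} {c : Fin m → F} :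
    c ∈ LinearMap.ker (evalCoeffs ξ m) ↔
      ∀ α ∈ ({1, -1, ξ, ξ ^ Fintype.card F, ξ ^ 2, ξ ^ (2 * Fintype.card F)} : Set K),
        ∑ i, algebraMap F K (c i) * α ^ (i : ℕ) = 0 := by
  have hcard : Fintype.card F ≠ 0 := Fintype.card_ne_zero
  have hmap : ∀ r : F, aeval r ((degreeLTEquiv F m).symm c : F[X]) = 0 ↔
      ∑ i, algebraMap F K (c i) * algebraMap F K r ^ (i : ℕ) = 0 := by
    intro r
    rw [← aeval_degreeLTEquiv_symm, aeval_algebraMap_apply, FaithfulSMul.algebraMap_eq_zero_iff]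
  have h1 := hmap 1
  have h2 := hmap (-1)
  rw [map_one] at h1
  rw [map_neg, map_one] at h2
  rw [LinearMap.mem_ker]
  change (aeval (1 : F) ((degreeLTEquiv F m).symm c : F[X]),
    aeval (-1 : F) ((degreeLTEquiv F m).symm c : F[X]),
    aeval ξ ((degreeLTEquiv F m).symm c : F[X]),
    aeval (ξ ^ 2) ((degreeLTEquiv F m).symm c : F[X])) = 0 ↔ _
  simp only [Prod.mk_eq_zero, h1, h2, Set.mem_insert_iff, Set.mem_singleton_iff, forall_eq_or_imp,
    forall_eq, pow_mul ξ 2, sum_mul_pow_card, pow_eq_zero_iff hcard, aeval_degreeLTEquiv_symm (K := K)]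
  tauto

lemma ker_evalCoeffs_six_eq_bot [Fintype F] {ξ : K} {v : Fin 6 → K} (hv : Function.Injective v)
    (hvξ : ∀ j, v j ∈ ({1, -1, ξ, ξ ^ Fintype.card F, ξ ^ 2, ξ ^ (2 * Fintype.card F)} : Set K)) :
    LinearMap.ker (evalCoeffs (F := F) ξ 6) = ⊥ := by
  rw [LinearMap.ker_eq_bot']
  intro c hc
  have hker := mem_ker_evalCoeffs.1 (LinearMap.mem_ker.2 hc)
  have := Matrix.eq_zero_of_forall_index_sum_mul_pow_eq_zero (f := v)
    (v := fun i => algebraMap F K (c i)) hv fun j => hker _ (hvξ j)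
  ext i
  simpa using congrFun this i

/-- Words of length at most `m` are words of length `m`. -/
lemma range_evalCoeffs_mono {ξ : K} {m k : ℕ} (h : k ≤ m) :
    LinearMap.range (evalCoeffs (F := F) ξ k) ≤ LinearMap.range (evalCoeffs (F := F) ξ m) := by
  rintro _ ⟨c, rfl⟩
  refine ⟨degreeLTEquiv F m
    ⟨(degreeLTEquiv F k).symm c, degreeLT_mono h ((degreeLTEquiv F k).symm c).2⟩, ?_⟩
  simp [evalCoeffs]

lemma finrank_ker_evalCoeffs [FiniteDimensional F K] (hK : Module.finrank F K = 2) {ξ : K}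
    (h6 : LinearMap.ker (evalCoeffs (F := F) ξ 6) = ⊥) {m : ℕ} (hm : 6 ≤ m) :
    Module.finrank F (LinearMap.ker (evalCoeffs (F := F) ξ m)) = m - 6 := by
  have hdim : Module.finrank F (F × F × K × K) = 6 := by simp [hK]
  have hrank6 := LinearMap.finrank_range_add_finrank_ker (evalCoeffs (F := F) ξ 6)
  have hrank := LinearMap.finrank_range_add_finrank_ker (evalCoeffs (F := F) ξ m)
  have hle := Submodule.finrank_mono (range_evalCoeffs_mono (F := F) (ξ := ξ) hm)
  have hle' := Submodule.finrank_le (LinearMap.range (evalCoeffs (F := F) ξ m))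
  rw [h6, finrank_bot, Module.finrank_fin_fun] at hrank6
  rw [Module.finrank_fin_fun] at hrank
  omega

/-- There is a nonzero word in the kernel supported on the first seven positions. -/
lemma exists_mem_ker_evalCoeffs [FiniteDimensional F K] (hK : Module.finrank F K = 2) (ξ : K)
    {m : ℕ} (hm : 7 ≤ m) :
    ∃ c ∈ LinearMap.ker (evalCoeffs (F := F) ξ m), c ≠ 0 ∧ ∀ i : Fin m, 7 ≤ (i : ℕ) → c i = 0 := by
  have hker : LinearMap.ker (evalCoeffs (F := F) ξ 7) ≠ ⊥ :=
    LinearMap.ker_ne_bot_of_finrank_lt (by simp [hK])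
  obtain ⟨c, hc, hc0⟩ := Submodule.exists_mem_ne_zero_of_ne_bot hker
  set p := (degreeLTEquiv F 7).symm c with hp
  have hp0 : (p : F[X]) ≠ 0 := by simpa [hp] using hc0
  refine ⟨degreeLTEquiv F m ⟨p, degreeLT_mono hm p.2⟩, ?_, ?_, ?_⟩
  · rw [LinearMap.mem_ker] at hc ⊢
    simpa [evalCoeffs] using hc
  · simpa using hp0
  · intro i hi
    exact coeff_eq_zero_of_degree_lt ((mem_degreeLT.1 p.2).trans_le (by exact_mod_cast hi))

end Dimension

/-- A nonzero word vanishing at `±1`, `ξ` and `± ξ ^ 2` has pair weight at least `8`. -/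
lemma eight_le_pairWeight {F K : Type*} [Field F] [DecidableEq F] [Field K] [Algebra F K]
    {n h : ℕ} (hn : n = 2 * h) (hh0 : 0 < h) (hF : ∀ r : F, r ≠ 0 → r ^ h = 1) (h2K : (2 : K) ≠ 0)
    {ξ : K} (hξ : IsPrimitiveRoot ξ n) {c : Fin n → F} (hc : c ≠ 0)
    (hpos : ∑ i, algebraMap F K (c i) = 0)
    (hneg : ∑ i, algebraMap F K (c i) * (-1) ^ (i : ℕ) = 0)
    (h1 : ∑ i, algebraMap F K (c i) * ξ ^ (i : ℕ) = 0)
    (h2 : ∑ i, algebraMap F K (c i) * (ξ ^ 2) ^ (i : ℕ) = 0)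
    (h2' : ∑ i, algebraMap F K (c i) * (-ξ ^ 2) ^ (i : ℕ) = 0)
    {next : Fin n → Fin n} (hnext : ∀ i, (next i : ℕ) = (i + 1) % n) :
    8 ≤ (Finset.univ.filter fun i => c i ≠ 0 ∨ c (next i) ≠ 0).card := by
  classical
  have hξ0 : ξ ≠ 0 := hξ.ne_zero (by omega)
  have hξh : ξ ^ h = -1 := (hξ.pow (by omega) (by omega : n = h * 2)).eq_neg_one_of_two_right
  have h11 : (1 : K) ≠ -1 := fun h => h2K (by linear_combination h)
  set x : Fin n → K := fun i => ξ ^ (i : ℕ) with hx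
  have hinj : Function.Injective x := fun i j hij => Fin.ext (hξ.pow_inj i.2 j.2 hij)
  have hxh : ∀ i, x i ^ h = (-1) ^ (i : ℕ) := fun i => by rw [hx, ← hξh, pow_right_comm]
  have hxh' : ∀ i, x i ^ h = 1 ∨ x i ^ h = -1 := fun i => by
    rw [hxh]; exact neg_one_pow_eq_or K _
  have hxnext : ∀ i, x (next i) = ξ * x i := by
    intro i
    simp only [hx, hnext]
    rw [← pow_succ', ← pow_eq_pow_mod _ hξ.pow_eq_one]
  have hsurj : Function.Surjective next := Finite.surjective_of_injective fun i j hij =>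
    hinj (mul_left_cancel₀ hξ0 (by rw [← hxnext, ← hxnext, hij]))
  set E := Finset.univ.filter fun i => c i ≠ 0 ∧ x i ^ h = 1 with hE
  set O := Finset.univ.filter fun i => c i ≠ 0 ∧ x i ^ h = -1 with hO
  have hsplit : ∀ f : Fin n → K, ∑ i, algebraMap F K (c i) * f i =
      ∑ i ∈ E, algebraMap F K (c i) * f i + ∑ i ∈ O, algebraMap F K (c i) * f i := by
    intro f
    rw [hE, hO, Finset.sum_filter, Finset.sum_filter, ← Finset.sum_add_distrib]
    refine Finset.sum_congr rfl fun i _ => ?_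
    by_cases hci : c i = 0
    · simp [hci]
    · rcases hxh' i with hi | hi <;> simp [hi, hci, h11, h11.symm]
  have hzero : ∀ f : Fin n → K, ∑ i, algebraMap F K (c i) * f i = 0 →
      ∑ i, algebraMap F K (c i) * ((-1) ^ (i : ℕ) * f i) = 0 →
      ∑ i ∈ E, algebraMap F K (c i) * f i = 0 ∧ ∑ i ∈ O, algebraMap F K (c i) * f i = 0 := by
    intro f hf hf'
    rw [hsplit] at hf hf'
    have hEs : ∑ i ∈ E, algebraMap F K (c i) * ((-1) ^ (i : ℕ) * f i) =
        ∑ i ∈ E, algebraMap F K (c i) * f i :=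
      Finset.sum_congr rfl fun i hi => by rw [← hxh, (Finset.mem_filter.1 hi).2.2, one_mul]
    have hOs : ∑ i ∈ O, algebraMap F K (c i) * ((-1) ^ (i : ℕ) * f i) =
        -∑ i ∈ O, algebraMap F K (c i) * f i := by
      rw [← Finset.sum_neg_distrib]
      exact Finset.sum_congr rfl fun i hi => by rw [← hxh, (Finset.mem_filter.1 hi).2.2]; ring
    rw [hEs, hOs] at hf'
    constructor
    · exact (mul_eq_zero.1 (by linear_combination hf + hf' :
        2 * ∑ i ∈ E, algebraMap F K (c i) * f i = 0)).resolve_left h2K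
    · exact (mul_eq_zero.1 (by linear_combination hf - hf' :
        2 * ∑ i ∈ O, algebraMap F K (c i) * f i = 0)).resolve_left h2K
  obtain ⟨hE0, hO0⟩ := hzero (fun _ => 1) (by simpa using hpos) (by simpa using hneg)
  obtain ⟨hE2, hO2⟩ := hzero (fun i => x i ^ 2) (by simpa only [hx, pow_right_comm] using h2)
    (by
      rw [← h2']
      refine Finset.sum_congr rfl fun i _ => ?_
      rw [neg_pow (ξ ^ 2), hx, pow_right_comm])
  rw [hsplit] at h1
  have hext : ∀ i, Function.extend x c 0 (x i) = c i := hinj.extend_apply c 0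
  have hsum : ∀ (S : Finset (Fin n)) (g : K → K),
      ∑ y ∈ S.image x, algebraMap F K (Function.extend x c 0 y) * g y =
        ∑ i ∈ S, algebraMap F K (c i) * g (x i) := by
    intro S g
    rw [Finset.sum_image hinj.injOn]
    simp only [hext]
  have hmain := eight_le_card_union_add_card_union (a := Function.extend x c 0)
    (A := E.image x) (B := O.image x) hF h2K hξh hξ0
    (Finset.forall_mem_image.2 <| by simp +contextual [hE])
    (Finset.forall_mem_image.2 <| by simp +contextual [hO])
    (by simp [hx, hξ0])
    (Finset.forall_mem_image.2 <| by simp +contextual [hE, hext])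
    (Finset.forall_mem_image.2 <| by simp +contextual [hO, hext])
    (by simpa using (hsum E fun _ => 1).trans hE0) ((hsum E (· ^ 2)).trans hE2)
    (by simpa using (hsum O fun _ => 1).trans hO0) ((hsum O (· ^ 2)).trans hO2)
    (by rw [← h1]; exact congrArg₂ (· + ·) (hsum E id) (hsum O id))
    (by
      obtain ⟨i, hi⟩ := Function.ne_iff.1 hc
      refine ⟨x i, ?_⟩
      rcases hxh' i with hi' | hi'
      · exact Finset.mem_union_left _ (Finset.mem_image_of_mem x (by simpa [hE, hi'] using hi))
      · exact Finset.mem_union_right _ (Finset.mem_image_of_mem x (by simpa [hO, hi'] using hi)))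
  refine hmain.trans ?_
  set T := Finset.univ.filter fun i => c i ≠ 0 ∨ c (next i) ≠ 0 with hT
  have hsub : ∀ (ε : K) (S S' : Finset (Fin n)), (∀ i ∈ S, c i ≠ 0 ∧ x i ^ h = ε) →
      (∀ i ∈ S', c i ≠ 0 ∧ x i ^ h = -ε) →
      S.image x ∪ (S'.image x).image (ξ⁻¹ * ·) ⊆ (T.filter fun i => x i ^ h = ε).image x := by
    intro ε S S' hS hS'
    refine Finset.union_subset (Finset.image_subset_image fun i hi => ?_) ?_
    · simp [hT, hS i hi]
    · intro y hy
      simp only [Finset.mem_image, exists_exists_and_eq_and] at hy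
      obtain ⟨j, hj, rfl⟩ := hy
      obtain ⟨i, rfl⟩ := hsurj j
      rw [hxnext, inv_mul_cancel_left₀ hξ0]
      obtain ⟨hcj, hj⟩ := hS' _ hj
      rw [hxnext, mul_pow, hξh] at hj
      refine Finset.mem_image_of_mem x ?_
      simp only [hT, Finset.mem_filter, Finset.mem_univ, true_and]
      exact ⟨Or.inr hcj, by linear_combination -hj⟩
  have hle1 := Finset.card_le_card (hsub 1 E O (by simp [hE]) (by simp [hO]))
  have hle2 := Finset.card_le_card (hsub (-1) O E (by simp [hO]) (by simp [hE]))
  have hcard := Finset.card_filter_add_card_filter_not (s := T) (fun i => x i ^ h = 1)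
  have hnot : T.filter (fun i => ¬x i ^ h = 1) = T.filter fun i => x i ^ h = -1 :=
    Finset.filter_congr fun i _ => ⟨(hxh' i).resolve_left, fun hi hi' => h11 (hi'.symm.trans hi)⟩
  rw [hnot] at hcard
  rw [Finset.card_image_of_injective _ hinj] at hle1 hle2
  omega


/-- For a prime power `q ≡ 3 (mod 4)` and `n = 4q-4`, the cyclic code
`C = {c ∈ F_q^n : c(1) = c(-1) = c(ξ) = c(ξ^q) = c(ξ^2) = c(ξ^{2q}) = 0}` (with `ξ` a primitive
`n`-th root of unity in `F_{q^2}`) is an `(n, d_P = 8)_q` MDS symbol-pair code: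
its minimum pair distance is `8` and `|C| = q^{n-6}`. -/
theorem stmt_8 (q : ℕ) (hq : IsPrimePow q) (hq4 : q % 4 = 3)
    (F F2 : Type) [Field F] [Fintype F] [DecidableEq F]
    [Field F2] [Fintype F2] [Algebra F F2]
    (hF : Fintype.card F = q) (hF2 : Fintype.card F2 = q ^ 2)
    (ξ : F2) (hξ : IsPrimitiveRoot ξ (4 * q - 4))
    (C : Set (Fin (4 * q - 4) → F))
    (hC : C = {c | ∀ α ∈ ({1, -1, ξ, ξ ^ q, ξ ^ 2, ξ ^ (2 * q)} : Set F2),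
      ∑ i : Fin (4 * q - 4), algebraMap F F2 (c i) * α ^ (i : ℕ) = 0}) :
    IsLeast {w : ℕ | ∃ c ∈ C, c ≠ 0 ∧
        (Finset.univ.filter fun i : Fin (4 * q - 4) =>
          c i ≠ 0 ∨ c ⟨((i : ℕ) + 1) % (4 * q - 4), Nat.mod_lt _ (by omega)⟩ ≠ 0).card = w} 8
      ∧ Nat.card ↥C = q ^ (4 * q - 4 - 6) := by
  classical
  have hodd : 3 ≤ q := by omega
  have hξh : ξ ^ (2 * (q - 1)) = -1 :=
    (hξ.pow (by omega) (by omega : 4 * q - 4 = 2 * (q - 1) * 2)).eq_neg_one_of_two_right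
  have h2K : (2 : F2) ≠ 0 := by
    intro h
    have : ξ ^ (2 * (q - 1)) = ξ ^ 0 := by rw [hξh]; linear_combination -h
    have := hξ.pow_inj (by omega) (by omega) this
    omega
  have hFh : ∀ r : F, r ≠ 0 → r ^ (2 * (q - 1)) = 1 := by
    intro r hr
    rw [mul_comm, pow_mul, ← hF, FiniteField.pow_card_sub_one_eq_one r hr, one_pow]
  have hξ2q : ξ ^ (2 * q) = -ξ ^ 2 := by
    rw [show 2 * q = 2 * (q - 1) + 2 by omega, pow_add, hξh]; ring
  have hrank : Module.finrank F F2 = 2 := by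
    have := Module.card_eq_pow_finrank (K := F) (V := F2)
    rw [hF, hF2] at this
    exact (Nat.pow_right_injective (by omega) this).symm
  have hker : C = LinearMap.ker (evalCoeffs (F := F) ξ (4 * q - 4)) := by
    ext c
    rw [hC, SetLike.mem_coe, mem_ker_evalCoeffs, hF]
    rfl
  have hbot : LinearMap.ker (evalCoeffs (F := F) ξ 6) = ⊥ := by
    apply ker_evalCoeffs_six_eq_bot (v := fun j => ξ ^ (![0, 2 * (q - 1), 1, q, 2, 2 * q] j))
    · intro j k hjk
      have hlt : ∀ j, ![0, 2 * (q - 1), 1, q, 2, 2 * q] j < 4 * q - 4 := by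
        intro j
        fin_cases j <;> simp <;> omega
      have := hξ.pow_inj (hlt j) (hlt k) hjk
      fin_cases j <;> fin_cases k <;> simp at this ⊢ <;> omega
    · intro j
      rw [hF]
      fin_cases j <;> simp [hξh]
  have hlower : ∀ c ∈ C, c ≠ 0 → 8 ≤ (Finset.univ.filter fun i : Fin (4 * q - 4) =>
      c i ≠ 0 ∨ c ⟨((i : ℕ) + 1) % (4 * q - 4), Nat.mod_lt _ (by omega)⟩ ≠ 0).card := by
    intro c hcC hc
    rw [hC] at hcC
    refine eight_le_pairWeight (h := 2 * (q - 1)) (by omega) (by omega) hFh h2K hξ hc ?_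
      (hcC (-1) (by simp)) (hcC ξ (by simp)) (hcC (ξ ^ 2) (by simp)) ?_ fun i => rfl
    · simpa using hcC 1 (by simp)
    · rw [← hξ2q]
      exact hcC _ (by simp)
  refine ⟨⟨?_, ?_⟩, ?_⟩
  · obtain ⟨c, hcker, hc0, hc⟩ := exists_mem_ker_evalCoeffs (F := F) hrank ξ
      (by omega : 7 ≤ 4 * q - 4)
    have hcC : c ∈ C := by rw [hker]; exact hcker
    refine ⟨c, hcC, hc0, le_antisymm ?_ (hlower c hcC hc0)⟩
    have hsub : (Finset.univ.filter fun i : Fin (4 * q - 4) =>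
        c i ≠ 0 ∨ c ⟨((i : ℕ) + 1) % (4 * q - 4), Nat.mod_lt _ (by omega)⟩ ≠ 0).image Fin.val ⊆
        insert (4 * q - 5) (Finset.range 7) := by
      intro k hk
      simp only [Finset.mem_image, Finset.mem_filter, Finset.mem_univ, true_and] at hk
      obtain ⟨i, hi, rfl⟩ := hk
      rw [Finset.mem_insert, Finset.mem_range]
      by_contra! hcon
      have hmod : ((i : ℕ) + 1) % (4 * q - 4) = i + 1 := Nat.mod_eq_of_lt (by omega)
      rcases hi with hi | hi
      · exact hi (hc i hcon.2)
      · exact hi (hc _ (by simp only [hmod]; omega))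
    rw [← Finset.card_image_of_injective _ Fin.val_injective]
    exact (Finset.card_le_card hsub).trans ((Finset.card_insert_le _ _).trans (by simp))
  · rintro w ⟨c, hcC, hc0, rfl⟩
    exact hlower c hcC hc0
  · have hcard := Module.natCard_eq_pow_finrank (K := F)
      (V := LinearMap.ker (evalCoeffs (F := F) ξ (4 * q - 4)))
    rw [finrank_ker_evalCoeffs hrank hbot (by omega), Nat.card_eq_fintype_card (α := F), hF]
      at hcard
    rw [hker]
    exact hcard
end

section
/- Let q be an odd prime power, n = 2q+2, ξ ∈ F_{q^2} a primitive n-th root of unity, and let C ⊆ F_q^n be the cyclic code C = {c ∈ F_q^n : c(α) = 0 for every α ∈ {1, ξ, ξ^{-1}, ξ^q, ξ^{-q}, ξ^2, ξ^{2q}}, evaluation in F_{q^2}}. Then the minimum Hamming distance of C satisfies: d_H(C) = 8 if q = 3, and d_H(C) = 6 if q ≥ 5. -/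
open Polynomial in
/-- A weighted power-sum system at distinct nodes, with at least as many exponents as nodes, has
only the zero solution. -/
theorem eq_zero_of_sum_mul_pow_eq_zero {ι K : Type*} [Field K] (s : Finset ι)
    (p : ι → K) (hp : Set.InjOn p s) (c : ι → K) (m : ℕ) (hm : s.card ≤ m)
    (h : ∀ k < m, ∑ i ∈ s, c i * p i ^ k = 0) : ∀ i ∈ s, c i = 0 := by
  classical
  intro i hi
  set f : K[X] := ∏ j ∈ s.erase i, (X - C (p j)) with hf
  have hdeg : f.natDegree < m := by
    rw [hf, natDegree_finsetProd_X_sub_C_eq_card, Finset.card_erase_of_mem hi]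
    have := Finset.card_pos.2 ⟨i, hi⟩
    omega
  have hsum : ∑ j ∈ s, c j * f.eval (p j) = 0 := by
    simp_rw [eval_eq_sum_range' hdeg, Finset.mul_sum]
    rw [Finset.sum_comm]
    refine Finset.sum_eq_zero fun k hk => ?_
    have := h k (Finset.mem_range.1 hk)
    calc ∑ j ∈ s, c j * (f.coeff k * p j ^ k) = f.coeff k * ∑ j ∈ s, c j * p j ^ k := by
          rw [Finset.mul_sum]; exact Finset.sum_congr rfl fun j _ => by ring
      _ = 0 := by rw [this, mul_zero]
  rw [Finset.sum_eq_single_of_mem i hi] at hsum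
  · refine (mul_eq_zero.1 hsum).resolve_right ?_
    rw [hf, eval_prod, ← ne_eq, Finset.prod_ne_zero_iff]
    intro j hj
    obtain ⟨hji, hjs⟩ := Finset.mem_erase.1 hj
    simpa [sub_eq_zero] using fun e => hji (hp hi hjs e).symm
  · intro j hj hji
    rw [hf, eval_prod, Finset.prod_eq_zero (Finset.mem_erase.2 ⟨hji, hj⟩) (by simp), mul_zero]

/-- If the weighted power sums of exponents `-1` and `1` vanish separately over `A` and over `B`,
and those of exponents `-2`, `0`, `2` vanish over `A ∪ B`, then at most five nodes cannot carry
nonzero weights, provided no node of `A` is opposite or equal to a node of `B`. -/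
theorem eq_empty_of_card_add_card_le_five {ι K : Type*} [Field K]
    (A B : Finset ι) (p : ι → K) (hp : Function.Injective p) (hp0 : ∀ i, p i ≠ 0)
    (hAB : ∀ a ∈ A, ∀ b ∈ B, p a ^ 2 ≠ p b ^ 2) (c : ι → K)
    (hcA : ∀ a ∈ A, c a ≠ 0) (hcB : ∀ b ∈ B, c b ≠ 0)
    (hA1 : ∑ i ∈ A, c i * p i = 0) (hA1' : ∑ i ∈ A, c i * (p i)⁻¹ = 0)
    (hB1 : ∑ i ∈ B, c i * p i = 0) (hB1' : ∑ i ∈ B, c i * (p i)⁻¹ = 0)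
    (h0 : ∑ i ∈ A, c i + ∑ i ∈ B, c i = 0)
    (h2 : ∑ i ∈ A, c i * p i ^ 2 + ∑ i ∈ B, c i * p i ^ 2 = 0)
    (h2' : ∑ i ∈ A, c i * (p i)⁻¹ ^ 2 + ∑ i ∈ B, c i * (p i)⁻¹ ^ 2 = 0)
    (hcard : A.card + B.card ≤ 5) (hle : A.card ≤ B.card) : A = ∅ ∧ B = ∅ := by
  rcases A.eq_empty_or_nonempty with rfl | ⟨u, hu⟩
  · refine ⟨rfl, Finset.eq_empty_of_forall_notMem fun b hb => hcB b hb ?_⟩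
    simp only [Finset.sum_empty, zero_add, Finset.card_empty] at h0 h2 h2' hcard
    have key := eq_zero_of_sum_mul_pow_eq_zero B p hp.injOn (fun i => c i * (p i)⁻¹ ^ 2) 5 hcard
      (by
        intro k hk
        interval_cases k
        · simpa using h2'
        · rw [← hB1']
          refine Finset.sum_congr rfl fun i _ => ?_
          have := hp0 i
          field_simp
        · rw [← h0]
          refine Finset.sum_congr rfl fun i _ => ?_
          have := hp0 i
          field_simp
        · rw [← hB1]
          refine Finset.sum_congr rfl fun i _ => ?_
          have := hp0 i
          field_simp
        · rw [← h2]
          refine Finset.sum_congr rfl fun i _ => ?_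
          have := hp0 i
          field_simp) b hb
    simpa [hp0 b] using key
  · exfalso
    have hA2 : ∀ i ∈ A, p i ^ 2 = p u ^ 2 := by
      by_contra! hcon
      obtain ⟨v, hv, hvu⟩ := hcon
      have key := eq_zero_of_sum_mul_pow_eq_zero A (fun i => p i ^ 2)
        (by
          classical
          have huv : u ≠ v := fun e => hvu (by rw [e])
          have hAe : A = {u, v} := (Finset.eq_of_subset_of_card_le
            (by simp [Finset.insert_subset_iff, hu, hv])
            (by rw [Finset.card_pair huv]; omega)).symm
          rw [hAe]
          intro x hx y hy hxy
          simp only [Finset.coe_insert, Finset.coe_singleton, Set.mem_insert_iff,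
            Set.mem_singleton_iff] at hx hy
          rcases hx with rfl | rfl <;> rcases hy with rfl | rfl
          · rfl
          · exact absurd hxy.symm hvu
          · exact absurd hxy hvu
          · rfl) (fun i => c i * (p i)⁻¹) 2 (by omega)
        (by
          intro k hk
          interval_cases k
          · simpa using hA1'
          · rw [← hA1]
            refine Finset.sum_congr rfl fun i _ => ?_
            have := hp0 i
            field_simp) u hu
      exact hcA u hu (by simpa [hp0 u] using key)
    have hB : B.Nonempty := Finset.card_pos.1 (lt_of_lt_of_le (Finset.card_pos.2 ⟨u, hu⟩) hle)
    obtain ⟨v, hv⟩ := hB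
    have hA3 : 2 ≤ A.card := by
      by_contra! hlt
      have := eq_zero_of_sum_mul_pow_eq_zero A p hp.injOn (fun i => c i * p i) 1 (by omega)
        (by
          intro k hk
          interval_cases k
          simpa using hA1) u hu
      exact hcA u hu (by simpa [hp0 u] using this)
    have hs2 : ∑ i ∈ A, c i * p i ^ 2 = p u ^ 2 * ∑ i ∈ A, c i := by
      rw [Finset.mul_sum]
      exact Finset.sum_congr rfl fun i hi => by rw [hA2 i hi, mul_comm]
    have hs2' : p u ^ 2 * ∑ i ∈ A, c i * (p i)⁻¹ ^ 2 = ∑ i ∈ A, c i := by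
      rw [Finset.mul_sum]
      refine Finset.sum_congr rfl fun i hi => ?_
      rw [← hA2 i hi]
      have := hp0 i
      field_simp
    have key := eq_zero_of_sum_mul_pow_eq_zero B (fun i => (p i)⁻¹)
      (fun x _ y _ hxy => hp (inv_injective hxy)) (fun i => c i * (p i ^ 2 - p u ^ 2)) 3 (by omega)
      (by
        have expand : ∀ k, ∑ i ∈ B, c i * (p i ^ 2 - p u ^ 2) * (p i)⁻¹ ^ k =
            ∑ i ∈ B, c i * p i ^ 2 * (p i)⁻¹ ^ k - p u ^ 2 * ∑ i ∈ B, c i * (p i)⁻¹ ^ k := by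
          intro k
          rw [Finset.mul_sum, ← Finset.sum_sub_distrib]
          exact Finset.sum_congr rfl fun i _ => by ring
        intro k hk
        rw [expand]
        interval_cases k
        · simp only [pow_zero, mul_one]
          linear_combination h2 - p u ^ 2 * h0 - hs2
        · have : ∑ i ∈ B, c i * p i ^ 2 * (p i)⁻¹ ^ 1 = ∑ i ∈ B, c i * p i :=
            Finset.sum_congr rfl fun i _ => by
              have := hp0 i
              field_simp
          rw [this, hB1]
          simp only [pow_one, hB1', mul_zero, sub_zero]
        · have : ∑ i ∈ B, c i * p i ^ 2 * (p i)⁻¹ ^ 2 = ∑ i ∈ B, c i :=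
            Finset.sum_congr rfl fun i _ => by
              have := hp0 i
              field_simp
          rw [this]
          linear_combination h0 - p u ^ 2 * h2' + hs2') v hv
    rcases mul_eq_zero.1 key with h | h
    · exact hcB v hv h
    · exact hAB u hu v hv (sub_eq_zero.1 h).symm

theorem pow_half_order_eq_neg_one {K : Type*} [Field K] {q : ℕ} {ξ : K}
    (hξ : IsPrimitiveRoot ξ (2 * q + 2)) : ξ ^ (q + 1) = -1 := by
  have h1 : ξ ^ (q + 1) ≠ 1 := hξ.pow_ne_one_of_pos_of_lt (by omega) (by omega)
  have h2 : (ξ ^ (q + 1)) ^ 2 = 1 := by rw [← pow_mul, ← hξ.pow_eq_one]; ring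
  exact (mul_self_eq_one_iff.1 (by rw [← sq, h2])).resolve_left h1

/-- Every nonzero word with the prescribed zeros has weight at least six. -/
theorem six_le_card_support {F K : Type*} [Field F] [DecidableEq F] [Field K] [Algebra F K]
    {q : ℕ} (hodd : Odd q) {ξ : K} (hξ : IsPrimitiveRoot ξ (2 * q + 2))
    (c : Fin (2 * q + 2) → F) (hc0 : c ≠ 0)
    (h : ∀ α ∈ ({1, ξ, ξ⁻¹, ξ ^ q, (ξ ^ q)⁻¹, ξ ^ 2, ξ ^ (2 * q)} : Set K),
      ∑ i : Fin (2 * q + 2), algebraMap F K (c i) * α ^ (i : ℕ) = 0) :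
    6 ≤ (Finset.univ.filter fun i : Fin (2 * q + 2) => c i ≠ 0).card := by
  by_contra! hlt
  have hneg := pow_half_order_eq_neg_one hξ
  have hξ0 : ξ ≠ 0 := hξ.ne_zero (by omega)
  have htwo : (2 : K) ≠ 0 := by
    intro h2
    refine hξ.pow_ne_one_of_pos_of_lt (l := q + 1) (by omega) (by omega) ?_
    rw [hneg]
    linear_combination -h2
  set S := Finset.univ.filter fun i : Fin (2 * q + 2) => c i ≠ 0 with hS
  set p : Fin (2 * q + 2) → K := fun i => ξ ^ (i : ℕ) with hp
  set d : Fin (2 * q + 2) → K := fun i => algebraMap F K (c i) with hd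
  set A := S.filter fun i : Fin (2 * q + 2) => Even (i : ℕ)
  set B := S.filter fun i : Fin (2 * q + 2) => ¬ Even (i : ℕ)
  have hsum : ∀ g : Fin (2 * q + 2) → K,
      ∑ i ∈ A, d i * g i + ∑ i ∈ B, d i * g i = ∑ i, d i * g i := by
    intro g
    rw [Finset.sum_filter_add_sum_filter_not, hS, Finset.sum_filter]
    refine Finset.sum_congr rfl fun i _ => ?_
    by_cases hi : c i = 0 <;> simp [hi, hd]
  have hsplit : ∀ g g' : Fin (2 * q + 2) → K, (∑ i, d i * g i = 0) → (∑ i, d i * g' i = 0) →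
      (∀ i, g' i = (-1) ^ (i : ℕ) * g i) →
      ∑ i ∈ A, d i * g i = 0 ∧ ∑ i ∈ B, d i * g i = 0 := by
    intro g g' hg hg' hgg
    rw [← hsum] at hg hg'
    have e1 : ∑ i ∈ A, d i * g' i = ∑ i ∈ A, d i * g i :=
      Finset.sum_congr rfl fun i hi => by
        rw [hgg, (Finset.mem_filter.1 hi).2.neg_one_pow, one_mul]
    have e2 : ∑ i ∈ B, d i * g' i = -∑ i ∈ B, d i * g i := by
      rw [← Finset.sum_neg_distrib]
      exact Finset.sum_congr rfl fun i hi => by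
        rw [hgg, (Nat.not_even_iff_odd.1 (Finset.mem_filter.1 hi).2).neg_one_pow]; ring
    rw [e1, e2] at hg'
    constructor
    · refine (mul_eq_zero.1 ?_).resolve_left htwo
      linear_combination hg + hg'
    · refine (mul_eq_zero.1 ?_).resolve_left htwo
      linear_combination hg - hg'
  have hq2 : ξ ^ q = -ξ⁻¹ := by
    field_simp
    rw [← hneg, pow_succ]
  have hq1 : (ξ ^ q)⁻¹ = -ξ := by
    rw [hq2, inv_neg, inv_inv]
  have hq3 : ξ ^ (2 * q) = ξ⁻¹ ^ 2 := by
    rw [mul_comm, pow_mul, hq2]; ring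
  obtain ⟨hA1, hB1⟩ := hsplit p (fun i => ((ξ ^ q)⁻¹) ^ (i : ℕ)) (h _ (by simp)) (h _ (by simp))
    (fun i => by rw [hq1, neg_pow])
  obtain ⟨hA1', hB1'⟩ := hsplit (fun i => (p i)⁻¹) (fun i => (ξ ^ q) ^ (i : ℕ))
    (by simpa only [hp, inv_pow] using h ξ⁻¹ (by simp)) (h _ (by simp))
    (fun i => by rw [hq2, neg_pow, hp, inv_pow])
  have h0 := (hsum fun i => 1 ^ (i : ℕ)).trans (h 1 (by simp))
  have h2 := (hsum fun i => (ξ ^ 2) ^ (i : ℕ)).trans (h _ (by simp))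
  have h2' := (hsum fun i => (ξ ^ (2 * q)) ^ (i : ℕ)).trans (h _ (by simp))
  simp only [one_pow, mul_one] at h0
  simp only [pow_right_comm ξ 2] at h2
  simp only [hq3, pow_right_comm ξ⁻¹ 2] at h2'
  simp only [inv_pow ξ (Fin.val _)] at h2'
  have hpinj : Function.Injective p := fun i j hij => Fin.ext (hξ.pow_inj i.2 j.2 hij)
  have hp0 : ∀ i, p i ≠ 0 := fun i => pow_ne_zero _ hξ0
  have hdne : ∀ i ∈ S, d i ≠ 0 := fun i hi => by
    simpa [hd] using (Finset.mem_filter.1 hi).2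
  have hpar : ∀ a ∈ A, ∀ b ∈ B, p a ^ 2 ≠ p b ^ 2 := by
    intro a ha b hb hab
    have hae := (Finset.mem_filter.1 ha).2
    have hbo := (Finset.mem_filter.1 hb).2
    rcases sq_eq_sq_iff_eq_or_eq_neg.1 hab with e | e
    · exact hbo (hpinj e ▸ hae)
    · have e' : ξ ^ (a : ℕ) = ξ ^ ((b : ℕ) + (q + 1)) := by
        rw [pow_add, hneg]
        simpa [hp] using e
      rw [(isOfFinOrder_iff_pow_eq_one.2 ⟨2 * q + 2, by omega, hξ.pow_eq_one⟩).pow_eq_pow_iff_modEq,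
          ← hξ.eq_orderOf] at e'
      have hmod : (a : ℕ) % 2 = ((b : ℕ) + (q + 1)) % 2 := e'.of_dvd ⟨q + 1, by ring⟩
      rw [Nat.even_iff] at hae hbo
      rw [Nat.odd_iff] at hodd
      omega
  have hcard : A.card + B.card = S.card := Finset.card_filter_add_card_filter_not _
  have hAS : ∀ i ∈ A, d i ≠ 0 := fun i hi => hdne i (Finset.mem_filter.1 hi).1
  have hBS : ∀ i ∈ B, d i ≠ 0 := fun i hi => hdne i (Finset.mem_filter.1 hi).1
  have hAB0 : A = ∅ ∧ B = ∅ := by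
    rcases le_total A.card B.card with hle | hle
    · exact eq_empty_of_card_add_card_le_five A B p hpinj hp0 hpar d hAS hBS hA1 hA1' hB1 hB1'
        h0 h2 h2' (by omega) hle
    · exact (eq_empty_of_card_add_card_le_five B A p hpinj hp0
        (fun b hb a ha => (hpar a ha b hb).symm) d hBS hAS hB1 hB1' hA1 hA1'
        (by rw [add_comm]; exact h0) (by rw [add_comm]; exact h2) (by rw [add_comm]; exact h2')
        (by omega) hle).symm
  have hS0 : S = ∅ := Finset.card_eq_zero.1 (by rw [← hcard, hAB0.1, hAB0.2]; rfl)
  refine hc0 (funext fun i => ?_)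
  by_contra hi
  have : i ∈ S := by simpa [hS] using hi
  simp [hS0] at this

/-- The even positions carry a nonzero word with the prescribed zeros and weight at most six. -/
theorem exists_card_support_le_six {F K : Type*} [Field F] [Fintype F] [DecidableEq F] [Field K]
    [Fintype K] [Algebra F K] {q : ℕ} (hF : Fintype.card F = q) (hK : Fintype.card K = q ^ 2)
    (hq : 5 ≤ q) {ξ : K} (hξ : IsPrimitiveRoot ξ (2 * q + 2)) :
    ∃ c : Fin (2 * q + 2) → F, c ≠ 0 ∧
      (∀ α ∈ ({1, ξ, ξ⁻¹, ξ ^ q, (ξ ^ q)⁻¹, ξ ^ 2, ξ ^ (2 * q)} : Set K),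
        ∑ i : Fin (2 * q + 2), algebraMap F K (c i) * α ^ (i : ℕ) = 0) ∧
      (Finset.univ.filter fun i : Fin (2 * q + 2) => c i ≠ 0).card ≤ 6 := by
  have hrank : Module.finrank F K = 2 := by
    have h := Module.card_eq_pow_finrank (K := F) (V := K)
    rw [hF, hK] at h
    exact (Nat.pow_right_injective (by omega : 2 ≤ q) h).symm
  let L : (Fin 6 → F) →ₗ[F] F × K × K :=
    (Fintype.linearCombination F fun _ => (1 : F)).prod
      ((Fintype.linearCombination F fun j : Fin 6 => ξ ^ (2 * (j : ℕ))).prod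
        (Fintype.linearCombination F fun j : Fin 6 => (ξ ^ 2) ^ (2 * (j : ℕ))))
  have hker : LinearMap.ker L ≠ ⊥ := LinearMap.ker_ne_bot_of_finrank_lt (by simp [hrank])
  obtain ⟨e, he, he0⟩ := Submodule.exists_mem_ne_zero_of_ne_bot hker
  have heL : L e = 0 := he
  simp only [L, LinearMap.prod_apply, Function.prod_apply, Prod.mk_eq_zero,
    Fintype.linearCombination_apply, smul_eq_mul, mul_one] at heL
  obtain ⟨e1, e2, e3⟩ := heL
  let σ : Fin 6 ↪ Fin (2 * q + 2) :=
    ⟨fun j => ⟨2 * (j : ℕ), by omega⟩, fun i j hij => by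
      simp only [Fin.mk.injEq] at hij
      omega⟩
  let c : Fin (2 * q + 2) → F := Function.extend σ e 0
  have hcσ : ∀ j, c (σ j) = e j := fun j => σ.injective.extend_apply _ _ _
  have hsupp : ∀ i, i ∉ Finset.univ.map σ → c i = 0 := fun i hi =>
    Function.extend_apply' _ _ _ fun ⟨j, hj⟩ => hi (by simp [← hj])
  have hsum : ∀ α : K, ∑ i : Fin (2 * q + 2), algebraMap F K (c i) * α ^ (i : ℕ) =
      ∑ j : Fin 6, algebraMap F K (e j) * α ^ (2 * (j : ℕ)) := by
    intro α
    rw [← Finset.sum_subset (Finset.subset_univ (Finset.univ.map σ))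
      fun i _ hi => by rw [hsupp i hi, map_zero, zero_mul], Finset.sum_map]
    simp only [hcσ]
    rfl
  have hfrob : ∀ α : K, ∑ j : Fin 6, algebraMap F K (e j) * α ^ (2 * (j : ℕ)) = 0 →
      ∑ j : Fin 6, algebraMap F K (e j) * (α ^ q) ^ (2 * (j : ℕ)) = 0 := by
    intro α hα
    have := congrArg (FiniteField.frobeniusAlgHom F K) hα
    rw [map_sum, map_zero] at this
    rw [← this]
    refine Finset.sum_congr rfl fun j _ => ?_
    rw [map_mul, AlgHom.commutes, FiniteField.coe_frobeniusAlgHom, hF, pow_right_comm]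
  have hinv : ∀ j : ℕ, ξ⁻¹ ^ (2 * j) = (ξ ^ q) ^ (2 * j) := by
    intro j
    rw [inv_pow]
    refine inv_eq_of_mul_eq_one_left ?_
    rw [← mul_pow, ← pow_succ, ← pow_mul,
      show (q + 1) * (2 * j) = (2 * q + 2) * j by ring, pow_mul, hξ.pow_eq_one, one_pow]
  have hinv' : ∀ j : ℕ, (ξ ^ q)⁻¹ ^ (2 * j) = ξ ^ (2 * j) := by
    intro j
    rw [inv_pow, ← hinv, inv_pow, inv_inv]
  have z1 : ∑ j : Fin 6, algebraMap F K (e j) * ξ ^ (2 * (j : ℕ)) = 0 := by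
    simpa only [Algebra.smul_def] using e2
  have z2 : ∑ j : Fin 6, algebraMap F K (e j) * (ξ ^ 2) ^ (2 * (j : ℕ)) = 0 := by
    simpa only [Algebra.smul_def] using e3
  refine ⟨c, ?_, ?_, ?_⟩
  · intro hc
    exact he0 (funext fun j => by rw [← hcσ, hc]; rfl)
  · intro α hα
    rw [hsum]
    simp only [Set.mem_insert_iff, Set.mem_singleton_iff] at hα
    rcases hα with rfl | rfl | rfl | rfl | rfl | rfl | rfl
    · simp only [one_pow, mul_one, ← map_sum, e1, map_zero]
    · exact z1
    · simp only [hinv]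
      exact hfrob _ z1
    · exact hfrob _ z1
    · simp only [hinv']
      exact z1
    · exact z2
    · rw [pow_mul]
      exact hfrob _ z2
  · calc _ ≤ (Finset.univ.map σ).card := Finset.card_le_card fun i hi => by
          by_contra hn
          exact (Finset.mem_filter.1 hi).2 (hsupp i hn)
      _ = 6 := by simp

/-- For an odd prime power `q` and `n = 2q+2`, the cyclic code
`C = {c ∈ F_q^n : c(α) = 0 for all α ∈ {1, ξ, ξ⁻¹, ξ^q, ξ^{-q}, ξ^2, ξ^{2q}}}` (with `ξ` a
primitive `n`-th root of unity in `F_{q^2}`) has minimum Hamming distance `8` if `q = 3`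
and `6` if `q ≥ 5`. -/
theorem stmt_9 (q : ℕ) (hq : IsPrimePow q) (hodd : Odd q)
    (F F2 : Type) [Field F] [Fintype F] [DecidableEq F]
    [Field F2] [Fintype F2] [Algebra F F2]
    (hF : Fintype.card F = q) (hF2 : Fintype.card F2 = q ^ 2)
    (ξ : F2) (hξ : IsPrimitiveRoot ξ (2 * q + 2))
    (C : Set (Fin (2 * q + 2) → F))
    (hC : C = {c | ∀ α ∈ ({1, ξ, ξ⁻¹, ξ ^ q, (ξ ^ q)⁻¹, ξ ^ 2, ξ ^ (2 * q)} : Set F2),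
      ∑ i : Fin (2 * q + 2), algebraMap F F2 (c i) * α ^ (i : ℕ) = 0}) :
    (q = 3 → IsLeast {w : ℕ | ∃ c ∈ C, c ≠ 0 ∧
        (Finset.univ.filter fun i : Fin (2 * q + 2) => c i ≠ 0).card = w} 8)
    ∧ (5 ≤ q → IsLeast {w : ℕ | ∃ c ∈ C, c ≠ 0 ∧
        (Finset.univ.filter fun i : Fin (2 * q + 2) => c i ≠ 0).card = w} 6) := by
  subst hC
  refine ⟨?_, fun hq5 => ⟨?_, ?_⟩⟩
  · rintro rfl
    have h8 : ξ ^ 8 = 1 := hξ.pow_eq_one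
    have hξ0 : ξ ≠ 0 := hξ.ne_zero (by omega)
    refine ⟨⟨fun i => (-1) ^ (i : ℕ), ?_, ?_, ?_⟩, ?_⟩
    · intro α hα
      have hneg : ξ ^ 4 = -1 := pow_half_order_eq_neg_one hξ
      have hα8 : α ^ 8 = 1 ∧ α ≠ ξ ^ 4 := by
        obtain ⟨j, hj8, hj4, rfl⟩ : ∃ j < 8, j ≠ 4 ∧ α = ξ ^ j := by
          simp only [Set.mem_insert_iff, Set.mem_singleton_iff] at hα
          rcases hα with rfl | rfl | rfl | rfl | rfl | rfl | rfl
          · exact ⟨0, by omega, by omega, by simp⟩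
          · exact ⟨1, by omega, by omega, by simp⟩
          · exact ⟨7, by omega, by omega, inv_eq_of_mul_eq_one_left (by rw [← pow_succ, h8])⟩
          · exact ⟨3, by omega, by omega, rfl⟩
          · exact ⟨5, by omega, by omega, inv_eq_of_mul_eq_one_left (by rw [← pow_add, h8])⟩
          · exact ⟨2, by omega, by omega, rfl⟩
          · exact ⟨6, by omega, by omega, rfl⟩
        refine ⟨by rw [pow_right_comm, h8, one_pow], fun h => hj4 ?_⟩
        exact hξ.pow_inj hj8 (by omega) h
      have hne : -α - 1 ≠ 0 := by
        intro h
        exact hα8.2 (by rw [hneg]; linear_combination -h)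
      simp only [map_pow, map_neg, map_one, ← mul_pow, neg_one_mul]
      rw [Fin.sum_univ_eq_sum_range fun i => (-α) ^ i]
      refine (mul_eq_zero.1 ?_).resolve_right hne
      rw [geom_sum_mul]
      linear_combination hα8.1
    · intro h
      simpa using congrFun h 0
    · simp
    · rintro w ⟨c, hc, hc0, rfl⟩
      by_contra! hlt
      have hnode : ∀ k < 7, ξ ^ k * (ξ ^ 3)⁻¹ ∈
          ({1, ξ, ξ⁻¹, ξ ^ 3, (ξ ^ 3)⁻¹, ξ ^ 2, ξ ^ (2 * 3)} : Set F2) := by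
        intro k hk
        simp only [Set.mem_insert_iff, Set.mem_singleton_iff]
        interval_cases k
        · simp
        · have : ξ ^ 1 * (ξ ^ 3)⁻¹ = ξ ^ (2 * 3) := by
            field_simp
            linear_combination -h8
          rw [this]
          simp
        · have : ξ ^ 2 * (ξ ^ 3)⁻¹ = ξ⁻¹ := by field_simp
          simp [this]
        · have : ξ ^ 3 * (ξ ^ 3)⁻¹ = 1 := by field_simp
          simp [this]
        · have : ξ ^ 4 * (ξ ^ 3)⁻¹ = ξ := by field_simp
          simp [this]
        · have : ξ ^ 5 * (ξ ^ 3)⁻¹ = ξ ^ 2 := by field_simp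
          simp [this]
        · have : ξ ^ 6 * (ξ ^ 3)⁻¹ = ξ ^ 3 := by field_simp
          simp [this]
      have key := eq_zero_of_sum_mul_pow_eq_zero
        (Finset.univ.filter fun i : Fin (2 * 3 + 2) => c i ≠ 0) (fun i => ξ ^ (i : ℕ))
        (fun i _ j _ hij => Fin.ext (hξ.pow_inj i.2 j.2 hij))
        (fun i => algebraMap F F2 (c i) * ((ξ ^ 3)⁻¹) ^ (i : ℕ)) 7 (by omega)
        (by
          intro k hk
          rw [← hc _ (hnode k hk), Finset.sum_filter]
          refine Finset.sum_congr rfl fun i _ => ?_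
          by_cases hi : c i = 0
          · simp [hi]
          · rw [if_pos hi, mul_pow, pow_right_comm ξ k]
            ring)
      refine hc0 (funext fun i => ?_)
      by_contra hi
      have := key i (by simpa using hi)
      simp [hξ0] at this
      exact hi this
  · obtain ⟨c, hc0, hc, hle⟩ := exists_card_support_le_six hF hF2 hq5 hξ
    exact ⟨c, hc, hc0, le_antisymm hle (six_le_card_support hodd hξ c hc0 hc)⟩
  · rintro w ⟨c, hc, hc0, rfl⟩
    exact six_le_card_support hodd hξ c hc0 hc
end

section
/- Let q > 3 be an odd prime power, ξ ∈ F_{q^2} a primitive (2q+2)-th root of unity, and β = ξ^2 + ξ^{-2} (so β ∈ F_q). Define b_k ∈ F_{q^2} for 0 ≤ k ≤ q-3 by b_k = (ξ^{k+4} - ξ^{-k})/(ξ^4 - 1) if k is even and b_k = 0 if k is odd, and set b(x) = b_0 + b_1 x + ... + b_{q-3} x^{q-3}. Then every b_k lies in F_q, the identity x^{q+1} + 1 = (x^4 - βx^2 + 1)·b(x) holds in F_{q^2}[x], and the Euclidean dual C_2^⊥ of the negacyclic code C_2 of length q+1 over F_q with generator polynomial x^4 - βx^2 + 1 satisfies C_2^⊥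 = {w ∈ F_q^{q+1} : b(x) divides w(x)}; that is, b(x) is the generator polynomial of C_2^⊥. -/
open Polynomial in
theorem quartic_mul_sum_range {R : Type*} [CommRing R] (β : R) (b : ℕ → R)
    (h0 : b 0 = 1) (h2 : b 2 = β) (hrec : ∀ k, b (2 * k + 4) = β * b (2 * k + 2) - b (2 * k))
    (hoddk : ∀ k, b (2 * k + 1) = 0) (m : ℕ) :
    (X ^ 4 - C β * X ^ 2 + 1 : R[X]) * ∑ k ∈ Finset.range (2 * m + 1), C (b k) * X ^ k =
      1 - C (b (2 * m + 2)) * X ^ (2 * m + 2) + C (b (2 * m)) * X ^ (2 * m + 4) := by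
  induction m with
  | zero => simp [h0, h2]; ring
  | succ m ih =>
    rw [show 2 * (m + 1) + 1 = 2 * m + 1 + 1 + 1 by ring, Finset.sum_range_succ,
      Finset.sum_range_succ, mul_add, mul_add, ih, hoddk,
      show 2 * (m + 1) + 2 = 2 * m + 4 by ring, hrec, show 2 * m + 1 + 1 = 2 * m + 2 by ring,
      show 2 * (m + 1) = 2 * m + 2 by ring]
    simp only [C_sub, C_mul, C_0]
    ring

open Polynomial in
theorem coeff_sum_fin {R : Type*} [Semiring R] {n : ℕ} (w : Fin n → R) (i : Fin n) :
    (∑ j : Fin n, C (w j) * X ^ (j : ℕ)).coeff i = w i := by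
  simp [coeff_X_pow, Fin.val_inj]

/-- An element of an extension of a finite field `F` fixed by the `|F|`-power map lies in `F`. -/
theorem mem_range_algebraMap_of_pow_card_eq {F K : Type*} [Field F] [Fintype F] [Field K]
    [Algebra F K] {x : K} (hx : x ^ Fintype.card F = x) : x ∈ Set.range (algebraMap F K) := by
  have hcard : (Polynomial.X ^ Fintype.card F - Polynomial.X : Polynomial F).roots.card =
      (Polynomial.X ^ Fintype.card F - Polynomial.X : Polynomial F).natDegree := by
    rw [FiniteField.roots_X_pow_card_sub_X,
      FiniteField.X_pow_card_sub_X_natDegree_eq F Fintype.one_lt_card]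
    simp
  have hroots := Polynomial.roots_map_of_injective_of_card_eq_natDegree
    (algebraMap F K).injective hcard
  have hmem : x ∈ ((Polynomial.X ^ Fintype.card F - Polynomial.X : Polynomial F).map
      (algebraMap F K)).roots := by
    rw [Polynomial.mem_roots']
    refine ⟨?_, by simp [hx]⟩
    rw [Polynomial.map_ne_zero_iff (algebraMap F K).injective]
    exact FiniteField.X_pow_card_sub_X_ne_zero F Fintype.one_lt_card
  rw [← hroots, FiniteField.roots_X_pow_card_sub_X] at hmem
  simpa using hmem

open Polynomial in
/-- Pairing with a shift of the palindromic polynomial `x⁴ - βx² + 1` computes a coefficient of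
the product with it. -/
theorem sum_coeff_quartic_mul_X_pow {R : Type*} [CommRing R] (β : R) (W : R[X]) {j n : ℕ}
    (hj : j + 4 < n) :
    ∑ i ∈ Finset.range n, ((X ^ 4 - C β * X ^ 2 + 1 : R[X]) * X ^ j).coeff i * W.coeff i =
      ((X ^ 4 - C β * X ^ 2 + 1 : R[X]) * W).coeff (j + 4) := by
  have e : (X ^ 4 - C β * X ^ 2 + 1 : R[X]) * X ^ j = X ^ (j + 4) - C β * X ^ (j + 2) + X ^ j := by
    ring
  have e' : (X ^ 4 - C β * X ^ 2 + 1 : R[X]) * W = X ^ 4 * W - C β * (X ^ 2 * W) + W := by ring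
  have h2 : (X ^ 2 * W).coeff (j + 4) = W.coeff (j + 2) := coeff_X_pow_mul W 2 (j + 2)
  rw [e, e']
  simp [coeff_X_pow, coeff_X_pow_mul, h2, sub_mul, add_mul, Finset.sum_add_distrib, hj,
    show j + 2 < n by omega, show j < n by omega]
  ring

open Polynomial in
theorem natDegree_quartic {F : Type*} [Field F] (β : F) :
    (X ^ 4 - C β * X ^ 2 + 1 : F[X]).natDegree = 4 := by
  compute_degree!

open Polynomial in
/-- The coefficients of `g W` in degrees `4, …, m` vanish for `W` of degree at most `m` exactly
when the check polynomial of `g = x⁴ - βx² + 1` divides `W`. -/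
theorem check_dvd_iff_coeff_quartic_mul_eq_zero {F : Type*} [Field F] {β : F} {m : ℕ}
    {B W : F[X]} (hm : 3 ≤ m) (hB : (X ^ 4 - C β * X ^ 2 + 1) * B = X ^ (m + 1) + 1)
    (hW : W.natDegree ≤ m) :
    B ∣ W ↔ ∀ j, j + 4 ≤ m → ((X ^ 4 - C β * X ^ 2 + 1) * W).coeff (j + 4) = 0 := by
  have hg := natDegree_quartic β
  set g : F[X] := X ^ 4 - C β * X ^ 2 + 1
  have hg0 : g ≠ 0 := by rintro h; simp [h] at hg
  have hn : (X ^ (m + 1) + 1 : F[X]).natDegree = m + 1 := by compute_degree!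
  constructor
  · rintro ⟨s, rfl⟩ j hj
    rcases eq_or_ne s 0 with rfl | hs
    · simp
    have hB0 : B ≠ 0 := by rintro rfl; simp [← hB] at hn
    have hdeg : g.natDegree + B.natDegree = m + 1 := by rw [← natDegree_mul hg0 hB0, hB, hn]
    rw [natDegree_mul hB0 hs] at hW
    rw [← mul_assoc, hB, add_mul, one_mul, coeff_add,
      coeff_eq_zero_of_natDegree_lt (show s.natDegree < j + 4 by omega), coeff_X_pow_mul',
      if_neg (by omega), add_zero]
  · intro h
    set lo : F[X] := ∑ i ∈ Finset.range 4, C ((g * W).coeff i) * X ^ i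
    have hlo (i : ℕ) : lo.coeff i = if i < 4 then (g * W).coeff i else 0 := by
      simp [lo, finsetSum_coeff, coeff_X_pow]
    obtain ⟨hi, hhi⟩ : X ^ (m + 1) ∣ g * W - lo := by
      rw [X_pow_dvd_iff]
      intro d hd
      rw [coeff_sub, hlo]
      split_ifs with h4
      · exact sub_self _
      · obtain ⟨j, rfl⟩ := Nat.exists_eq_add_of_le' (not_lt.mp h4)
        rw [h j (by omega), sub_zero]
    have hhi4 (i : ℕ) (h4 : 4 ≤ i) : hi.coeff i = 0 := by
      have hdeg : (g * W).natDegree < i + (m + 1) := natDegree_mul_le.trans_lt (by omega)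
      rw [← coeff_X_pow_mul hi (m + 1) i, ← hhi, coeff_sub, hlo, if_neg (by omega),
        coeff_eq_zero_of_natDegree_lt hdeg, sub_zero]
    have hfactor : lo - hi = g * (W - B * hi) := by
      linear_combination -hhi + hi * hB
    have hdeg : (lo - hi).degree < g.degree := by
      rw [degree_eq_natDegree hg0, hg, degree_lt_iff_coeff_zero]
      intro i h4
      rw [coeff_sub, hlo, if_neg (by omega), hhi4 i h4, sub_zero]
    have hzero : lo - hi = 0 := eq_zero_of_dvd_of_degree_lt ⟨_, hfactor⟩ hdeg
    rw [hfactor, mul_eq_zero, or_iff_right hg0, sub_eq_zero] at hzero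
    exact ⟨hi, hzero⟩

open Polynomial in
/-- The Euclidean dual of the code of length `m + 1` generated by `g = x⁴ - βx² + 1` is the code
generated by the check polynomial of `g`. -/
theorem forall_quartic_dvd_sum_eq_zero_iff {F : Type*} [Field F] {β : F} {m : ℕ} {B : F[X]}
    (hm : 3 ≤ m) (hB : (X ^ 4 - C β * X ^ 2 + 1) * B = X ^ (m + 1) + 1)
    (w : Fin (m + 1) → F) :
    (∀ v : Fin (m + 1) → F,
      (X ^ 4 - C β * X ^ 2 + 1 : F[X]) ∣ ∑ i : Fin (m + 1), C (v i) * X ^ (i : ℕ) →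
        ∑ i : Fin (m + 1), v i * w i = 0) ↔
      B ∣ ∑ i : Fin (m + 1), C (w i) * X ^ (i : ℕ) := by
  have hnat (v : Fin (m + 1) → F) : (∑ i : Fin (m + 1), C (v i) * X ^ (i : ℕ)).natDegree ≤ m :=
    natDegree_le_iff_coeff_eq_zero.mpr fun _ hN =>
      coeff_eq_zero_of_degree_lt ((degree_sum_fin_lt v).trans_le (by exact_mod_cast hN))
  have hg := natDegree_quartic β
  rw [check_dvd_iff_coeff_quartic_mul_eq_zero hm hB (hnat w)]
  have hpair (p : F[X]) : ∑ i : Fin (m + 1), p.coeff i * w i =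
      ∑ i ∈ Finset.range (m + 1),
        p.coeff i * (∑ j : Fin (m + 1), C (w j) * X ^ (j : ℕ)).coeff i := by
    simp_rw [Finset.sum_range, coeff_sum_fin]
  constructor
  · intro h j hj
    rw [← sum_coeff_quartic_mul_X_pow β _ (show j + 4 < m + 1 by omega), ← hpair]
    refine h _ ?_
    have hdeg : ((X ^ 4 - C β * X ^ 2 + 1 : F[X]) * X ^ j).natDegree < m + 1 :=
      natDegree_mul_le.trans_lt (by rw [hg, natDegree_X_pow]; omega)
    have hsum := as_sum_range_C_mul_X_pow' _ hdeg
    rw [Finset.sum_range] at hsum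
    exact hsum ▸ dvd_mul_right _ _
  · rintro h v ⟨t, ht⟩
    have hv : ∑ i : Fin (m + 1), v i * w i =
        ∑ i : Fin (m + 1), ((X ^ 4 - C β * X ^ 2 + 1 : F[X]) * t).coeff i * w i := by
      simp_rw [← ht, coeff_sum_fin]
    have ht0 (j : ℕ) (hj : j ∈ t.support) : j + 4 ≤ m := by
      have hne : t ≠ 0 := by rintro rfl; simp at hj
      have := hnat v
      rw [ht, natDegree_mul (by intro h0; simp [h0] at hg) hne, hg] at this
      have := le_natDegree_of_mem_supp j hj
      omega
    rw [hv]
    conv_lhs => rw [t.as_sum_support_C_mul_X_pow]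
    simp_rw [Finset.mul_sum, finsetSum_coeff, Finset.sum_mul]
    rw [Finset.sum_comm]
    refine Finset.sum_eq_zero fun j hj => ?_
    simp_rw [mul_left_comm _ (C _), coeff_C_mul, mul_assoc]
    rw [← Finset.mul_sum, hpair, sum_coeff_quartic_mul_X_pow β _ (by have := ht0 j hj; omega),
      h j (ht0 j hj), mul_zero]


/-- Let `q > 3` be an odd prime power, `ξ ∈ F_{q^2}` a primitive `(2q+2)`-th
root of unity, `β = ξ^2 + ξ^{-2}`. Define `b_k = (ξ^{k+4} - ξ^{-k})/(ξ^4 - 1)` for even `k`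
and `b_k = 0` for odd `k` (`0 ≤ k ≤ q-3`), and `b(x) = Σ_{k=0}^{q-3} b_k x^k`. Then `β` and
all `b_k` lie in `F_q`, `x^{q+1} + 1 = (x^4 - βx^2 + 1)·b(x)` in `F_{q^2}[x]`, and the
Euclidean dual of the negacyclic code of length `q+1` over `F_q` with generator polynomial
`x^4 - βx^2 + 1` is the code with generator polynomial `b(x)`, i.e. it consists exactly of
the words `w` with `b(x) ∣ w(x)`. -/
theorem stmt_10 (q : ℕ) (hq : IsPrimePow q) (hodd : Odd q) (hq3 : 3 < q)
    (F F2 : Type) [Field F] [Fintype F]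
    [Field F2] [Fintype F2] [Algebra F F2]
    (hF : Fintype.card F = q) (hF2 : Fintype.card F2 = q ^ 2)
    (ξ : F2) (hξ : IsPrimitiveRoot ξ (2 * q + 2))
    (b : ℕ → F2)
    (hb : ∀ k, b k = if k % 2 = 0 then (ξ ^ (k + 4) - ξ⁻¹ ^ k) / (ξ ^ 4 - 1) else 0) :
    ∃ (β : F) (b' : ℕ → F),
      algebraMap F F2 β = ξ ^ 2 + ξ⁻¹ ^ 2
      ∧ (∀ k : ℕ, k ≤ q - 3 → algebraMap F F2 (b' k) = b k)
      ∧ (Polynomial.X ^ (q + 1) + 1 : Polynomial F2) =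
          (Polynomial.X ^ 4 - Polynomial.C (ξ ^ 2 + ξ⁻¹ ^ 2) * Polynomial.X ^ 2 + 1) *
            (∑ k ∈ Finset.range (q - 2), Polynomial.C (b k) * Polynomial.X ^ k)
      ∧ {w : Fin (q + 1) → F |
            ∀ v : Fin (q + 1) → F,
              ((Polynomial.X ^ 4 - Polynomial.C β * Polynomial.X ^ 2 + 1 : Polynomial F) ∣
                  ∑ i : Fin (q + 1), Polynomial.C (v i) * Polynomial.X ^ (i : ℕ)) →
                ∑ i : Fin (q + 1), v i * w i = 0} =
          {w : Fin (q + 1) → F |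
            (∑ k ∈ Finset.range (q - 2), Polynomial.C (b' k) * Polynomial.X ^ k : Polynomial F) ∣
              ∑ i : Fin (q + 1), Polynomial.C (w i) * Polynomial.X ^ (i : ℕ)} := by
  obtain ⟨r, rfl⟩ : ∃ r, q = 2 * r + 5 := by
    obtain ⟨s, rfl⟩ := hodd
    exact ⟨s - 2, by omega⟩
  have hξ0 : ξ ≠ 0 := hξ.ne_zero (by omega)
  have hξ4 : ξ ^ 4 - 1 ≠ 0 := sub_ne_zero.mpr (hξ.pow_ne_one_of_pos_of_lt (by omega) (by omega))
  have hξneg : ξ ^ (2 * r + 6) = -1 := by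
    have hsq : ξ ^ (2 * r + 6) * ξ ^ (2 * r + 6) = 1 := by
      rw [← pow_add, ← hξ.pow_eq_one]
      congr 1
      ring
    exact (mul_self_eq_one_iff.mp hsq).resolve_left
      (hξ.pow_ne_one_of_pos_of_lt (by omega) (by omega))
  have hξq : ξ ^ (2 * r + 5) = -ξ⁻¹ := by
    field_simp
    rw [← hξneg]
    ring
  have heven (k : ℕ) : b (2 * k) = (ξ ^ (2 * k + 4) - ξ⁻¹ ^ (2 * k)) / (ξ ^ 4 - 1) := by
    rw [hb, if_pos (by omega)]
  have hb_odd (k : ℕ) : b (2 * k + 1) = 0 := by rw [hb, if_neg (by omega)]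
  have h0 : b 0 = 1 := by simpa [div_self hξ4] using heven 0
  have h2 : b 2 = ξ ^ 2 + ξ⁻¹ ^ 2 := by
    rw [show b 2 = _ from heven 1]
    simp only [inv_pow]
    field_simp
    ring
  have hrec (k : ℕ) : b (2 * k + 4) = (ξ ^ 2 + ξ⁻¹ ^ 2) * b (2 * k + 2) - b (2 * k) := by
    rw [show 2 * k + 4 = 2 * (k + 2) by ring, show 2 * k + 2 = 2 * (k + 1) by ring,
      heven, heven, heven]
    simp only [inv_pow]
    field_simp
    ring
  have hlast : b (2 * (r + 1)) = 1 := by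
    rw [heven, div_eq_one_iff_eq hξ4, show 2 * (r + 1) + 4 = 2 * r + 6 by ring, hξneg, inv_pow]
    field_simp
    linear_combination -hξneg
  have hnext : b (2 * (r + 1) + 2) = 0 := by
    rw [show 2 * (r + 1) + 2 = 2 * (r + 2) by ring, heven, div_eq_zero_iff, inv_pow]
    left
    field_simp
    linear_combination (ξ ^ (2 * r + 6) - 1) * hξneg
  have hfactor := quartic_mul_sum_range (ξ ^ 2 + ξ⁻¹ ^ 2) b h0 h2 hrec hb_odd (r + 1)
  rw [hlast, hnext] at hfactor
  have hid : (Polynomial.X ^ (2 * r + 5 + 1) + 1 : Polynomial F2) =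
      (Polynomial.X ^ 4 - Polynomial.C (ξ ^ 2 + ξ⁻¹ ^ 2) * Polynomial.X ^ 2 + 1) *
        ∑ k ∈ Finset.range (2 * r + 5 - 2), Polynomial.C (b k) * Polynomial.X ^ k := by
    rw [show 2 * r + 5 - 2 = 2 * (r + 1) + 1 by omega, hfactor, Polynomial.C_0, Polynomial.C_1]
    ring
  obtain ⟨β, hβ⟩ : ξ ^ 2 + ξ⁻¹ ^ 2 ∈ Set.range (algebraMap F F2) := by
    apply mem_range_algebraMap_of_pow_card_eq
    have hadd : (ξ ^ 2 + ξ⁻¹ ^ 2) ^ Fintype.card F =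
        (ξ ^ 2) ^ Fintype.card F + (ξ⁻¹ ^ 2) ^ Fintype.card F :=
      map_add (FiniteField.frobeniusAlgHom F F2) _ _
    rw [hadd, hF, pow_right_comm, pow_right_comm ξ⁻¹, inv_pow, hξq]
    simp [add_comm]
  have hb_even_mem (k : ℕ) : b (2 * k) ∈ (algebraMap F F2).range ∧
      b (2 * k + 2) ∈ (algebraMap F F2).range := by
    induction k with
    | zero => exact ⟨h0 ▸ one_mem _, h2 ▸ ⟨β, hβ⟩⟩
    | succ k ih => exact ⟨ih.2, hrec k ▸ sub_mem (mul_mem ⟨β, hβ⟩ ih.2) ih.1⟩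
  have hb_mem (k : ℕ) : ∃ y, algebraMap F F2 y = b k := by
    obtain ⟨l, rfl | rfl⟩ := k.even_or_odd'
    · exact (hb_even_mem l).1
    · exact ⟨0, by rw [map_zero, hb_odd]⟩
  choose b' hb' using hb_mem
  refine ⟨β, b', hβ, fun k _ => hb' k, hid, ?_⟩
  ext w
  refine forall_quartic_dvd_sum_eq_zero_iff (by omega) ?_ w
  apply Polynomial.map_injective _ (algebraMap F F2).injective
  simpa [Polynomial.map_sum, hβ, hb'] using hid.symm
end

section
/- Let q be an odd prime power, n = 2q+2, ξ ∈ F_{q^2} a primitive n-th root of unity, and let C ⊆ F_q^n be the cyclic code C = {c ∈ F_q^n : c(α) = 0 for every α ∈ {1, ξ, ξ^{-1}, ξ^q, ξ^{-q}, ξ^2, ξ^{2q}}, evaluation in F_{q^2}}. Then for every integer ℓ with 6 ≤ ℓ ≤ n-2, there is no codeword c ∈ C whose support is exactly {0, 1, 2, 3, 4, ℓ}; equivalently, C contains no codeword of the form (⋆,⋆,⋆,⋆,⋆,0_r,⋆,0_{n-r-6}) with each ⋆ a nonzero element of F_q and 1 ≤ r ≤ n-7. -/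
/-- For an odd prime power `q` and `n = 2q+2`, the cyclic code
`C = {c ∈ F_q^n : c(α) = 0 for all α ∈ {1, ξ, ξ⁻¹, ξ^q, ξ^{-q}, ξ^2, ξ^{2q}}}` contains,
for every `6 ≤ ℓ ≤ n-2`, no codeword whose support is exactly `{0, 1, 2, 3, 4, ℓ}`. -/
theorem stmt_11 (q : ℕ) (hq : IsPrimePow q) (hodd : Odd q)
    (F F2 : Type) [Field F] [Fintype F]
    [Field F2] [Fintype F2] [Algebra F F2]
    (hF : Fintype.card F = q) (hF2 : Fintype.card F2 = q ^ 2)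
    (ξ : F2) (hξ : IsPrimitiveRoot ξ (2 * q + 2))
    (C : Set (Fin (2 * q + 2) → F))
    (hC : C = {c | ∀ α ∈ ({1, ξ, ξ⁻¹, ξ ^ q, (ξ ^ q)⁻¹, ξ ^ 2, ξ ^ (2 * q)} : Set F2),
      ∑ i : Fin (2 * q + 2), algebraMap F F2 (c i) * α ^ (i : ℕ) = 0}) :
    ∀ ℓ : ℕ, 6 ≤ ℓ → ℓ ≤ 2 * q + 2 - 2 →
      ¬ ∃ c ∈ C, ∀ i : Fin (2 * q + 2),
        c i ≠ 0 ↔ ((i : ℕ) = 0 ∨ (i : ℕ) = 1 ∨ (i : ℕ) = 2 ∨ (i : ℕ) = 3 ∨ (i : ℕ) = 4 ∨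
          (i : ℕ) = ℓ) := by
  intro ℓ h6 hℓ
  rintro ⟨c, hc, hsupp⟩
  have hq1 : 1 < q := hq.one_lt
  have hx0 : ξ ≠ 0 := hξ.ne_zero (by omega)
  have hneg : ξ ^ (q + 1) = -1 := by
    have h : (ξ ^ (q + 1)) ^ 2 = 1 := by
      rw [← pow_mul, show (q + 1) * 2 = 2 * q + 2 by ring, hξ.pow_eq_one]
    exact (mul_self_eq_one_iff.mp (sq (ξ ^ (q + 1)) ▸ h)).resolve_left
      (hξ.pow_ne_one_of_pos_of_lt (by omega) (by omega))
  have two_ne : (2 : F2) ≠ 0 := by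
    intro h2
    apply hξ.pow_ne_one_of_pos_of_lt (l := q + 1) (by omega) (by omega)
    linear_combination hneg - h2
  obtain ⟨y, hy⟩ : ∃ y, y = ξ⁻¹ := ⟨_, rfl⟩
  have hxy : ξ * y = 1 := by rw [hy, mul_inv_cancel₀ hx0]
  have hξq : ξ ^ q = -y := by
    have : ξ ^ q * ξ = -1 := by rw [← pow_succ, hneg]
    linear_combination y * this - ξ ^ q * hxy
  have hξqi : (ξ ^ q)⁻¹ = -ξ := by
    rw [hξq, hy, inv_neg, inv_inv]
  have hξ2q : ξ ^ (2 * q) = y ^ 2 := by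
    rw [mul_comm, pow_mul, hξq, neg_sq]
  rw [hC, hξq, hξ2q, ← hξq, hξqi, hξq, ← hy] at hc
  set A : ℕ → F2 := fun i => if h : i < 2 * q + 2 then algebraMap F F2 (c ⟨i, h⟩) else 0 with hA
  have A_ne (i : ℕ) (hi : i < 2 * q + 2)
      (h : i = 0 ∨ i = 1 ∨ i = 2 ∨ i = 3 ∨ i = 4 ∨ i = ℓ) : A i ≠ 0 := by
    simpa [hA, hi] using (hsupp ⟨i, hi⟩).mpr h
  have sum_eq (α : F2) : ∑ i : Fin (2 * q + 2), algebraMap F F2 (c i) * α ^ (i : ℕ) =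
      A 0 + A 1 * α + A 2 * α ^ 2 + A 3 * α ^ 3 + A 4 * α ^ 4 + A ℓ * α ^ ℓ := by
    have h1 : ∑ i : Fin (2 * q + 2), algebraMap F F2 (c i) * α ^ (i : ℕ) =
        ∑ i ∈ Finset.range (2 * q + 2), A i * α ^ i := by
      rw [Finset.sum_range]
      simp [hA]
    have h2 : ({0, 1, 2, 3, 4, ℓ} : Finset ℕ) ⊆ Finset.range (2 * q + 2) := by
      intro i hi
      simp only [Finset.mem_insert, Finset.mem_singleton] at hi
      rw [Finset.mem_range]
      omega
    rw [h1, ← Finset.sum_subset h2]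
    · have hs (k : ℕ) (hk : k ≤ 4) : k ≠ ℓ := by omega
      rw [Finset.sum_insert (by simp [hs]), Finset.sum_insert (by simp [hs]),
        Finset.sum_insert (by simp [hs]), Finset.sum_insert (by simp [hs]),
        Finset.sum_insert (by simp [hs]), Finset.sum_singleton]
      ring
    · intro i hi hi'
      simp only [Finset.mem_insert, Finset.mem_singleton] at hi'
      rw [Finset.mem_range] at hi
      have : c ⟨i, hi⟩ = 0 := by
        by_contra h
        exact hi' ((hsupp ⟨i, hi⟩).mp h)
      simp [hA, this]
  have key (α : F2) (hα : α ∈ ({1, ξ, y, -y, -ξ, ξ ^ 2, y ^ 2} : Set F2)) :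
      A 0 + A 1 * α + A 2 * α ^ 2 + A 3 * α ^ 3 + A 4 * α ^ 4 + A ℓ * α ^ ℓ = 0 := by
    rw [← sum_eq]
    exact hc α hα
  have e1 := key ξ (by simp)
  have e2 := key y (by simp)
  have e3 := key (-ξ) (by simp)
  have e4 := key (-y) (by simp)
  have e5 := key (ξ ^ 2) (by simp)
  have e6 := key (y ^ 2) (by simp)
  have hA3 := A_ne 3 (by omega) (by simp)
  have hAℓ := A_ne ℓ (by omega) (by simp)
  have hx4 : ξ ^ 4 - 1 ≠ 0 :=
    sub_ne_zero.mpr (hξ.pow_ne_one_of_pos_of_lt (by omega) (by obtain ⟨k, rfl⟩ := hodd; omega))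
  have hy0 : y ≠ 0 := right_ne_zero_of_mul_eq_one hxy
  generalize A 0 = a0 at *
  generalize A 1 = a1 at *
  generalize A 2 = a2 at *
  generalize A 3 = a3 at *
  generalize A 4 = a4 at *
  generalize A ℓ = b at *
  rcases Nat.even_or_odd' ℓ with ⟨m, rfl | rfl⟩
  · have h1 : a1 + a3 * ξ ^ 2 = 0 := by
      apply mul_left_cancel₀ (mul_ne_zero two_ne hx0)
      rw [(even_two_mul m).neg_pow] at e3
      linear_combination e1 - e3
    have h2 : a1 + a3 * y ^ 2 = 0 := by
      apply mul_left_cancel₀ (mul_ne_zero two_ne hy0)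
      rw [(even_two_mul m).neg_pow] at e4
      linear_combination e2 - e4
    apply mul_ne_zero hA3 hx4
    linear_combination ξ ^ 2 * (h1 - h2) + a3 * (ξ * y + 1) * hxy
  · obtain ⟨X, hX⟩ : ∃ X, X = ξ ^ m := ⟨_, rfl⟩
    obtain ⟨Y, hY⟩ : ∃ Y, Y = y ^ m := ⟨_, rfl⟩
    have hXY : X * Y = 1 := by rw [hX, hY, ← mul_pow, hxy, one_pow]
    have p1 : ξ ^ (2 * m + 1) = X ^ 2 * ξ := by rw [hX]; ring
    have p2 : y ^ (2 * m + 1) = Y ^ 2 * y := by rw [hY]; ring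
    have p5 : (ξ ^ 2) ^ (2 * m + 1) = X ^ 4 * ξ ^ 2 := by rw [hX]; ring
    have p6 : (y ^ 2) ^ (2 * m + 1) = Y ^ 4 * y ^ 2 := by rw [hY]; ring
    rw [(odd_two_mul_add_one m).neg_pow, p1] at e3
    rw [(odd_two_mul_add_one m).neg_pow, p2] at e4
    rw [p1] at e1
    rw [p2] at e2
    rw [p5] at e5
    rw [p6] at e6
    have o1 : a1 + a3 * ξ ^ 2 + b * X ^ 2 = 0 := by
      apply mul_left_cancel₀ (mul_ne_zero two_ne hx0)
      linear_combination e1 - e3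
    have o2 : a1 + a3 * y ^ 2 + b * Y ^ 2 = 0 := by
      apply mul_left_cancel₀ (mul_ne_zero two_ne hy0)
      linear_combination e2 - e4
    have v1 : a0 + a2 * ξ ^ 2 + a4 * ξ ^ 4 = 0 := by
      apply mul_left_cancel₀ two_ne
      linear_combination e1 + e3
    have v2 : a0 + a2 * y ^ 2 + a4 * y ^ 4 = 0 := by
      apply mul_left_cancel₀ two_ne
      linear_combination e2 + e4
    have hxy2 : ξ ^ 2 * y ^ 2 = 1 := by rw [← mul_pow, hxy, one_pow]
    have hxy4 : ξ ^ 4 * y ^ 4 = 1 := by rw [← mul_pow, hxy, one_pow]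
    have a04 : a0 = a4 := by
      apply mul_right_cancel₀ hx4
      linear_combination ξ ^ 4 * v2 - v1 - a2 * ξ ^ 2 * hxy2 - a4 * hxy4
    subst a04
    obtain ⟨Z, hZ⟩ : ∃ Z, Z = X ^ 2 * y := ⟨_, rfl⟩
    obtain ⟨W, hW⟩ : ∃ W, W = Y ^ 2 * ξ := ⟨_, rfl⟩
    have hXZ : X ^ 2 = Z * ξ := by rw [hZ]; linear_combination -X ^ 2 * hxy
    have hYW : Y ^ 2 = W * y := by rw [hW]; linear_combination -Y ^ 2 * hxy
    have hX4 : X ^ 4 = Z ^ 2 * ξ ^ 2 := by linear_combination (X ^ 2 + Z * ξ) * hXZ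
    have hY4 : Y ^ 4 = W ^ 2 * y ^ 2 := by linear_combination (Y ^ 2 + W * y) * hYW
    have hZW : Z * W = 1 := by
      have : X ^ 2 * Y ^ 2 = 1 := by rw [← mul_pow, hXY, one_pow]
      rw [hZ, hW]
      linear_combination X ^ 2 * Y ^ 2 * hxy + this
    rw [hXZ] at o1
    rw [hYW] at o2
    rw [hX4] at e5
    rw [hY4] at e6
    have f1 : a3 * (ξ ^ 2 - y ^ 2) = -b * (Z * ξ - W * y) := by linear_combination o1 - o2
    have f2 : a1 * (y ^ 2 - ξ ^ 2) = -b * (Z * y - W * ξ) := by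
      linear_combination y ^ 2 * o1 - ξ ^ 2 * o2 - b * (Z * y - W * ξ) * hxy
    have g5 : a0 * (y ^ 4 + ξ ^ 4) + a1 * y ^ 2 + a2 + a3 * ξ ^ 2 + b * Z ^ 2 = 0 := by
      linear_combination y ^ 4 * e5 - (a0 * ξ ^ 4 + a2 + b * Z ^ 2) * hxy4
        - (a1 * y ^ 2 + a3 * ξ ^ 2 * (ξ ^ 2 * y ^ 2 + 1)) * hxy2
    have g6 : a0 * (y ^ 4 + ξ ^ 4) + a1 * ξ ^ 2 + a2 + a3 * y ^ 2 + b * W ^ 2 = 0 := by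
      linear_combination ξ ^ 4 * e6 - (a0 * y ^ 4 + a2 + b * W ^ 2) * hxy4
        - (a1 * ξ ^ 2 + a3 * y ^ 2 * (ξ ^ 2 * y ^ 2 + 1)) * hxy2
    have hprod : b * ((Z - W) * ((Z - ξ) * (Z - y))) = 0 := by
      linear_combination Z * (g5 - g6 - f1 - f2) + b * (Z - W) * (hxy - hZW)
    rw [mul_eq_zero, mul_eq_zero, mul_eq_zero, sub_eq_zero, sub_eq_zero, sub_eq_zero] at hprod
    rcases hprod with h | h | h | h
    · exact hAℓ h
    · have : ξ ^ (4 * m) = ξ ^ 2 := by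
        have : X ^ 4 = ξ ^ 2 := by
          rw [hX4]
          linear_combination ξ ^ 2 * (Z * h + hZW)
        rw [← this, hX]; ring
      have h1 : ξ ^ (4 * m - 2) = 1 := by
        apply mul_right_cancel₀ (pow_ne_zero 2 hx0)
        rw [← pow_add, one_mul, ← this]
        congr 1
        omega
      have h2 := (hξ.pow_eq_one_iff_dvd _).mp h1
      have h3 : 4 ∣ 2 * q + 2 := by obtain ⟨k, rfl⟩ := hodd; omega
      have h4 := h3.trans h2
      omega
    · have h1 : ξ ^ (2 * m) = ξ ^ 2 := by
        rw [mul_comm, pow_mul, ← hX, hXZ, h, sq]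
      have h2 := hξ.pow_inj (by omega) (by omega) h1
      omega
    · have h1 : ξ ^ (2 * m) = ξ ^ 0 := by
        rw [mul_comm, pow_mul, ← hX, hXZ, h, mul_comm, hxy, pow_zero]
      have h2 := hξ.pow_inj (by omega) (by omega) h1
      omega
end
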